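/- Let d ≥ 2 and let 0 < α ≤ 1. There exists a unique real number m ∈ (0,1] with the following property: for every open bounded set Ω ⊆ ℝ^d, every g ∈ L^∞_α, and every pair of disjoint open balls B₊, B₋ ⊂ ℝ^d with |B₋| = m·|B₊| > 0, one has |Ω|^{2/d} λ₁^g(Ω) ≥ |B₊ ∪ B₋|^{2/d} λ₁^{χ_α}(B₊ ∪ B₋), where χ_α is the bang-bang function associated with B₋ and α. Moreover, this unique m satisfies m ≥ α^{d/(d-1)}. -/

import Mathlib

open MeasureTheory Metric Set Filter

open scoped Classical ENNReal

noncomputable section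

/-- The Rayleigh quotient of `u : ℝ^d → ℝ`. -/
def rayleigh (d : ℕ) (u : EuclideanSpace ℝ (Fin d) → ℝ) : ℝ :=
  (∫ x, ‖gradient u x‖ ^ 2) / (∫ x, (u x) ^ 2)

/-- A trial function for the Dirichlet eigenvalue on `Ω`: Lipschitz, vanishing outside `Ω`,
and not almost everywhere zero. -/
def IsDirTrial (d : ℕ) (Ω : Set (EuclideanSpace ℝ (Fin d)))
    (u : EuclideanSpace ℝ (Fin d) → ℝ) : Prop :=
  (∃ K, LipschitzWith K u) ∧ (∀ x ∉ Ω, u x = 0) ∧ ¬ (u =ᵐ[volume] fun _ => (0 : ℝ))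

/-- The first Dirichlet eigenvalue of `Ω`. -/
def dirichletEV (d : ℕ) (Ω : Set (EuclideanSpace ℝ (Fin d))) : ℝ :=
  sInf { r | ∃ u, IsDirTrial d Ω u ∧ rayleigh d u = r }

/-- The first twisted eigenvalue of `Ω` with orthogonality constraint `g`. -/
def twistedEV (d : ℕ) (Ω : Set (EuclideanSpace ℝ (Fin d)))
    (g : EuclideanSpace ℝ (Fin d) → ℝ) : ℝ :=
  sInf { r | ∃ u, IsDirTrial d Ω u ∧ (∫ x, u x * g x) = 0 ∧ rayleigh d u = r }

/-- `u` is a minimizer for the first twisted eigenvalue `λ₁^g(Ω)`. -/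
def IsTwistedMin (d : ℕ) (Ω : Set (EuclideanSpace ℝ (Fin d)))
    (g u : EuclideanSpace ℝ (Fin d) → ℝ) : Prop :=
  IsDirTrial d Ω u ∧ (∫ x, u x * g x) = 0 ∧ rayleigh d u = twistedEV d Ω g

/-- The bang-bang function equal to `1` on `Bm` and `α` elsewhere. -/
def chiBang (d : ℕ) (α : ℝ) (Bm : Set (EuclideanSpace ℝ (Fin d))) :
    EuclideanSpace ℝ (Fin d) → ℝ :=
  fun x => if x ∈ Bm then 1 else α

/-- `m` is a good measure ratio for the parameter `α`: the scaled twisted eigenvalue of any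
open bounded nonempty set with any constraint in `L^∞_α` is bounded below by the scaled
twisted eigenvalue of any pair of disjoint balls with measure ratio `m`, endowed with the
bang-bang constraint. -/
def GoodRatio (d : ℕ) (α m : ℝ) : Prop :=
  ∀ Ω : Set (EuclideanSpace ℝ (Fin d)), IsOpen Ω → Bornology.IsBounded Ω → Ω.Nonempty →
  ∀ g : EuclideanSpace ℝ (Fin d) → ℝ, Measurable g → (∀ᵐ x, α ≤ g x ∧ g x ≤ 1) →
  ∀ (cp cm : EuclideanSpace ℝ (Fin d)) (rp rm : ℝ), 0 < rp → 0 < rm →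
    Disjoint (ball cp rp) (ball cm rm) →
    (volume (ball cm rm)).toReal = m * (volume (ball cp rp)).toReal →
    (volume (ball cp rp ∪ ball cm rm)).toReal ^ ((2 : ℝ) / d) *
        twistedEV d (ball cp rp ∪ ball cm rm) (chiBang d α (ball cm rm)) ≤
      (volume Ω).toReal ^ ((2 : ℝ) / d) * twistedEV d Ω g

section PrekopaLeindler

open scoped Pointwise

/-- One-dimensional Brunn–Minkowski inequality. -/
theorem volume_add_le_of_add_mem {A B C : Set ℝ} (hA : MeasurableSet A) (hB : MeasurableSet B)
    (hA0 : A.Nonempty) (hB0 : B.Nonempty) (h : ∀ a ∈ A, ∀ b ∈ B, a + b ∈ C) :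
    volume A + volume B ≤ volume C := by
  obtain ⟨a₀, ha₀⟩ := hA0
  obtain ⟨b₀, hb₀⟩ := hB0
  have key : ∀ K ⊆ A, IsCompact K → K.Nonempty → ∀ L ⊆ B, IsCompact L → L.Nonempty →
      volume K + volume L ≤ volume C := by
    intro K hKA hK hK0 L hLB hL hL0
    have hM := hK.sSup_mem hK0
    have hm := hL.sInf_mem hL0
    have h1 : volume K = volume ((fun x => sInf L + x) '' K) := by
      rw [image_add_left, measure_preimage_add]
    have h2 : volume L = volume ((fun x => sSup K + x) '' L) := by
      rw [image_add_left, measure_preimage_add]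
    have hm2 : MeasurableSet ((fun x => sSup K + x) '' L) :=
      (hL.image (by fun_prop)).measurableSet
    rw [h1, h2, ← measure_union_add_inter _ hm2]
    have h3 : volume (((fun x => sInf L + x) '' K) ∩ ((fun x => sSup K + x) '' L)) = 0 := by
      refine measure_mono_null (t := {sInf L + sSup K}) ?_ (by simp)
      rintro _ ⟨⟨x, hx, rfl⟩, ⟨y, hy, hxy⟩⟩
      have := le_csSup hK.bddAbove hx
      have := csInf_le hL.bddBelow hy
      simp only [mem_singleton_iff] at hxy ⊢
      linarith
    rw [h3, add_zero]
    refine measure_mono ?_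
    rintro _ (⟨x, hx, rfl⟩ | ⟨x, hx, rfl⟩)
    · have := h _ (hKA hx) _ (hLB hm)
      rwa [add_comm] at this
    · exact h _ (hKA hM) _ (hLB hx)
  have key2 : ∀ K ⊆ A, IsCompact K → ∀ L ⊆ B, IsCompact L → volume K + volume L ≤ volume C := by
    intro K hKA hK L hLB hL
    refine le_trans ?_ (key (insert a₀ K) (insert_subset ha₀ hKA) (hK.insert _) (insert_nonempty _ _)
      (insert b₀ L) (insert_subset hb₀ hLB) (hL.insert _) (insert_nonempty _ _))
    exact add_le_add (measure_mono (subset_insert _ _)) (measure_mono (subset_insert _ _))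
  by_contra hlt
  rw [not_le] at hlt
  by_cases hA0 : volume A = 0
  · rw [hA0, zero_add] at hlt
    obtain ⟨L, hLB, hL, hlt'⟩ := hB.exists_lt_isCompact hlt
    have := key2 ∅ (empty_subset _) isCompact_empty L hLB hL
    simp only [measure_empty, zero_add] at this
    exact absurd hlt' (not_lt.2 this)
  by_cases hB0 : volume B = 0
  · rw [hB0, add_zero] at hlt
    obtain ⟨L, hLB, hL, hlt'⟩ := hA.exists_lt_isCompact hlt
    have := key2 L hLB hL ∅ (empty_subset _) isCompact_empty
    simp only [measure_empty, add_zero] at this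
    exact absurd hlt' (not_lt.2 this)
  obtain ⟨y, hy, z, hz, hyz⟩ := ENNReal.exists_lt_add_of_lt_add hlt hA0 hB0
  obtain ⟨K, hKA, hK, hy'⟩ := hA.exists_lt_isCompact hy
  obtain ⟨L, hLB, hL, hz'⟩ := hB.exists_lt_isCompact hz
  exact absurd (key2 K hKA hK L hLB hL) (not_le.2 (hyz.trans_le (add_le_add hy'.le hz'.le)))

theorem ENNReal_geom_le_arith (a b : ℝ≥0∞) {t : ℝ} (ht0 : 0 < t) (ht1 : t < 1) :
    a ^ (1 - t) * b ^ t ≤ ENNReal.ofReal (1 - t) * a + ENNReal.ofReal t * b := by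
  have ht : 0 < 1 - t := by linarith
  by_cases ha : a = ∞
  · rw [ha, ENNReal.mul_top (by simpa using ht), top_add]; exact le_top
  by_cases hb : b = ∞
  · rw [hb, ENNReal.mul_top (by simpa using ht0), add_top]; exact le_top
  lift a to NNReal using ha
  lift b to NNReal using hb
  have e1 : ENNReal.ofReal (1 - t) = ((1 - t).toNNReal : NNReal) := rfl
  have e2 : ENNReal.ofReal t = (t.toNNReal : NNReal) := rfl
  have h1 : ((1 - t).toNNReal : ℝ) = 1 - t := Real.coe_toNNReal _ ht.le
  have h2 : (t.toNNReal : ℝ) = t := Real.coe_toNNReal _ ht0.le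
  have := NNReal.geom_mean_le_arith_mean2_weighted (1 - t).toNNReal t.toNNReal a b
    (by rw [← NNReal.coe_inj]; push_cast; rw [h1, h2]; ring)
  rw [h1, h2] at this
  rw [← ENNReal.coe_rpow_of_nonneg _ ht.le, ← ENNReal.coe_rpow_of_nonneg _ ht0.le, e1, e2]
  exact_mod_cast this

/-- The Prékopa–Leindler inequality in dimension one for functions with supremum one. -/
theorem prekopa_leindler_real_aux {t : ℝ} (ht0 : 0 < t) (ht1 : t < 1) {f g h : ℝ → ℝ≥0∞}
    (hf : Measurable f) (hg : Measurable g) (hh : Measurable h)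
    (hf1 : ⨆ x, f x = 1) (hg1 : ⨆ x, g x = 1)
    (H : ∀ x y, f x ^ (1 - t) * g y ^ t ≤ h ((1 - t) * x + t * y)) :
    ENNReal.ofReal (1 - t) * (∫⁻ x, f x) + ENNReal.ofReal t * ∫⁻ x, g x ≤ ∫⁻ x, h x := by
  have ht : 0 < 1 - t := by linarith
  have layer : ∀ p : ℝ → ℝ≥0∞, Measurable p → (⨆ x, p x = 1) →
      ∫⁻ x, p x = ∫⁻ s in Ioo (0 : ℝ) 1, volume {x | ENNReal.ofReal s < p x} := by
    intro p hp hp1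
    have hle : ∀ x, p x ≤ 1 := fun x => hp1 ▸ le_iSup p x
    have hne : ∀ x, p x ≠ ∞ := fun x => ne_top_of_le_ne_top ENNReal.one_ne_top (hle x)
    have h1 := lintegral_eq_lintegral_meas_lt (f := fun x => (p x).toReal) volume
      (Eventually.of_forall fun x => ENNReal.toReal_nonneg) hp.ennreal_toReal.aemeasurable
    simp only [ENNReal.ofReal_toReal (hne _)] at h1
    rw [h1, ← Ioo_union_Ici_eq_Ioi (zero_lt_one), lintegral_union measurableSet_Ici]
    · have h2 : ∫⁻ s in Ici (1 : ℝ), volume {a | s < (p a).toReal} = 0 := by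
        rw [setLIntegral_congr_fun measurableSet_Ici (g := fun _ => 0), lintegral_zero]
        intro s hs
        have : {a | s < (p a).toReal} = ∅ := by
          ext a
          simp only [mem_ofPred_eq, mem_empty_iff_false, iff_false, not_lt]
          refine le_trans ?_ (show (1 : ℝ) ≤ s from hs)
          exact ENNReal.toReal_le_of_le_ofReal zero_le_one (by simpa using hle a)
        simp only [this, measure_empty]
      rw [h2, add_zero]
      refine setLIntegral_congr_fun measurableSet_Ioo fun s hs => ?_
      congr 1
      ext a
      exact (ENNReal.ofReal_lt_iff_lt_toReal hs.1.le (hne a)).symm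
    · rw [Set.disjoint_left]
      intro s hs hs'
      exact absurd hs.2 (not_lt.2 hs')
  have layer' : ∫⁻ s in Ioo (0 : ℝ) 1, volume {x | ENNReal.ofReal s < h x} ≤ ∫⁻ x, h x := by
    have h1 := lintegral_eq_lintegral_meas_lt (f := fun x => (min (h x) 1).toReal) volume
      (Eventually.of_forall fun x => ENNReal.toReal_nonneg)
      (hh.min measurable_const).ennreal_toReal.aemeasurable
    have hne : ∀ x, min (h x) 1 ≠ ∞ := fun x =>
      ne_top_of_le_ne_top ENNReal.one_ne_top (min_le_right _ _)
    simp only [ENNReal.ofReal_toReal (hne _)] at h1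
    calc _ ≤ ∫⁻ s in Ioi (0 : ℝ), volume {a | s < (min (h a) 1).toReal} := by
          refine le_trans ?_ (lintegral_mono_set (s := Ioo (0 : ℝ) 1) (fun s hs => hs.1))
          refine setLIntegral_mono' measurableSet_Ioo fun s hs => measure_mono ?_
          intro a ha
          refine (ENNReal.ofReal_lt_iff_lt_toReal hs.1.le (hne a)).1 (lt_min ha ?_)
          simpa using hs.2
      _ ≤ _ := by
          rw [← h1]
          exact lintegral_mono fun x => min_le_left _ _
  refine le_trans ?_ layer'
  rw [layer f hf hf1, layer g hg hg1, ← lintegral_const_mul' _ _ ENNReal.ofReal_ne_top,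
    ← lintegral_const_mul' _ _ ENNReal.ofReal_ne_top]
  have meas : ∀ p : ℝ → ℝ≥0∞, Measurable fun s : ℝ => volume {x | ENNReal.ofReal s < p x} :=
    fun p => Antitone.measurable fun s s' hs => measure_mono fun x hx =>
      lt_of_le_of_lt (ENNReal.ofReal_le_ofReal hs) hx
  rw [← lintegral_add_left ((meas f).const_mul _)]
  refine setLIntegral_mono' measurableSet_Ioo fun s hs => ?_
  have scale : ∀ (r : ℝ), 0 < r → ∀ S : Set ℝ, ENNReal.ofReal r * volume S = volume (r • S) := by
    intro r hr S
    rw [Measure.addHaar_smul]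
    simp [abs_of_pos hr]
  have ne : ∀ p : ℝ → ℝ≥0∞, (⨆ x, p x = 1) → {x | ENNReal.ofReal s < p x}.Nonempty := by
    intro p hp
    have : ENNReal.ofReal s < ⨆ x, p x := by rw [hp]; simpa using hs.2
    exact lt_iSup_iff.1 this
  have ms : ∀ p : ℝ → ℝ≥0∞, Measurable p → MeasurableSet {x | ENNReal.ofReal s < p x} :=
    fun p hp => measurableSet_lt measurable_const hp
  rw [scale _ ht, scale _ ht0]
  refine volume_add_le_of_add_mem ((ms f hf).const_smul_of_ne_zero ht.ne')
    ((ms g hg).const_smul_of_ne_zero ht0.ne') ((ne f hf1).smul_set) ((ne g hg1).smul_set) ?_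
  rintro _ ⟨x, hx, rfl⟩ _ ⟨y, hy, rfl⟩
  refine lt_of_lt_of_le ?_ (H x y)
  have e : ENNReal.ofReal s = ENNReal.ofReal s ^ (1 - t) * ENNReal.ofReal s ^ t := by
    rw [← ENNReal.rpow_add_of_nonneg _ _ ht.le ht0.le]
    simp
  rw [e]
  exact ENNReal.mul_lt_mul (ENNReal.rpow_lt_rpow hx ht) (ENNReal.rpow_lt_rpow hy ht0)

theorem prekopa_leindler_real {t : ℝ} (ht0 : 0 < t) (ht1 : t < 1) {f g h : ℝ → ℝ≥0∞}
    (hf : Measurable f) (hg : Measurable g) (hh : Measurable h)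
    (H : ∀ x y, f x ^ (1 - t) * g y ^ t ≤ h ((1 - t) * x + t * y)) :
    (∫⁻ x, f x) ^ (1 - t) * (∫⁻ x, g x) ^ t ≤ ∫⁻ x, h x := by
  have ht : 0 < 1 - t := by linarith
  have bdd : ∀ N : ℕ, (∫⁻ x, min (f x) N) ^ (1 - t) * (∫⁻ x, min (g x) N) ^ t ≤ ∫⁻ x, h x := by
    intro N
    set F := fun x => min (f x) N with hF
    set G := fun x => min (g x) N with hG
    set a := ⨆ x, F x with ha
    set b := ⨆ x, G x with hb
    have haN : a ≠ ∞ := ne_top_of_le_ne_top (ENNReal.natCast_ne_top N)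
      (iSup_le fun x => min_le_right _ _)
    have hbN : b ≠ ∞ := ne_top_of_le_ne_top (ENNReal.natCast_ne_top N)
      (iSup_le fun x => min_le_right _ _)
    by_cases ha0 : a = 0
    · have : ∀ x, F x = 0 := fun x => le_antisymm (ha0 ▸ le_iSup F x) zero_le
      have h0 : ∫⁻ x, F x = 0 := by simp only [this, lintegral_zero]
      rw [h0, ENNReal.zero_rpow_of_pos ht, zero_mul]
      exact zero_le
    by_cases hb0 : b = 0
    · have : ∀ x, G x = 0 := fun x => le_antisymm (hb0 ▸ le_iSup G x) zero_le
      have h0 : ∫⁻ x, G x = 0 := by simp only [this, lintegral_zero]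
      rw [h0, ENNReal.zero_rpow_of_pos ht0, mul_zero]
      exact zero_le
    set c := a ^ (1 - t) * b ^ t with hc
    have hc0 : c ≠ 0 := mul_ne_zero (by simp [ENNReal.rpow_eq_zero_iff, ha0, haN])
      (by simp [ENNReal.rpow_eq_zero_iff, hb0, hbN])
    have hcN : c ≠ ∞ := ENNReal.mul_ne_top (ENNReal.rpow_ne_top_of_nonneg ht.le haN)
      (ENNReal.rpow_ne_top_of_nonneg ht0.le hbN)
    have mF : Measurable F := hf.min measurable_const
    have mG : Measurable G := hg.min measurable_const
    have sup : ∀ (p : ℝ → ℝ≥0∞) (q : ℝ≥0∞), (⨆ x, p x = q) → q ≠ 0 → q ≠ ∞ →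
        ⨆ x, q⁻¹ * p x = 1 := by
      intro p q hp hq hq'
      rw [← ENNReal.mul_iSup, hp, ENNReal.inv_mul_cancel hq hq']
    have h1 := prekopa_leindler_real_aux ht0 ht1 (mF.const_mul a⁻¹) (mG.const_mul b⁻¹)
      (hh.const_mul c⁻¹) (sup F a rfl ha0 haN) (sup G b rfl hb0 hbN) (by
        intro x y
        rw [ENNReal.mul_rpow_of_nonneg _ _ ht.le, ENNReal.mul_rpow_of_nonneg _ _ ht0.le,
          ENNReal.inv_rpow, ENNReal.inv_rpow, hc,
          ENNReal.mul_inv (Or.inr (ENNReal.rpow_ne_top_of_nonneg ht0.le hbN))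
            (Or.inl (ENNReal.rpow_ne_top_of_nonneg ht.le haN)), mul_mul_mul_comm]
        gcongr
        refine le_trans ?_ (H x y)
        gcongr
        · exact min_le_left _ _
        · exact min_le_left _ _)
    have h2 := (ENNReal_geom_le_arith (∫⁻ x, a⁻¹ * F x) (∫⁻ x, b⁻¹ * G x) ht0 ht1).trans h1
    rw [lintegral_const_mul _ mF, lintegral_const_mul _ mG, lintegral_const_mul _ hh,
      ENNReal.mul_rpow_of_nonneg _ _ ht.le, ENNReal.mul_rpow_of_nonneg _ _ ht0.le,
      mul_mul_mul_comm, ENNReal.inv_rpow, ENNReal.inv_rpow,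
      ← ENNReal.mul_inv (Or.inr (ENNReal.rpow_ne_top_of_nonneg ht0.le hbN))
        (Or.inl (ENNReal.rpow_ne_top_of_nonneg ht.le haN)), ← hc] at h2
    exact (ENNReal.mul_le_mul_iff_right (ENNReal.inv_ne_zero.2 hcN) (ENNReal.inv_ne_top.2 hc0)).1 h2
  have lim : ∀ p : ℝ → ℝ≥0∞, Measurable p →
      Tendsto (fun N : ℕ => ∫⁻ x, min (p x) N) atTop (nhds (∫⁻ x, p x)) := by
    intro p hp
    refine lintegral_tendsto_of_tendsto_of_monotone
      (fun N => (hp.min measurable_const).aemeasurable) ?_ ?_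
    · refine Eventually.of_forall fun x N M hNM => ?_
      exact min_le_min le_rfl (by exact_mod_cast hNM)
    · refine Eventually.of_forall fun x => ?_
      have := (tendsto_const_nhds (x := p x) (f := atTop (α := ℕ))).min ENNReal.tendsto_nat_nhds_top
      simpa using this
  by_cases hF0 : ∫⁻ x, f x = 0
  · simp [hF0, ht]
  by_cases hG0 : ∫⁻ x, g x = 0
  · simp [hG0, ht0]
  refine le_of_tendsto' (ENNReal.Tendsto.mul ((lim f hf).ennrpow_const (1 - t)) (Or.inl ?_)
    ((lim g hg).ennrpow_const t) (Or.inl ?_)) bdd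
  · simp [ENNReal.rpow_eq_zero_iff, hF0, ht1.le]
  · simp [ENNReal.rpow_eq_zero_iff, hG0, ht0.le]

/-- The Prékopa–Leindler inequality. -/
theorem prekopa_leindler {t : ℝ} (ht0 : 0 < t) (ht1 : t < 1) {n : ℕ} :
    ∀ {f g h : (Fin n → ℝ) → ℝ≥0∞} (_ : Measurable f) (_ : Measurable g) (_ : Measurable h)
    (_ : ∀ x y, f x ^ (1 - t) * g y ^ t ≤ h ((1 - t) • x + t • y)),
    (∫⁻ x, f x) ^ (1 - t) * (∫⁻ x, g x) ^ t ≤ ∫⁻ x, h x := by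
  induction n with
  | zero =>
    intro f g h hf hg hh H
    simp only [lintegral_unique, mul_one, volume_pi, Measure.pi_univ,
      Finset.univ_eq_empty, Finset.prod_empty]
    refine le_trans (H _ _) (le_of_eq ?_)
    congr 1
    exact Subsingleton.elim _ _
  | succ n ih =>
    intro f g h hf hg hh H
    let e := (MeasurableEquiv.piFinSuccAbove (fun _ : Fin (n + 1) => ℝ) 0).symm
    have he := (volume_preserving_piFinSuccAbove (fun _ : Fin (n + 1) => ℝ) 0).symm
    have fub : ∀ p : (Fin (n + 1) → ℝ) → ℝ≥0∞, Measurable p →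
        ∫⁻ x, p x = ∫⁻ x : ℝ, ∫⁻ y : Fin n → ℝ, p (e (x, y)) := by
      intro p hp
      rw [← he.lintegral_comp hp, Measure.volume_eq_prod, lintegral_prod]
      exact (hp.comp e.measurable).aemeasurable
    have marg : ∀ p : (Fin (n + 1) → ℝ) → ℝ≥0∞, Measurable p →
        Measurable fun x : ℝ => ∫⁻ y : Fin n → ℝ, p (e (x, y)) := by
      intro p hp
      exact (hp.comp e.measurable).lintegral_prod_right'
    rw [fub f hf, fub g hg, fub h hh]
    refine prekopa_leindler_real ht0 ht1 (marg f hf) (marg g hg) (marg h hh) fun x y => ?_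
    have meas : ∀ p : (Fin (n + 1) → ℝ) → ℝ≥0∞, Measurable p → ∀ x : ℝ,
        Measurable fun y : Fin n → ℝ => p (e (x, y)) := fun p hp x =>
      (hp.comp e.measurable).comp measurable_prodMk_left
    refine ih (meas f hf x) (meas g hg y) (meas h hh _) fun x' y' => ?_
    refine (H _ _).trans (le_of_eq ?_)
    congr 1
    ext i
    refine Fin.cases ?_ (fun j => ?_) i <;>
      simp [e, MeasurableEquiv.piFinSuccAbove]

theorem prekopa_leindler_set {d : ℕ} {t : ℝ} (ht0 : 0 < t) (ht1 : t < 1)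
    {A B C : Set (EuclideanSpace ℝ (Fin d))} (hA : MeasurableSet A) (hB : MeasurableSet B)
    (hC : MeasurableSet C) (H : ∀ x ∈ A, ∀ y ∈ B, (1 - t) • x + t • y ∈ C) :
    volume A ^ (1 - t) * volume B ^ t ≤ volume C := by
  have ht : 0 < 1 - t := by linarith
  let e := MeasurableEquiv.toLp 2 (Fin d → ℝ)
  have he : MeasurePreserving e := PiLp.volume_preserving_toLp (Fin d)
  have key : ∀ S : Set (EuclideanSpace ℝ (Fin d)), MeasurableSet S →
      volume S = ∫⁻ x, (e ⁻¹' S).indicator 1 x := by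
    intro S hS
    rw [lintegral_indicator_one (e.measurable hS), he.measure_preimage hS.nullMeasurableSet]
  have ms : ∀ S : Set (EuclideanSpace ℝ (Fin d)), MeasurableSet S →
      Measurable ((e ⁻¹' S).indicator (1 : (Fin d → ℝ) → ℝ≥0∞)) := fun S hS =>
    measurable_one.indicator (e.measurable hS)
  rw [key A hA, key B hB, key C hC]
  refine prekopa_leindler ht0 ht1 (ms A hA) (ms B hB) (ms C hC) fun x y => ?_
  by_cases hx : x ∈ e ⁻¹' A
  · by_cases hy : y ∈ e ⁻¹' B
    · have : (1 - t) • x + t • y ∈ e ⁻¹' C := H _ hx _ hy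
      simp [hx, hy, this]
    · simp [hy, ht0]
  · simp [hx, ht]

/-- Brunn–Minkowski inequality for the sum of a set with a ball. -/
theorem volume_ball_add_le_thickening {d : ℕ} {A : Set (EuclideanSpace ℝ (Fin d))}
    (hA : MeasurableSet A) {r s : ℝ} (hr : 0 < r) (hs : 0 < s)
    (h : volume (ball (0 : EuclideanSpace ℝ (Fin d)) r) ≤ volume A) :
    volume (ball (0 : EuclideanSpace ℝ (Fin d)) (r + s)) ≤ volume (thickening s A) := by
  have hrs : 0 < r + s := by linarith
  set t := s / (r + s) with ht
  have ht0 : 0 < t := by positivity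
  have ht1 : 1 - t = r / (r + s) := by rw [ht]; field_simp; ring
  have ht1' : 0 < 1 - t := by rw [ht1]; positivity
  have hmul : (1 - t)⁻¹ * r = r + s := by rw [ht1]; field_simp
  have h1 : volume (ball (0 : EuclideanSpace ℝ (Fin d)) (r + s)) ≤ volume ((1 - t)⁻¹ • A) := by
    have : ball (0 : EuclideanSpace ℝ (Fin d)) (r + s) = (1 - t)⁻¹ • ball 0 r := by
      rw [_root_.smul_ball (by positivity)]
      simp [abs_of_pos, ht1', hmul]
    rw [this, Measure.addHaar_smul, Measure.addHaar_smul]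
    gcongr
  have h2 := prekopa_leindler_set ht0 (by linarith) (hA.const_smul_of_ne_zero (inv_ne_zero ht1'.ne'))
    (measurableSet_ball (x := (0 : EuclideanSpace ℝ (Fin d))) (ε := r + s))
    (isOpen_thickening (δ := s) (E := A)).measurableSet (by
      rintro _ ⟨x, hx, rfl⟩ y hy
      refine mem_thickening_iff.2 ⟨x, hx, ?_⟩
      simp only [smul_smul, mul_inv_cancel₀ ht1'.ne', one_smul, dist_eq_norm, add_sub_cancel_left,
        norm_smul, Real.norm_eq_abs, abs_of_pos ht0]
      rw [mem_ball_zero_iff] at hy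
      calc t * ‖y‖ < t * (r + s) := by gcongr
        _ = s := by rw [ht]; field_simp)
  refine le_trans ?_ h2
  have e : ∀ X : ℝ≥0∞, X = X ^ (1 - t) * X ^ t := by
    intro X
    rw [← ENNReal.rpow_add_of_nonneg _ _ ht1'.le ht0.le]
    simp
  conv_lhs => rw [e (volume _)]
  gcongr

end PrekopaLeindler

section RadialODE

open Real

/-- The radial solution of `Δφ + φ = 0` in dimension `n + 2`, up to normalization. -/
def radPhi (n : ℕ) (r : ℝ) : ℝ := ∫ θ in (0 : ℝ)..π, cos (r * cos θ) * sin θ ^ n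

/-- Minus the derivative of `radPhi`. -/
def radPsi (n : ℕ) (r : ℝ) : ℝ := ∫ θ in (0 : ℝ)..π, cos θ * sin (r * cos θ) * sin θ ^ n

/-- The primitive of `radPhi n r * r ^ (n + 1)` vanishing at `0`. -/
def radH (n : ℕ) (r : ℝ) : ℝ := r ^ (n + 1) * radPsi n r

/-- The integral of `(radPhi n s - radPhi n r) * s ^ (n + 1)` for `s` in `(0, r)`. -/
def radD (n : ℕ) (r : ℝ) : ℝ := radH n r - radPhi n r * r ^ (n + 2) / (n + 2)

theorem hasDerivAt_radPhi (n : ℕ) (r : ℝ) : HasDerivAt (radPhi n) (-radPsi n r) r := by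
  have h := intervalIntegral.hasDerivAt_integral_of_dominated_loc_of_deriv_le (μ := volume)
    (F := fun (r θ : ℝ) => cos (r * cos θ) * sin θ ^ n)
    (F' := fun (r θ : ℝ) => -(cos θ * sin (r * cos θ) * sin θ ^ n)) (x₀ := r) (a := 0) (b := π)
    (s := univ) (bound := fun _ => 1) univ_mem
    (Eventually.of_forall fun x => (by fun_prop : Continuous _).aestronglyMeasurable)
    ((by fun_prop : Continuous _).intervalIntegrable _ _)
    ((by fun_prop : Continuous _).aestronglyMeasurable)
    (Eventually.of_forall fun θ _ x _ => ?_) (by simp)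
    (Eventually.of_forall fun θ _ x _ => ?_)
  · have h2 := h.2
    rw [intervalIntegral.integral_neg] at h2
    exact h2
  · rw [norm_neg, norm_mul, norm_mul, norm_pow]
    simp only [norm_eq_abs]
    have h1 := abs_cos_le_one θ
    have h2 := abs_sin_le_one (x * cos θ)
    have h3 := pow_le_one₀ (n := n) (abs_nonneg (sin θ)) (abs_sin_le_one θ)
    exact mul_le_one₀ (mul_le_one₀ h1 (abs_nonneg _) h2) (by positivity) h3
  · have h1 : HasDerivAt (fun x => cos (x * cos θ)) (-sin (x * cos θ) * (1 * cos θ)) x :=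
      ((hasDerivAt_id x).mul_const _).cos
    exact (h1.mul_const (sin θ ^ n)).congr_deriv (by ring)

theorem hasDerivAt_radPsi_aux (n : ℕ) (r : ℝ) : HasDerivAt (radPsi n)
    (∫ θ in (0 : ℝ)..π, cos θ ^ 2 * cos (r * cos θ) * sin θ ^ n) r := by
  have h := intervalIntegral.hasDerivAt_integral_of_dominated_loc_of_deriv_le (μ := volume)
    (F := fun (r θ : ℝ) => cos θ * sin (r * cos θ) * sin θ ^ n)
    (F' := fun (r θ : ℝ) => cos θ ^ 2 * cos (r * cos θ) * sin θ ^ n) (x₀ := r) (a := 0) (b := π)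
    (s := univ) (bound := fun _ => 1) univ_mem
    (Eventually.of_forall fun x => (by fun_prop : Continuous _).aestronglyMeasurable)
    ((by fun_prop : Continuous _).intervalIntegrable _ _)
    ((by fun_prop : Continuous _).aestronglyMeasurable)
    (Eventually.of_forall fun θ _ x _ => ?_) (by simp)
    (Eventually.of_forall fun θ _ x _ => ?_)
  · exact h.2
  · rw [norm_mul, norm_mul, norm_pow, norm_pow]
    simp only [norm_eq_abs]
    have h1 := pow_le_one₀ (n := 2) (abs_nonneg (cos θ)) (abs_cos_le_one θ)
    have h2 := abs_cos_le_one (x * cos θ)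
    have h3 := pow_le_one₀ (n := n) (abs_nonneg (sin θ)) (abs_sin_le_one θ)
    exact mul_le_one₀ (mul_le_one₀ h1 (abs_nonneg _) h2) (by positivity) h3
  · have h1 : HasDerivAt (fun x => sin (x * cos θ)) (cos (x * cos θ) * (1 * cos θ)) x :=
      ((hasDerivAt_id x).mul_const _).sin
    exact ((h1.const_mul (cos θ)).mul_const (sin θ ^ n)).congr_deriv (by ring)

theorem radPsi_eq (n : ℕ) (r : ℝ) : (n + 1) * radPsi n r =
    r * ∫ θ in (0 : ℝ)..π, cos (r * cos θ) * sin θ ^ (n + 2) := by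
  have h := intervalIntegral.integral_mul_deriv_eq_deriv_mul (a := 0) (b := π)
    (u := fun θ => sin (r * cos θ)) (u' := fun θ => cos (r * cos θ) * (r * -sin θ))
    (v := fun θ => sin θ ^ (n + 1)) (v' := fun θ => ((n + 1 : ℕ) : ℝ) * sin θ ^ n * cos θ)
    (fun θ _ => ((hasDerivAt_cos θ).const_mul r).sin)
    (fun θ _ => ((hasDerivAt_sin θ).pow (n + 1)).congr_deriv (by simp))
    ((by fun_prop : Continuous _).intervalIntegrable _ _)
    ((by fun_prop : Continuous _).intervalIntegrable _ _)
  simp only [sin_pi, sin_zero, ne_eq, Nat.add_eq_zero_iff, one_ne_zero, and_false,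
    not_false_eq_true, zero_pow, mul_zero, sub_self, zero_sub] at h
  rw [radPsi, ← intervalIntegral.integral_const_mul, ← intervalIntegral.integral_const_mul,
    ← sub_eq_zero]
  rw [← add_eq_zero_iff_eq_neg, ← sub_neg_eq_add, ← intervalIntegral.integral_neg] at h
  convert h using 3 <;> (ext θ; push_cast; ring)

theorem hasDerivAt_radPsi (n : ℕ) {r : ℝ} (hr : r ≠ 0) :
    HasDerivAt (radPsi n) (radPhi n r - (n + 1) * radPsi n r / r) r := by
  refine (hasDerivAt_radPsi_aux n r).congr_deriv ?_
  rw [radPsi_eq, mul_div_cancel_left₀ _ hr, radPhi, ← intervalIntegral.integral_sub]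
  · congr 1
    ext θ
    rw [cos_sq']
    ring
  all_goals exact (by fun_prop : Continuous _).intervalIntegrable _ _

theorem radPsi_zero (n : ℕ) : radPsi n 0 = 0 := by simp [radPsi]

theorem radPhi_zero_pos (n : ℕ) : 0 < radPhi n 0 := by
  simpa [radPhi] using integral_sin_pow_pos (n := n)

theorem hasDerivAt_radH (n : ℕ) (r : ℝ) : HasDerivAt (radH n) (radPhi n r * r ^ (n + 1)) r := by
  rcases eq_or_ne r 0 with rfl | hr
  · refine ((hasDerivAt_pow (n + 1) (0 : ℝ)).mul (hasDerivAt_radPsi_aux n 0)).congr_deriv ?_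
    simp [radPsi_zero]
  · refine ((hasDerivAt_pow (n + 1) r).mul (hasDerivAt_radPsi n hr)).congr_deriv ?_
    push_cast
    field_simp
    ring

theorem hasDerivAt_radD (n : ℕ) (r : ℝ) : HasDerivAt (radD n) (r * radH n r / (n + 2)) r := by
  refine ((hasDerivAt_radH n r).sub
    (((hasDerivAt_radPhi n r).mul (hasDerivAt_pow (n + 2) r)).div_const _)).congr_deriv ?_
  have : (n : ℝ) + 2 ≠ 0 := by positivity
  rw [radH]
  push_cast
  field_simp
  ring

theorem continuous_radPhi (n : ℕ) : Continuous (radPhi n) :=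
  continuous_iff_continuousAt.2 fun r => (hasDerivAt_radPhi n r).continuousAt

theorem continuous_radPsi (n : ℕ) : Continuous (radPsi n) :=
  continuous_iff_continuousAt.2 fun r => (hasDerivAt_radPsi_aux n r).continuousAt

theorem continuous_radH (n : ℕ) : Continuous (radH n) :=
  continuous_iff_continuousAt.2 fun r => (hasDerivAt_radH n r).continuousAt

theorem continuous_radD (n : ℕ) : Continuous (radD n) :=
  continuous_iff_continuousAt.2 fun r => (hasDerivAt_radD n r).continuousAt

theorem radH_zero (n : ℕ) : radH n 0 = 0 := by simp [radH]

theorem radD_zero (n : ℕ) : radD n 0 = 0 := by simp [radD, radH]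

theorem lipschitzWith_radPhi (n : ℕ) : ∃ K, LipschitzWith K (radPhi n) := by
  refine ⟨Real.toNNReal π, lipschitzWith_of_nnnorm_deriv_le
    (fun r => (hasDerivAt_radPhi n r).differentiableAt) fun r => ?_⟩
  rw [(hasDerivAt_radPhi n r).deriv, nnnorm_neg, ← NNReal.coe_le_coe, coe_nnnorm,
    coe_toNNReal _ pi_pos.le, radPsi]
  refine (intervalIntegral.norm_integral_le_of_norm_le_const (C := 1) fun θ _ => ?_).trans
    (by simp [abs_of_pos pi_pos])
  rw [norm_mul, norm_mul, norm_pow]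
  simp only [norm_eq_abs]
  exact mul_le_one₀ (mul_le_one₀ (abs_cos_le_one θ) (abs_nonneg _) (abs_sin_le_one _))
    (by positivity) (pow_le_one₀ (abs_nonneg _) (abs_sin_le_one θ))

/-- The first point after `x` where a continuous function stops being positive. -/
theorem exists_first_nonpos {f : ℝ → ℝ} (hf : Continuous f) {x y : ℝ} (hxy : x ≤ y)
    (hx : 0 < f x) (hy : f y ≤ 0) : ∃ z, x < z ∧ z ≤ y ∧ f z = 0 ∧ ∀ w, x ≤ w → w < z → 0 < f w := by
  have hc : IsCompact (Icc x y ∩ {w | f w ≤ 0}) :=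
    isCompact_Icc.inter_right (isClosed_le hf continuous_const)
  have hm := hc.sInf_mem ⟨y, ⟨hxy, le_rfl⟩, hy⟩
  set z := sInf (Icc x y ∩ {w | f w ≤ 0}) with hz
  have hz0 : f z ≤ 0 := hm.2
  have hlt : ∀ w, x ≤ w → w < z → 0 < f w := by
    intro w hxw hwz
    by_contra hcon
    exact absurd (csInf_le hc.bddBelow ⟨⟨hxw, hwz.le.trans hm.1.2⟩, not_lt.1 hcon⟩) (not_le.2 hwz)
  have hxz : x < z := lt_of_le_of_ne hm.1.1 fun h => by rw [← h] at hz0; linarith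
  refine ⟨z, hxz, hm.1.2, le_antisymm hz0 ?_, hlt⟩
  refine ge_of_tendsto (x := nhdsWithin z (Iio z)) (hf.continuousAt.mono_left nhdsWithin_le_nhds) ?_
  filter_upwards [Ioo_mem_nhdsLT hxz] with w hw
  exact (hlt w hw.1.le hw.2).le

theorem exists_radPhi_nonpos (n : ℕ) : ∃ r, 0 ≤ r ∧ radPhi n r ≤ 0 := by
  by_contra! hcon
  set r₀ : ℝ := 2 * (n + 1) with hr₀
  have hr₀0 : 0 < r₀ := by positivity
  have hder : ∀ r, r₀ ≤ r → HasDerivAt (fun r => arctan (radPsi n r / radPhi n r) - 3 / 4 * r)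
      (1 / (1 + (radPsi n r / radPhi n r) ^ 2) *
        (1 - (n + 1) / r * (radPsi n r / radPhi n r) + (radPsi n r / radPhi n r) ^ 2) - 3 / 4) r := by
    intro r hr
    have hr0 : 0 < r := hr₀0.trans_le hr
    have hp := (hcon r hr0.le).ne'
    have h1 := ((hasDerivAt_radPsi n hr0.ne').div (hasDerivAt_radPhi n r) hp).arctan
    refine (h1.sub ((hasDerivAt_id r).const_mul (3 / 4))).congr_deriv ?_
    congr 1
    · congr 1
      field_simp
      ring
    · simp
  have hmono : MonotoneOn (fun r => arctan (radPsi n r / radPhi n r) - 3 / 4 * r) (Ici r₀) := by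
    refine monotoneOn_of_deriv_nonneg (convex_Ici _)
      (fun r hr => (hder r hr).continuousAt.continuousWithinAt)
      (fun r hr => (hder r (interior_subset hr)).differentiableAt.differentiableWithinAt)
      fun r hr => ?_
    have hr := interior_subset hr
    rw [(hder r hr).deriv]
    set F := radPsi n r / radPhi n r
    have hr0 : 0 < r := hr₀0.trans_le hr
    have h1 : (n + 1) / r ≤ 1 / 2 := by
      rw [div_le_iff₀ hr0]
      have : r₀ ≤ r := hr
      linarith
    have h0 : 0 ≤ (n + 1) / r := by positivity
    have h2 : (n + 1) / r * F ≤ (1 + F ^ 2) / 4 := by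
      rcases le_total F 0 with hF | hF
      · nlinarith
      · nlinarith [sq_nonneg (F - 1)]
    rw [sub_nonneg, one_div_mul_eq_div, le_div_iff₀ (by positivity)]
    nlinarith
  have := hmono (mem_Ici.2 le_rfl) (mem_Ici.2 (by linarith : r₀ ≤ r₀ + 8)) (by linarith)
  simp only at this
  have h1 := neg_pi_div_two_lt_arctan (radPsi n r₀ / radPhi n r₀)
  have h2 := arctan_lt_pi_div_two (radPsi n (r₀ + 8) / radPhi n (r₀ + 8))
  linarith [pi_lt_d2]

/-- The first zero of `radPhi`. -/
theorem exists_radPhi_zero (n : ℕ) :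
    ∃ a, 0 < a ∧ radPhi n a = 0 ∧ ∀ r, 0 ≤ r → r < a → 0 < radPhi n r := by
  obtain ⟨r, hr, hr0⟩ := exists_radPhi_nonpos n
  obtain ⟨z, h1, -, h2, h3⟩ := exists_first_nonpos (continuous_radPhi n) hr (radPhi_zero_pos n) hr0
  exact ⟨z, h1, h2, h3⟩

theorem strictMonoOn_of_hasDerivAt_pos {f f' : ℝ → ℝ} {x y : ℝ}
    (hf : ∀ r ∈ Icc x y, HasDerivAt f (f' r) r) (hf' : ∀ r ∈ Ioo x y, 0 < f' r) :
    StrictMonoOn f (Icc x y) := by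
  refine strictMonoOn_of_deriv_pos (convex_Icc _ _)
    (fun r hr => (hf r hr).continuousAt.continuousWithinAt) fun r hr => ?_
  rw [interior_Icc] at hr
  rw [(hf r (Ioo_subset_Icc_self hr)).deriv]
  exact hf' r hr

theorem strictAntiOn_of_hasDerivAt_neg {f f' : ℝ → ℝ} {x y : ℝ}
    (hf : ∀ r ∈ Icc x y, HasDerivAt f (f' r) r) (hf' : ∀ r ∈ Ioo x y, f' r < 0) :
    StrictAntiOn f (Icc x y) := by
  refine strictAntiOn_of_deriv_neg (convex_Icc _ _)
    (fun r hr => (hf r hr).continuousAt.continuousWithinAt) fun r hr => ?_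
  rw [interior_Icc] at hr
  rw [(hf r (Ioo_subset_Icc_self hr)).deriv]
  exact hf' r hr

theorem radD_pos_of_radH_pos {n : ℕ} {b : ℝ} (hb : 0 < b) (h : ∀ r, 0 < r → r < b → 0 < radH n r) :
    0 < radD n b := by
  have := strictMonoOn_of_hasDerivAt_pos (x := 0) (y := b) (fun r _ => hasDerivAt_radD n r)
    (fun r hr => div_pos (mul_pos hr.1 (h r hr.1 hr.2)) (by positivity))
    (left_mem_Icc.2 hb.le) (right_mem_Icc.2 hb.le) hb
  rwa [radD_zero] at this

theorem strictMonoOn_radH {n : ℕ} {a : ℝ} (ha : ∀ r, 0 ≤ r → r < a → 0 < radPhi n r) :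
    StrictMonoOn (radH n) (Icc 0 a) :=
  strictMonoOn_of_hasDerivAt_pos (fun r _ => hasDerivAt_radH n r)
    fun r hr => mul_pos (ha r hr.1.le hr.2) (pow_pos hr.1 _)

theorem radH_pos_of_le {n : ℕ} {a : ℝ} (ha : ∀ r, 0 ≤ r → r < a → 0 < radPhi n r)
    {r : ℝ} (hr : 0 < r) (hra : r ≤ a) : 0 < radH n r := by
  have := strictMonoOn_radH ha (left_mem_Icc.2 (hr.le.trans hra)) ⟨hr.le, hra⟩ hr
  rwa [radH_zero] at this

theorem radH_pos {n : ℕ} {a : ℝ} (ha0 : 0 < a) (hphi : radPhi n a = 0)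
    (ha : ∀ r, 0 ≤ r → r < a → 0 < radPhi n r) {r : ℝ} (hr : 0 < r)
    (hra : r ^ (n + 2) ≤ 2 * a ^ (n + 2)) : 0 < radH n r := by
  by_contra! hcon
  have har : a ≤ r := by
    by_contra! h
    exact absurd (radH_pos_of_le ha hr h.le) (not_lt.2 hcon)
  obtain ⟨b, hab, hbr, hb0, hb⟩ := exists_first_nonpos (continuous_radH n) har
    (radH_pos_of_le ha ha0 le_rfl) hcon
  have hb_pos : 0 < b := ha0.trans hab
  have hH : ∀ s, 0 < s → s < b → 0 < radH n s := fun s hs hsb => by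
    rcases le_total s a with h | h
    · exact radH_pos_of_le ha hs h
    · exact hb s h hsb
  have hd : (0 : ℝ) < n + 2 := by positivity
  have hK : ∀ x y, 0 < x → y < b → x < y →
      radH n y / y ^ (2 * n + 2) < radH n x / x ^ (2 * n + 2) := by
    intro x y hx hy hxy
    refine strictAntiOn_of_hasDerivAt_neg (x := x) (y := y)
      (f := fun r => radH n r / r ^ (2 * n + 2))
      (f' := fun r => (radPhi n r * r ^ (n + 1) * r ^ (2 * n + 2) -
        radH n r * ((2 * n + 2 : ℕ) * r ^ (2 * n + 1))) / (r ^ (2 * n + 2)) ^ 2)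
      (fun s hs => ?_) (fun s hs => ?_) (left_mem_Icc.2 hxy.le) (right_mem_Icc.2 hxy.le) hxy
    · exact (hasDerivAt_radH n s).div (hasDerivAt_pow (2 * n + 2) s)
        (pow_ne_zero _ (hx.trans_le hs.1).ne')
    · have hs0 : 0 < s := hx.trans hs.1
      have hsb : s < b := hs.2.trans hy
      have h1 : 0 < radD n s := radD_pos_of_radH_pos hs0 fun r h h' => hH r h (h'.trans hsb)
      have h2 := hH s hs0 hsb
      refine div_neg_of_neg_of_pos ?_ (by positivity)
      have h3 : radPhi n s * s ^ (n + 2) = (n + 2) * (radH n s - radD n s) := by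
        rw [radD]; field_simp; ring
      have h4 : radPhi n s * s ^ (n + 1) * s ^ (2 * n + 2) =
          s ^ (2 * n + 1) * (radPhi n s * s ^ (n + 2)) := by ring
      rw [h4, h3]
      have h5 : s ^ (2 * n + 1) * ((n + 2) * (radH n s - radD n s)) -
          radH n s * ((2 * n + 2 : ℕ) * s ^ (2 * n + 1)) =
          -(s ^ (2 * n + 1) * (n * radH n s + (n + 2) * radD n s)) := by push_cast; ring
      rw [h5]
      have : 0 < n * radH n s + (n + 2) * radD n s :=
        add_pos_of_nonneg_of_pos (by positivity) (by positivity)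
      exact neg_neg_of_pos (by positivity)
  set k := radH n a / a ^ (2 * n + 2) with hk
  have hk0 : 0 < k := div_pos (hH a ha0 hab) (by positivity)
  set e : ℝ → ℝ := fun s => radPhi n s + k * (s ^ (n + 2) - a ^ (n + 2)) / (n + 2) with he
  have hed : ∀ s, HasDerivAt e (-radPsi n s + k * s ^ (n + 1)) s := by
    intro s
    refine ((hasDerivAt_radPhi n s).add ((((hasDerivAt_pow (n + 2) s).sub_const
      (a ^ (n + 2))).const_mul k).div_const _)).congr_deriv ?_
    push_cast
    field_simp
  have hed' : ∀ s, 0 < s → -radPsi n s + k * s ^ (n + 1) =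
      s ^ (n + 1) * (k - radH n s / s ^ (2 * n + 2)) := by
    intro s hs
    rw [radH]
    have : s ^ (2 * n + 2) = s ^ (n + 1) * s ^ (n + 1) := by ring
    rw [this]
    field_simp
    ring
  have hea : e a = 0 := by simp [he, hphi]
  have he0 : ∀ s, 0 < s → s < b → s ≠ a → 0 < e s := by
    intro s hs hsb hsa
    rcases lt_or_gt_of_ne hsa with h | h
    · rw [← hea]
      refine strictAntiOn_of_hasDerivAt_neg (x := s) (y := a) (fun t _ => hed t) (fun t ht => ?_)
        (left_mem_Icc.2 h.le) (right_mem_Icc.2 h.le) h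
      rw [hed' t (hs.trans ht.1)]
      exact mul_neg_of_pos_of_neg (pow_pos (hs.trans ht.1) _)
        (sub_neg.2 (hK t a (hs.trans ht.1) hab ht.2))
    · rw [← hea]
      refine strictMonoOn_of_hasDerivAt_pos (x := a) (y := s) (fun t _ => hed t) (fun t ht => ?_)
        (left_mem_Icc.2 h.le) (right_mem_Icc.2 h.le) h
      rw [hed' t (ha0.trans ht.1)]
      exact mul_pos (pow_pos (ha0.trans ht.1) _)
        (sub_pos.2 (hK a t ha0 (ht.2.trans hsb) ht.1))
  set G : ℝ → ℝ := fun s => radH n s +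
    k * (s ^ (2 * (n + 2)) / (2 * (n + 2)) - a ^ (n + 2) * s ^ (n + 2) / (n + 2)) / (n + 2) with hG
  have hGd : ∀ s, HasDerivAt G (s ^ (n + 1) * e s) s := by
    intro s
    refine ((hasDerivAt_radH n s).add (((((hasDerivAt_pow (2 * (n + 2)) s).div_const
      (2 * (n + 2) : ℝ)).sub (((hasDerivAt_pow (n + 2) s).const_mul (a ^ (n + 2))).div_const
      (n + 2 : ℝ))).const_mul k).div_const _)).congr_deriv ?_
    have : 2 * (n + 2) - 1 = (n + 1) + (n + 2) := by omega
    rw [this]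
    push_cast
    simp only [he]
    field_simp
    ring
  have hG1 : G 0 < G a := by
    refine strictMonoOn_of_hasDerivAt_pos (x := 0) (y := a) (fun t _ => hGd t) (fun t ht => ?_)
        (left_mem_Icc.2 ha0.le) (right_mem_Icc.2 ha0.le) ha0
    exact mul_pos (pow_pos ht.1 _) (he0 t ht.1 (ht.2.trans hab) ht.2.ne)
  have hG2 : G a < G b := by
    refine strictMonoOn_of_hasDerivAt_pos (x := a) (y := b) (fun t _ => hGd t) (fun t ht => ?_)
        (left_mem_Icc.2 hab.le) (right_mem_Icc.2 hab.le) hab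
    exact mul_pos (pow_pos (ha0.trans ht.1) _) (he0 t (ha0.trans ht.1) ht.2 ht.1.ne')
  have hG0 : G 0 = 0 := by simp [hG, radH_zero]
  have hGb : G b = k * b ^ (n + 2) * (b ^ (n + 2) - 2 * a ^ (n + 2)) / (2 * (n + 2) ^ 2) := by
    simp only [hG, hb0]
    field_simp
    ring
  have hble : b ^ (n + 2) ≤ 2 * a ^ (n + 2) :=
    (pow_le_pow_left₀ hb_pos.le hbr _).trans hra
  have : G b ≤ 0 := by
    rw [hGb]
    refine div_nonpos_of_nonpos_of_nonneg ?_ (by positivity)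
    exact mul_nonpos_of_nonneg_of_nonpos (by positivity) (by linarith)
  linarith

end RadialODE

section VolumeFunction

open Real

/-- The first positive zero of `radPhi`. -/
def radZero (n : ℕ) : ℝ := Classical.choose (exists_radPhi_zero n)

theorem radZero_pos (n : ℕ) : 0 < radZero n := (Classical.choose_spec (exists_radPhi_zero n)).1

theorem radPhi_radZero (n : ℕ) : radPhi n (radZero n) = 0 :=
  (Classical.choose_spec (exists_radPhi_zero n)).2.1

theorem radPhi_pos {n : ℕ} {r : ℝ} (hr : 0 ≤ r) (hra : r < radZero n) : 0 < radPhi n r :=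
  (Classical.choose_spec (exists_radPhi_zero n)).2.2 r hr hra

/-- The radii for which the Dirichlet Laplacian of the union of two balls of that total volume
is controlled. -/
def IsAdmRadius (n : ℕ) (r : ℝ) : Prop := 0 < r ∧ r ^ (n + 2) ≤ 2 * radZero n ^ (n + 2)

theorem IsAdmRadius.mono {n : ℕ} {r s : ℝ} (h : IsAdmRadius n r) (hs : 0 < s) (hsr : s ≤ r) :
    IsAdmRadius n s :=
  ⟨hs, (pow_le_pow_left₀ hs.le hsr _).trans h.2⟩

theorem IsAdmRadius.radH_pos {n : ℕ} {r : ℝ} (h : IsAdmRadius n r) : 0 < radH n r :=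
  _root_.radH_pos (radZero_pos n) (radPhi_radZero n) (fun _ => radPhi_pos) h.1 h.2

theorem IsAdmRadius.radPsi_pos {n : ℕ} {r : ℝ} (h : IsAdmRadius n r) : 0 < radPsi n r := by
  have := h.radH_pos
  rw [radH] at this
  exact pos_of_mul_pos_right this (pow_pos h.1 _).le

theorem IsAdmRadius.radD_pos {n : ℕ} {r : ℝ} (h : IsAdmRadius n r) : 0 < radD n r :=
  radD_pos_of_radH_pos h.1 fun _ hs hsr => (h.mono hs hsr.le).radH_pos

theorem IsAdmRadius.radPhi_neg {n : ℕ} {r : ℝ} (h : IsAdmRadius n r) (hr : radZero n < r) :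
    radPhi n r < 0 := by
  rw [← radPhi_radZero n]
  refine strictAntiOn_of_hasDerivAt_neg (x := radZero n) (y := r)
    (fun s _ => hasDerivAt_radPhi n s) (fun s hs => ?_) (left_mem_Icc.2 hr.le)
    (right_mem_Icc.2 hr.le) hr
  exact neg_neg_of_pos (h.mono ((radZero_pos n).trans hs.1) hs.2.le).radPsi_pos

theorem IsAdmRadius.radPhi_lt {n : ℕ} {r s : ℝ} (h : IsAdmRadius n r) (hs : 0 ≤ s) (hsr : s < r) :
    radPhi n r < radPhi n s := by
  refine strictAntiOn_of_hasDerivAt_neg (x := s) (y := r)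
    (fun s _ => hasDerivAt_radPhi n s) (fun t ht => ?_) (left_mem_Icc.2 hsr.le)
    (right_mem_Icc.2 hsr.le) hsr
  exact neg_neg_of_pos (h.mono (hs.trans_lt ht.1) ht.2.le).radPsi_pos

theorem IsAdmRadius.radH_mul_radD_lt {n : ℕ} {r : ℝ} (h : IsAdmRadius n r) :
    radH n r * radD n r < (n + 2) * radD n r ^ 2 + r ^ 2 * radH n r ^ 2 / (n + 2) := by
  have hH := h.radH_pos
  have hD := h.radD_pos
  have hr := h.1
  rcases le_or_gt r (radZero n) with hra | hra
  · have h1 : radD n r ≤ r ^ 2 * radH n r / (2 * (n + 2)) := by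
      have hm : MonotoneOn (fun s => s ^ 2 * radH n r / (2 * (n + 2)) - radD n s) (Icc 0 r) := by
        have hd : ∀ s, HasDerivAt (fun s => s ^ 2 * radH n r / (2 * (n + 2)) - radD n s)
            (s * (radH n r - radH n s) / (n + 2)) s := fun s => by
          refine ((((hasDerivAt_pow 2 s).mul_const (radH n r)).div_const _).sub
            (hasDerivAt_radD n s)).congr_deriv ?_
          field_simp
          push_cast
          ring
        refine monotoneOn_of_deriv_nonneg (convex_Icc _ _)
          (fun s _ => (hd s).continuousAt.continuousWithinAt)
          (fun s _ => (hd s).differentiableAt.differentiableWithinAt) fun s hs => ?_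
        rw [interior_Icc] at hs
        rw [(hd s).deriv]
        have := strictMonoOn_radH (n := n) (fun _ => radPhi_pos) ⟨hs.1.le, hs.2.le.trans hra⟩
          ⟨hr.le, hra⟩ hs.2
        have h3 := hs.1
        have : 0 < radH n r - radH n s := by linarith
        positivity
      have := hm (left_mem_Icc.2 hr.le) (right_mem_Icc.2 hr.le) hr.le
      simp only [radD_zero] at this
      norm_num at this
      exact this
    calc radH n r * radD n r ≤ radH n r * (r ^ 2 * radH n r / (2 * (n + 2))) := by gcongr
      _ ≤ r ^ 2 * radH n r ^ 2 / (n + 2) := by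
        rw [mul_div_assoc', div_le_div_iff₀ (by positivity) (by positivity)]
        have : 0 ≤ r ^ 2 * radH n r ^ 2 * (n + 2) := by positivity
        nlinarith
      _ < _ := by
        have : 0 < (n + 2) * radD n r ^ 2 := by positivity
        linarith
  · have h1 := h.radPhi_neg hra
    have h2 : radH n r ≤ radD n r := by
      rw [radD]
      have : radPhi n r * r ^ (n + 2) / (n + 2) ≤ 0 :=
        div_nonpos_of_nonpos_of_nonneg (mul_nonpos_of_nonpos_of_nonneg h1.le (by positivity))
          (by positivity)
      linarith
    have h3 : 0 < r ^ 2 * radH n r ^ 2 / (n + 2) := by positivity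
    have h4 : radH n r * radD n r ≤ radD n r ^ 2 := by nlinarith
    have h5 : 0 ≤ (n + 1) * radD n r ^ 2 := by positivity
    nlinarith

/-- Optimal constant in the one-dimensional radial inequality. -/
def radC (n : ℕ) (r : ℝ) : ℝ := radPhi n r / radD n r

/-- The square root of minus the derivative of `radC` with respect to volume. -/
def radT (n : ℕ) (r : ℝ) : ℝ := radPsi n r / radD n r

theorem IsAdmRadius.radT_pos {n : ℕ} {r : ℝ} (h : IsAdmRadius n r) : 0 < radT n r :=
  div_pos h.radPsi_pos h.radD_pos

theorem IsAdmRadius.radT_mul {n : ℕ} {r : ℝ} (h : IsAdmRadius n r) :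
    radT n r * r ^ (n + 1) = 1 + radC n r * (r ^ (n + 2) / (n + 2)) := by
  have hD := h.radD_pos.ne'
  rw [radT, radC]
  field_simp
  rw [radD, radH]
  field_simp
  ring

theorem IsAdmRadius.hasDerivAt_radC {n : ℕ} {r : ℝ} (h : IsAdmRadius n r) :
    HasDerivAt (radC n) (-radT n r ^ 2 * r ^ (n + 1)) r := by
  have hD := h.radD_pos.ne'
  refine ((hasDerivAt_radPhi n r).div (hasDerivAt_radD n r) hD).congr_deriv ?_
  rw [radT]
  field_simp
  have : radH n r = radD n r + radPhi n r * r ^ (n + 2) / (n + 2) := by rw [radD]; ring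
  have h2 : radPsi n r * r ^ (n + 1) = radH n r := by rw [radH]; ring
  have h3 : radPhi n r * r * radH n r = radPsi n r * (radPhi n r * r ^ (n + 2)) := by
    rw [radH]; ring
  have h4 : radPhi n r * r ^ (n + 2) = (n + 2) * (radH n r - radD n r) := by
    rw [this]; field_simp; ring
  have h5 : radPsi n r ^ 2 * r ^ (n + 1) * (n + 2) = radPsi n r * radH n r * (n + 2) := by
    rw [radH]; ring
  have h6 : r ^ (n + 1) * radPsi n r ^ 2 = radPsi n r * radH n r := by
    rw [radH]; ring
  linear_combination (-1 : ℝ) * h3 - radPsi n r * h4 + (n + 2) * h6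

theorem IsAdmRadius.radT_lt {n : ℕ} {r s : ℝ} (h : IsAdmRadius n r) (hs : 0 < s) (hsr : s < r) :
    radT n r < radT n s := by
  have ha : ∀ t ∈ Icc s r, IsAdmRadius n t := fun t ht => h.mono (hs.trans_le ht.1) ht.2
  refine strictAntiOn_of_hasDerivAt_neg (x := s) (y := r) (f := radT n)
    (fun t ht => (hasDerivAt_radPsi n (ha t ht).1.ne').div (hasDerivAt_radD n t)
      (ha t ht).radD_pos.ne') (fun t ht => ?_) (left_mem_Icc.2 hsr.le) (right_mem_Icc.2 hsr.le) hsr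
  have ht := ha t (Ioo_subset_Icc_self ht)
  have ht0 := ht.1
  have hD := ht.radD_pos
  refine div_neg_of_neg_of_pos ?_ (by positivity)
  have h1 := ht.radH_mul_radD_lt
  have h4 : radPhi n t * t ^ (n + 2) = (n + 2) * (radH n t - radD n t) := by
    rw [radD]; field_simp; ring
  have h2 : t ^ (n + 2) * ((radPhi n t - (n + 1) * radPsi n t / t) * radD n t -
      radPsi n t * (t * radH n t / (n + 2))) = radH n t * radD n t -
      ((n + 2) * radD n t ^ 2 + t ^ 2 * radH n t ^ 2 / (n + 2)) := by
    have h5 : t ^ (n + 2) * ((radPhi n t - (n + 1) * radPsi n t / t) * radD n t -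
      radPsi n t * (t * radH n t / (n + 2))) = (radPhi n t * t ^ (n + 2)) * radD n t
        - (n + 1) * radH n t * radD n t - t ^ 2 * radH n t ^ 2 / (n + 2) := by
      have : radH n t = t ^ (n + 1) * radPsi n t := rfl
      rw [this]
      field_simp
      ring
    rw [h5, h4]
    ring
  have h3 : t ^ (n + 2) * ((radPhi n t - (n + 1) * radPsi n t / t) * radD n t -
      radPsi n t * (t * radH n t / (n + 2))) < 0 := by rw [h2]; linarith
  exact neg_of_mul_neg_right h3 (by positivity)

/-- The radius of a ball as a function of its normalized volume. -/
def radOf (n : ℕ) (v : ℝ) : ℝ := ((n + 2) * v) ^ (1 / ((n : ℝ) + 2))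

theorem radOf_pow (n : ℕ) {v : ℝ} (hv : 0 ≤ v) : radOf n v ^ (n + 2) = (n + 2) * v := by
  rw [radOf, ← rpow_natCast, ← rpow_mul (by positivity)]
  push_cast
  rw [one_div_mul_cancel (by positivity), rpow_one]

theorem radOf_pos (n : ℕ) {v : ℝ} (hv : 0 < v) : 0 < radOf n v := by
  rw [radOf]; positivity

theorem radOf_vol (n : ℕ) {r : ℝ} (hr : 0 ≤ r) : radOf n (r ^ (n + 2) / (n + 2)) = r := by
  rw [radOf, mul_div_cancel₀ _ (by positivity), ← rpow_natCast, ← rpow_mul hr]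
  push_cast
  rw [mul_one_div_cancel (by positivity), rpow_one]

theorem radOf_lt (n : ℕ) {v w : ℝ} (hv : 0 ≤ v) (hvw : v < w) : radOf n v < radOf n w := by
  rw [radOf, radOf]
  exact rpow_lt_rpow (by positivity) (by gcongr) (by positivity)

theorem hasDerivAt_radOf (n : ℕ) {v : ℝ} (hv : 0 < v) :
    HasDerivAt (radOf n) (1 / radOf n v ^ (n + 1)) v := by
  have h1 : HasDerivAt (fun v : ℝ => ((n : ℝ) + 2) * v) (n + 2) v := by
    simpa using (hasDerivAt_id v).const_mul ((n : ℝ) + 2)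
  have hp : 0 < ((n : ℝ) + 2) * v := by positivity
  refine (h1.rpow_const (p := 1 / ((n : ℝ) + 2)) (Or.inl hp.ne')).congr_deriv ?_
  rw [rpow_sub_one hp.ne']
  have h2 := radOf_pow n hv.le
  have h3 := radOf_pos n hv
  have h4 : (((n : ℝ) + 2) * v) ^ (1 / ((n : ℝ) + 2)) = radOf n v := rfl
  rw [h4, ← h2]
  field_simp
  ring

/-- The normalized volume of the ball of radius `radZero n`. -/
def volZero (n : ℕ) : ℝ := radZero n ^ (n + 2) / (n + 2)

theorem volZero_pos (n : ℕ) : 0 < volZero n := by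
  have := radZero_pos n
  rw [volZero]; positivity

theorem isAdmRadius_radOf {n : ℕ} {v : ℝ} (hv : 0 < v) (hv2 : v ≤ 2 * volZero n) :
    IsAdmRadius n (radOf n v) := by
  refine ⟨radOf_pos n hv, ?_⟩
  rw [radOf_pow n hv.le]
  rw [volZero, mul_div_assoc', le_div_iff₀ (by positivity)] at hv2
  linarith

/-- `radC` as a function of volume. -/
def volC (n : ℕ) (v : ℝ) : ℝ := radC n (radOf n v)

theorem volC_vol (n : ℕ) {r : ℝ} (hr : 0 ≤ r) : volC n (r ^ (n + 2) / (n + 2)) = radC n r := by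
  rw [volC, radOf_vol n hr]

theorem volC_volZero (n : ℕ) : volC n (volZero n) = 0 := by
  rw [volZero, volC_vol n (radZero_pos n).le, radC, radPhi_radZero, zero_div]

theorem hasDerivAt_volC {n : ℕ} {v : ℝ} (hv : 0 < v) (hv2 : v ≤ 2 * volZero n) :
    HasDerivAt (volC n) (-radT n (radOf n v) ^ 2) v := by
  have h := isAdmRadius_radOf hv hv2
  refine (h.hasDerivAt_radC.comp v (hasDerivAt_radOf n hv)).congr_deriv ?_
  have := h.1
  field_simp

theorem strictAntiOn_volC (n : ℕ) : StrictAntiOn (volC n) (Ioc 0 (2 * volZero n)) := by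
  refine strictAntiOn_of_deriv_neg (convex_Ioc _ _)
    (fun v hv => (hasDerivAt_volC hv.1 hv.2).continuousAt.continuousWithinAt) fun v hv => ?_
  have hv := interior_subset hv
  rw [(hasDerivAt_volC hv.1 hv.2).deriv]
  have := (isAdmRadius_radOf hv.1 hv.2).radT_pos
  exact neg_neg_of_pos (by positivity)

theorem strictConvexOn_volC (n : ℕ) : StrictConvexOn ℝ (Ioc 0 (2 * volZero n)) (volC n) := by
  refine StrictMonoOn.strictConvexOn_of_deriv (convex_Ioc _ _)
    (fun v hv => (hasDerivAt_volC hv.1 hv.2).continuousAt.continuousWithinAt) ?_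
  intro v hv w hw hvw
  have hv := interior_subset hv
  have hw := interior_subset hw
  rw [(hasDerivAt_volC hv.1 hv.2).deriv, (hasDerivAt_volC hw.1 hw.2).deriv]
  have h1 := (isAdmRadius_radOf hw.1 hw.2).radT_pos
  have h2 := (isAdmRadius_radOf hw.1 hw.2).radT_lt (radOf_pos n hv.1) (radOf_lt n hv.1.le hvw)
  exact neg_lt_neg (pow_lt_pow_left₀ h2 h1.le two_ne_zero)

theorem exists_lt_volC (n : ℕ) (M : ℝ) :
    ∃ δ, 0 < δ ∧ δ ≤ 2 * volZero n ∧ ∀ v, 0 < v → v < δ → M < volC n v := by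
  have h1 : Tendsto (radD n) (nhdsWithin 0 (Ioi 0)) (nhdsWithin 0 (Ioi 0)) := by
    refine tendsto_nhdsWithin_iff.2 ⟨?_, ?_⟩
    · have := (continuous_radD n).tendsto 0
      rw [radD_zero] at this
      exact this.mono_left nhdsWithin_le_nhds
    · filter_upwards [Ioo_mem_nhdsGT (radZero_pos n)] with r hr
      exact radD_pos_of_radH_pos hr.1 fun s hs hsr =>
        radH_pos_of_le (fun _ => radPhi_pos) hs (hsr.trans hr.2).le
  have h2 : Tendsto (radC n) (nhdsWithin 0 (Ioi 0)) atTop := by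
    have := Tendsto.pos_mul_atTop (radPhi_zero_pos n)
      (((continuous_radPhi n).tendsto 0).mono_left nhdsWithin_le_nhds) h1.inv_tendsto_nhdsGT_zero
    exact this.congr fun r => (div_eq_mul_inv _ _).symm
  obtain ⟨ρ, hρ, hρ'⟩ := mem_nhdsGT_iff_exists_Ioo_subset.1 (h2.eventually_gt_atTop M)
  have hρ : 0 < ρ := hρ
  refine ⟨min (ρ ^ (n + 2) / (n + 2)) (2 * volZero n),
    lt_min (by positivity) (by have := volZero_pos n; positivity), min_le_right _ _, ?_⟩
  intro v hv hvδ
  refine hρ' ⟨radOf_pos n hv, ?_⟩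
  rw [← radOf_vol n hρ.le]
  exact radOf_lt n hv.le (hvδ.trans_le (min_le_left _ _))

end VolumeFunction

section OptimalVolumes

open Real

theorem volC_continuousAt {n : ℕ} {v : ℝ} (hv : 0 < v) (hv2 : v ≤ 2 * volZero n) :
    ContinuousAt (volC n) v := (hasDerivAt_volC hv hv2).continuousAt

/-- Minimal volumes `(x, y)` under the constraint `volC n x + α ^ 2 * volC n y ≤ 0`. -/
theorem exists_optimal_volumes_aux (n : ℕ) {α : ℝ} (hα0 : 0 < α) :
    ∃ x y : ℝ, 0 < x ∧ 0 < y ∧ x + y ≤ 2 * volZero n ∧ volC n x + α ^ 2 * volC n y ≤ 0 ∧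
      ∀ x' y', 0 < x' → 0 < y' → x' + y' ≤ 2 * volZero n →
        volC n x' + α ^ 2 * volC n y' ≤ 0 → x + y ≤ x' + y' := by
  have hv0 := volZero_pos n
  set B := volC n (2 * volZero n) with hB
  have hBle : ∀ v, 0 < v → v ≤ 2 * volZero n → B ≤ volC n v := fun v h1 h2 =>
    (strictAntiOn_volC n).antitoneOn ⟨h1, h2⟩ ⟨by positivity, le_rfl⟩ h2
  obtain ⟨δ₁, hδ₁, -, h₁⟩ := exists_lt_volC n (-(α ^ 2 * B))
  obtain ⟨δ₂, hδ₂, -, h₂⟩ := exists_lt_volC n (-B / α ^ 2)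
  set K : Set (ℝ × ℝ) := {p | δ₁ ≤ p.1 ∧ δ₂ ≤ p.2 ∧ p.1 + p.2 ≤ 2 * volZero n} with hK
  have hKc : IsCompact K := by
    refine IsCompact.of_isClosed_subset
      ((isCompact_Icc (a := δ₁) (b := 2 * volZero n)).prod
        (isCompact_Icc (a := δ₂) (b := 2 * volZero n))) ?_ ?_
    · exact (isClosed_le continuous_const continuous_fst).inter
        ((isClosed_le continuous_const continuous_snd).inter
          (isClosed_le (continuous_fst.add continuous_snd) continuous_const))
    · rintro ⟨x, y⟩ ⟨h1, h2, h3⟩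
      simp only at h1 h2 h3
      exact ⟨⟨h1, by simp only; linarith⟩, ⟨h2, by simp only; linarith⟩⟩
  have hcont : ContinuousOn (fun p : ℝ × ℝ => volC n p.1 + α ^ 2 * volC n p.2) K := by
    rintro ⟨x, y⟩ ⟨h1, h2, h3⟩
    simp only at h1 h2 h3
    refine ContinuousAt.continuousWithinAt (ContinuousAt.add ?_ (ContinuousAt.mul
      continuousAt_const ?_))
    · exact ContinuousAt.comp (f := Prod.fst) (volC_continuousAt (by simp only; linarith)
        (by simp only; linarith)) continuousAt_fst
    · exact ContinuousAt.comp (f := Prod.snd) (volC_continuousAt (by simp only; linarith)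
        (by simp only; linarith)) continuousAt_snd
  have hFc : IsCompact (K ∩ {p | volC n p.1 + α ^ 2 * volC n p.2 ≤ 0}) :=
    hKc.of_isClosed_subset (hcont.preimage_isClosed_of_isClosed hKc.isClosed isClosed_Iic)
      inter_subset_left
  have hmem : ∀ x y, 0 < x → 0 < y → x + y ≤ 2 * volZero n →
      volC n x + α ^ 2 * volC n y ≤ 0 →
      (x, y) ∈ K ∩ {p | volC n p.1 + α ^ 2 * volC n p.2 ≤ 0} := by
    intro x y hx hy hxy h
    refine ⟨⟨?_, ?_, hxy⟩, h⟩
    · by_contra! hlt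
      have h3 := h₁ x hx hlt
      have h4 := mul_le_mul_of_nonneg_left (hBle y hy (by linarith)) (sq_nonneg α)
      linarith
    · by_contra! hlt
      have h3 := h₂ y hy hlt
      rw [div_lt_iff₀ (by positivity)] at h3
      have h4 := hBle x hx (by linarith)
      linarith
  obtain ⟨⟨x, y⟩, hxy, hmin⟩ := hFc.exists_isMinOn
    ⟨(volZero n, volZero n), hmem _ _ hv0 hv0 (by linarith) (by simp [volC_volZero])⟩
    (f := fun p => p.1 + p.2) (by fun_prop)
  refine ⟨x, y, hδ₁.trans_le hxy.1.1, hδ₂.trans_le hxy.1.2.1, hxy.1.2.2, hxy.2, ?_⟩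
  intro x' y' hx' hy' hs h
  exact hmin (hmem x' y' hx' hy' hs h)

theorem exists_optimal_volumes (n : ℕ) {α : ℝ} (hα0 : 0 < α) (hα1 : α ≤ 1) :
    ∃ x y : ℝ, 0 < x ∧ 0 < y ∧ y ≤ x ∧ x + y ≤ 2 * volZero n ∧ volC n x + α ^ 2 * volC n y = 0 ∧
      (∀ x' y', 0 < x' → 0 < y' → x' + y' ≤ x + y →
        volC n x' + α ^ 2 * volC n y' ≤ 0 → x' = x ∧ y' = y) ∧
      α * radOf n x ^ (n + 1) ≤ radOf n y ^ (n + 1) := by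
  obtain ⟨x, y, hx, hy, hs, h0, hmin⟩ := exists_optimal_volumes_aux n hα0
  have hstrict : ∀ x' y', 0 < x' → 0 < y' → x' + y' ≤ x + y →
      0 ≤ volC n x' + α ^ 2 * volC n y' := by
    intro x' y' hx' hy' hle
    by_contra! hneg
    have hcont : ContinuousAt (fun t => volC n t + α ^ 2 * volC n y') x' :=
      (volC_continuousAt hx' (by linarith)).add continuousAt_const
    have hev := (hcont.eventually_lt continuousAt_const hneg).filter_mono
      (nhdsWithin_le_nhds (s := Iio x'))
    obtain ⟨t, ht, ht0, htx⟩ := (hev.and (Ioo_mem_nhdsLT hx')).exists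
    have := hmin t y' ht0 hy' (by linarith) ht.le
    linarith
  have huniq : ∀ x' y', 0 < x' → 0 < y' → x' + y' ≤ x + y →
        volC n x' + α ^ 2 * volC n y' ≤ 0 → x' = x ∧ y' = y := by
    intro x' y' hx' hy' hle h
    have hge := hmin x' y' hx' hy' (by linarith) h
    have hxx : x' = x := by
      by_contra hne
      have hyne : y' ≠ y := fun hyy => hne (by linarith)
      have hsc := strictConvexOn_volC n
      have h1 := hsc.2 ⟨hx', by linarith⟩ ⟨hx, by linarith⟩ hne
        (one_half_pos (α := ℝ)) one_half_pos (by norm_num)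
      have h2 := hsc.2 ⟨hy', by linarith⟩ ⟨hy, by linarith⟩ hyne
        (one_half_pos (α := ℝ)) one_half_pos (by norm_num)
      simp only [smul_eq_mul] at h1 h2
      have h3 := hstrict (1 / 2 * x' + 1 / 2 * x) (1 / 2 * y' + 1 / 2 * y) (by positivity)
        (by positivity) (by linarith)
      have h4 := mul_lt_mul_of_pos_left h2 (by positivity : 0 < α ^ 2)
      linarith
    exact ⟨hxx, by linarith⟩
  have hzero : volC n x + α ^ 2 * volC n y = 0 := le_antisymm h0 (hstrict x y hx hy le_rfl)
  have hα2 : α ^ 2 ≤ 1 := pow_le_one₀ hα0.le hα1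
  have hyx : y ≤ x := by
    by_contra! hlt
    have h1 := strictAntiOn_volC n ⟨hx, by linarith⟩ ⟨hy, by linarith⟩ hlt
    have := huniq y x hy hx (by linarith) (by nlinarith)
    linarith
  refine ⟨x, y, hx, hy, hyx, hs, hzero, huniq, ?_⟩
  have hax := isAdmRadius_radOf (n := n) hx (by linarith)
  have hay := isAdmRadius_radOf (n := n) hy (by linarith)
  have hder : HasDerivAt (fun t => volC n (x + t) + α ^ 2 * volC n (y - t))
      (-radT n (radOf n x) ^ 2 + α ^ 2 * radT n (radOf n y) ^ 2) 0 := by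
    have e1 : HasDerivAt (volC n) (-radT n (radOf n x) ^ 2) (x + 0) := by
      rw [add_zero]; exact hasDerivAt_volC hx (by linarith)
    have e2 : HasDerivAt (volC n) (-radT n (radOf n y) ^ 2) (y - 0) := by
      rw [sub_zero]; exact hasDerivAt_volC hy (by linarith)
    refine ((e1.comp (0 : ℝ) ((hasDerivAt_id (0 : ℝ)).const_add x)).add ((e2.comp (0 : ℝ)
      ((hasDerivAt_id (0 : ℝ)).const_sub y)).const_mul (α ^ 2))).congr_deriv ?_
    ring
  have hloc : IsLocalMin (fun t => volC n (x + t) + α ^ 2 * volC n (y - t)) 0 := by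
    filter_upwards [Ioo_mem_nhds (neg_lt_zero.2 hx) hy] with t ht
    simp only [add_zero, sub_zero, hzero]
    exact hstrict _ _ (by linarith [ht.1]) (by linarith [ht.2]) (by linarith)
  have h1 := hloc.hasDerivAt_eq_zero hder
  have hTx := hax.radT_pos
  have hTy := hay.radT_pos
  have h2 : radT n (radOf n x) = α * radT n (radOf n y) := by
    have : radT n (radOf n x) ^ 2 = (α * radT n (radOf n y)) ^ 2 := by rw [mul_pow]; linarith
    exact (pow_left_inj₀ hTx.le (by positivity) two_ne_zero).1 this
  have hanti : volC n x ≤ volC n y :=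
    (strictAntiOn_volC n).antitoneOn ⟨hy, by linarith⟩ ⟨hx, by linarith⟩ hyx
  have hCy : 0 ≤ volC n y := by
    by_contra! hneg
    nlinarith
  have hCx : volC n x ≤ 0 := by nlinarith
  have h3 := hax.radT_mul
  have h4 := hay.radT_mul
  rw [radOf_pow n hx.le, mul_div_cancel_left₀ _ (by positivity)] at h3
  rw [radOf_pow n hy.le, mul_div_cancel_left₀ _ (by positivity)] at h4
  have h5 : radC n (radOf n x) * x ≤ 0 := mul_nonpos_of_nonpos_of_nonneg hCx hx.le
  have h6 : 0 ≤ radC n (radOf n y) * y := mul_nonneg hCy hy.le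
  rw [h2] at h3
  refine le_of_mul_le_mul_left ?_ hTy
  nlinarith

theorem rpow_le_div_of_radOf {n : ℕ} {α x y : ℝ} (hα0 : 0 < α) (hx : 0 < x) (hy : 0 < y)
    (h : α * radOf n x ^ (n + 1) ≤ radOf n y ^ (n + 1)) :
    α ^ (((n + 2 : ℕ) : ℝ) / (((n + 2 : ℕ) : ℝ) - 1)) ≤ y / x := by
  have hX := radOf_pos n hx
  have hY := radOf_pos n hy
  have h1 : α ≤ (radOf n y / radOf n x) ^ (n + 1) := by
    rw [div_pow, le_div_iff₀ (by positivity)]; exact h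
  have h2 : y / x = (radOf n y / radOf n x) ^ (n + 2) := by
    rw [div_pow, radOf_pow n hx.le, radOf_pow n hy.le]
    field_simp
  have h4 : (((n + 2 : ℕ) : ℝ) - 1) = ((n + 1 : ℕ) : ℝ) := by push_cast; ring
  rw [h2, h4]
  refine (rpow_le_rpow hα0.le h1 (by positivity)).trans (le_of_eq ?_)
  rw [← rpow_natCast, ← rpow_natCast, ← rpow_mul (by positivity)]
  congr 1
  field_simp

end OptimalVolumes

section RadialInequality

theorem absolutelyContinuousOnInterval_of_hasDerivAt {f f' : ℝ → ℝ}
    (hf : ∀ x, HasDerivAt f (f' x) x) (hf' : Continuous f') (a b : ℝ) :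
    AbsolutelyContinuousOnInterval f a b := by
  refine ContDiffOn.absolutelyContinuousOnInterval (ContDiff.contDiffOn ?_)
  refine contDiff_one_iff_deriv.2 ⟨fun x => (hf x).differentiableAt, ?_⟩
  rwa [show deriv f = f' from funext fun x => (hf x).deriv]

theorem LipschitzWith.intervalIntegrable_deriv_mul {w k : ℝ → ℝ} {K : NNReal}
    (hw : LipschitzWith K w) (hk : Continuous k) (a b : ℝ) :
    IntervalIntegrable (fun r => deriv w r * k r) volume a b := by
  rw [intervalIntegrable_iff]
  exact Integrable.bdd_mul (c := K) (intervalIntegrable_iff.1 (hk.intervalIntegrable a b))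
    (measurable_deriv w).aestronglyMeasurable
    (Eventually.of_forall fun x => norm_deriv_le_of_lipschitz hw)

theorem LipschitzWith.intervalIntegrable_deriv_sq_mul {w k : ℝ → ℝ} {K : NNReal}
    (hw : LipschitzWith K w) (hk : Continuous k) (a b : ℝ) :
    IntervalIntegrable (fun r => deriv w r ^ 2 * k r) volume a b := by
  rw [intervalIntegrable_iff]
  refine Integrable.bdd_mul (c := K ^ 2) (intervalIntegrable_iff.1 (hk.intervalIntegrable a b))
    ((measurable_deriv w).pow_const 2).aestronglyMeasurable
    (Eventually.of_forall fun x => ?_)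
  rw [norm_pow]
  exact pow_le_pow_left₀ (norm_nonneg _) (norm_deriv_le_of_lipschitz hw) 2

theorem LipschitzWith.intervalIntegrable_form {w k : ℝ → ℝ} {K : NNReal}
    (hw : LipschitzWith K w) (hk : Continuous k) (a b : ℝ) :
    IntervalIntegrable (fun r => (deriv w r ^ 2 - w r ^ 2) * k r) volume a b := by
  simp only [sub_mul]
  exact (hw.intervalIntegrable_deriv_sq_mul hk a b).sub
    (((hw.continuous.pow 2).mul hk).intervalIntegrable a b)

/-- The pointwise Picone inequality behind `radial_form_nonneg`. -/
theorem radial_picone {t h h' e H F : ℝ} (ht : 0 < t) (hH : H ≠ 0) :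
    -2 * (h' * e + h * (h * t)) + (2 * e * (h * t) * (F / H)
      + e ^ 2 * ((-(H / t) * H - F * (F * t)) / H ^ 2)) ≤ (h' ^ 2 - h ^ 2) * t := by
  have : (h' ^ 2 - h ^ 2) * t - (-2 * (h' * e + h * (h * t)) + (2 * e * (h * t) * (F / H)
      + e ^ 2 * ((-(H / t) * H - F * (F * t)) / H ^ 2))) =
      ((h' * t + e) ^ 2 + (h * t - e * F * t / H) ^ 2) / t := by
    field_simp
    ring
  have h2 : 0 ≤ ((h' * t + e) ^ 2 + (h * t - e * F * t / H) ^ 2) / t := by positivity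
  linarith

theorem radial_form_nonneg {n : ℕ} {R : ℝ} (hR : IsAdmRadius n R) {h : ℝ → ℝ} {K : NNReal}
    (hh : LipschitzWith K h) (hhR : h R = 0) (hint : ∫ r in (0 : ℝ)..R, h r * r ^ (n + 1) = 0) :
    0 ≤ ∫ r in (0 : ℝ)..R, (deriv h r ^ 2 - h r ^ 2) * r ^ (n + 1) := by
  have hR0 := hR.1
  set e : ℝ → ℝ := fun r => ∫ t in (0 : ℝ)..r, h t * t ^ (n + 1) with he
  have hcont : Continuous fun t => h t * t ^ (n + 1) := hh.continuous.mul (by fun_prop)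
  have hed : ∀ r, HasDerivAt e (h r * r ^ (n + 1)) r := fun r =>
    (hcont.integral_hasStrictDerivAt 0 r).hasDerivAt
  have hecont : Continuous e := continuous_iff_continuousAt.2 fun r => (hed r).continuousAt
  set M : ℝ := K * R with hM
  have hM0 : 0 ≤ M := by positivity
  have hbd : ∀ r, 0 ≤ r → r ≤ R → |h r| ≤ M := by
    intro r h0 h1
    have := hh.dist_le_mul r R
    rw [hhR, Real.dist_eq, Real.dist_eq, sub_zero, abs_sub_comm r R,
      abs_of_nonneg (by linarith : (0 : ℝ) ≤ R - r)] at this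
    refine this.trans ?_
    rw [hM]
    gcongr
    linarith
  have hebd : ∀ r, 0 < r → r ≤ R → |e r| ≤ M * r ^ (n + 2) := by
    intro r h0 h1
    have := intervalIntegral.norm_integral_le_of_norm_le_const (a := 0) (b := r)
      (f := fun t => h t * t ^ (n + 1)) (C := M * r ^ (n + 1)) (fun t ht => by
        rw [uIoc_of_le h0.le] at ht
        rw [norm_mul, norm_pow, Real.norm_eq_abs, Real.norm_eq_abs, abs_of_pos ht.1]
        have := hbd t ht.1.le (ht.2.trans h1)
        have := ht.1
        have := ht.2
        gcongr)
    rw [sub_zero, abs_of_pos h0] at this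
    calc |e r| ≤ M * r ^ (n + 1) * r := this
      _ = _ := by ring
  have key : ∀ ε, 0 < ε → ε < R → ε < radZero n →
      -((n + 4) * M ^ 2 * ε ^ (n + 2)) ≤
        ∫ r in ε..R, (deriv h r ^ 2 - h r ^ 2) * r ^ (n + 1) := by
    intro ε hε hεR hεa
    have hH : ∀ r ∈ uIcc ε R, radH n r ≠ 0 := fun r hr => by
      rw [uIcc_of_le hεR.le] at hr
      exact (hR.mono (hε.trans_le hr.1) hr.2).radH_pos.ne'
    have hder : ∀ r ∈ uIcc ε R, HasDerivAt (fun r => e r ^ 2 * (radPhi n r / radH n r))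
        (2 * e r * (h r * r ^ (n + 1)) * (radPhi n r / radH n r) + e r ^ 2 *
          ((-radPsi n r * radH n r - radPhi n r * (radPhi n r * r ^ (n + 1))) / radH n r ^ 2))
        r := by
      intro r hr
      exact (((hed r).pow 2).mul ((hasDerivAt_radPhi n r).div (hasDerivAt_radH n r)
        (hH r hr))).congr_deriv (by simp)
    have hphi := continuous_radPhi n
    have hpsi := continuous_radPsi n
    have hHc := continuous_radH n
    have hhc := hh.continuous
    have i1 : IntervalIntegrable (fun r =>
        2 * e r * (h r * r ^ (n + 1)) * (radPhi n r / radH n r) + e r ^ 2 *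
          ((-radPsi n r * radH n r - radPhi n r * (radPhi n r * r ^ (n + 1))) / radH n r ^ 2))
        volume ε R := by
      refine ContinuousOn.intervalIntegrable ?_
      refine ContinuousOn.add (ContinuousOn.mul (by fun_prop) (ContinuousOn.div (by fun_prop)
        (by fun_prop) hH)) (ContinuousOn.mul (by fun_prop) (ContinuousOn.div (by fun_prop)
        (by fun_prop) fun r hr => pow_ne_zero _ (hH r hr)))
    have e1 := intervalIntegral.integral_eq_sub_of_hasDerivAt hder i1
    have e2 := AbsolutelyContinuousOnInterval.integral_deriv_mul_eq_sub
      (hh.lipschitzOnWith.absolutelyContinuousOnInterval (a := ε) (b := R))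
      (absolutelyContinuousOnInterval_of_hasDerivAt hed hcont ε R)
    simp only [(hed _).deriv] at e2
    have i2 : IntervalIntegrable (fun r => deriv h r * e r + h r * (h r * r ^ (n + 1)))
        volume ε R := (hh.intervalIntegrable_deriv_mul hecont ε R).add
      ((hhc.mul hcont).intervalIntegrable _ _)
    have hmono := intervalIntegral.integral_mono_on hεR.le ((i2.const_mul (-2)).add i1)
      (hh.intervalIntegrable_form (k := fun r => r ^ (n + 1)) (by fun_prop) ε R) (fun r hr => by
        have hr0 : 0 < r := hε.trans_le hr.1
        have := radial_picone (t := r ^ (n + 1)) (h := h r) (h' := deriv h r) (e := e r)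
          (F := radPhi n r) (pow_pos hr0 _) (hH r (by rwa [uIcc_of_le hεR.le]))
        rwa [show radH n r / r ^ (n + 1) = radPsi n r by
          rw [radH, mul_div_cancel_left₀ _ (pow_pos hr0 _).ne']] at this)
    refine le_trans ?_ hmono
    rw [intervalIntegral.integral_add (i2.const_mul (-2)) i1, intervalIntegral.integral_const_mul,
      e1, e2]
    have heR : e R = 0 := hint
    rw [heR, hhR]
    have hεadm := hR.mono hε hεR.le
    have hHε := hεadm.radH_pos
    have hphiε : 0 < radPhi n ε := radPhi_pos hε.le hεa
    have b1 : |h ε * e ε| ≤ M * (M * ε ^ (n + 2)) := by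
      rw [abs_mul]
      exact mul_le_mul (hbd ε hε.le hεR.le) (hebd ε hε hεR.le) (abs_nonneg _) hM0
    have b1' := (abs_le.1 b1).1
    have b2 : e ε ^ 2 ≤ (M * ε ^ (n + 2)) ^ 2 := by
      rw [← sq_abs]
      exact pow_le_pow_left₀ (abs_nonneg _) (hebd ε hε hεR.le) 2
    have b3 : e ε ^ 2 * (radPhi n ε / radH n ε) ≤ (n + 2) * M ^ 2 * ε ^ (n + 2) := by
      have hD := hεadm.radD_pos
      rw [radD, sub_pos, div_lt_iff₀ (by positivity)] at hD
      rw [← mul_div_assoc, div_le_iff₀ hHε]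
      calc e ε ^ 2 * radPhi n ε ≤ (M * ε ^ (n + 2)) ^ 2 * radPhi n ε := by gcongr
        _ = M ^ 2 * ε ^ (n + 2) * (radPhi n ε * ε ^ (n + 2)) := by ring
        _ ≤ M ^ 2 * ε ^ (n + 2) * (radH n ε * (n + 2)) := by gcongr
        _ = _ := by ring
    have e3 : (0 : ℝ) ^ 2 * (radPhi n R / radH n R) = 0 := by ring
    simp only [e3]
    linarith
  have ii := hh.intervalIntegrable_form (k := fun r => r ^ (n + 1)) (by fun_prop)
  have lim1 : Tendsto (fun ε : ℝ => -((n + 4) * M ^ 2 * ε ^ (n + 2))) (nhdsWithin 0 (Ioi 0))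
      (nhds 0) := by
    have : Continuous fun ε : ℝ => -((n + 4) * M ^ 2 * ε ^ (n + 2)) := by fun_prop
    have := this.tendsto 0
    rw [show -((n + 4) * M ^ 2 * (0 : ℝ) ^ (n + 2)) = 0 by simp] at this
    exact this.mono_left nhdsWithin_le_nhds
  have lim2 : Tendsto (fun ε => ∫ r in ε..R, (deriv h r ^ 2 - h r ^ 2) * r ^ (n + 1))
      (nhdsWithin 0 (Ioi 0))
      (nhds (∫ r in (0 : ℝ)..R, (deriv h r ^ 2 - h r ^ 2) * r ^ (n + 1))) := by
    have hc : Continuous fun ε => ∫ r in ε..R, (deriv h r ^ 2 - h r ^ 2) * r ^ (n + 1) := by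
      simp only [intervalIntegral.integral_symm R]
      exact (intervalIntegral.continuous_primitive ii R).neg
    exact (hc.tendsto 0).mono_left nhdsWithin_le_nhds
  refine le_of_tendsto_of_tendsto lim1 lim2 ?_
  filter_upwards [Ioo_mem_nhdsGT hR0, Ioo_mem_nhdsGT (radZero_pos n)] with ε h1 h2
  exact key ε h1.1 h1.2 h2.2

theorem integral_radPhi_sub (n : ℕ) (R : ℝ) :
    ∫ r in (0 : ℝ)..R, (radPhi n r - radPhi n R) * r ^ (n + 1) = radD n R := by
  have hphi := continuous_radPhi n
  have h1 := intervalIntegral.integral_eq_sub_of_hasDerivAt (a := 0) (b := R)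
    (f := fun r => radH n r - radPhi n R * (r ^ (n + 2) / (n + 2)))
    (f' := fun r => (radPhi n r - radPhi n R) * r ^ (n + 1)) (fun r _ => by
      refine ((hasDerivAt_radH n r).sub (((hasDerivAt_pow (n + 2) r).div_const _).const_mul
        (radPhi n R))).congr_deriv ?_
      push_cast
      field_simp)
    ((by fun_prop : Continuous _).intervalIntegrable _ _)
  rw [h1, radD, radH_zero]
  simp
  ring

/-- Integration by parts against `radPhi`. -/
theorem integral_form_radPhi {n : ℕ} {R : ℝ} {w : ℝ → ℝ} {K : NNReal}
    (hw : LipschitzWith K w) (hwR : w R = 0) :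
    ∫ r in (0 : ℝ)..R, (deriv w r * -radPsi n r - w r * (radPhi n r - radPhi n R)) * r ^ (n + 1) =
      radPhi n R * ∫ r in (0 : ℝ)..R, w r * r ^ (n + 1) := by
  have hphi := continuous_radPhi n
  have hwc := hw.continuous
  have e2 := AbsolutelyContinuousOnInterval.integral_deriv_mul_eq_sub
      (hw.lipschitzOnWith.absolutelyContinuousOnInterval (a := 0) (b := R))
      (absolutelyContinuousOnInterval_of_hasDerivAt (hasDerivAt_radH n) (by fun_prop) 0 R)
  simp only [(hasDerivAt_radH n _).deriv, hwR, radH_zero, mul_zero, zero_mul, sub_zero] at e2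
  have i1 := (hw.intervalIntegrable_deriv_mul (continuous_radH n) 0 R).add
    ((by fun_prop : Continuous fun r => w r * (radPhi n r * r ^ (n + 1))).intervalIntegrable
      (μ := volume) 0 R)
  have i2 : IntervalIntegrable (fun r => radPhi n R * (w r * r ^ (n + 1))) volume 0 R :=
    (by fun_prop : Continuous _).intervalIntegrable _ _
  have e3 := intervalIntegral.integral_sub i2 i1
  rw [e2, sub_zero] at e3
  rw [← intervalIntegral.integral_const_mul, ← e3]
  congr 1
  ext r
  simp only [radH]
  ring

theorem radial_inequality {n : ℕ} {R : ℝ} (hR : IsAdmRadius n R) {w : ℝ → ℝ} {K : NNReal}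
    (hw : LipschitzWith K w) (hwR : w R = 0) :
    radC n R * (∫ r in (0 : ℝ)..R, w r * r ^ (n + 1)) ^ 2 ≤
      ∫ r in (0 : ℝ)..R, (deriv w r ^ 2 - w r ^ 2) * r ^ (n + 1) := by
  have hD := hR.radD_pos
  set p := ∫ r in (0 : ℝ)..R, w r * r ^ (n + 1) with hp
  set s := p / radD n R with hs
  have hphi := continuous_radPhi n
  have hpsi := continuous_radPsi n
  have hwc := hw.continuous
  obtain ⟨L, hL⟩ := lipschitzWith_radPhi n
  have hf : LipschitzWith L fun r => radPhi n r - radPhi n R := by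
    refine LipschitzWith.of_dist_le_mul fun x y => ?_
    rw [dist_sub_right]
    exact hL.dist_le_mul x y
  have hfd : ∀ r, HasDerivAt (fun r => radPhi n r - radPhi n R) (-radPsi n r) r :=
    fun r => (hasDerivAt_radPhi n r).sub_const _
  have hsf : LipschitzWith (‖s‖₊ * L) fun r => s * (radPhi n r - radPhi n R) := by
    refine LipschitzWith.of_dist_le_mul fun x y => ?_
    have := hf.dist_le_mul x y
    rw [Real.dist_eq] at this ⊢
    rw [← mul_sub, abs_mul]
    push_cast
    rw [mul_assoc]
    exact mul_le_mul_of_nonneg_left this (abs_nonneg s)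
  have hh := hw.sub hsf
  have hpint : IntervalIntegrable (fun r => w r * r ^ (n + 1)) volume 0 R :=
    (by fun_prop : Continuous _).intervalIntegrable _ _
  have hfint : IntervalIntegrable (fun r => s * ((radPhi n r - radPhi n R) * r ^ (n + 1)))
    volume 0 R := (by fun_prop : Continuous _).intervalIntegrable _ _
  have h0 := radial_form_nonneg hR hh (by simp [hwR]) (by
    have : ∀ r, (w r - s * (radPhi n r - radPhi n R)) * r ^ (n + 1) =
      w r * r ^ (n + 1) - s * ((radPhi n r - radPhi n R) * r ^ (n + 1)) := fun r => by ring
    simp only [this]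
    rw [intervalIntegral.integral_sub hpint hfint, intervalIntegral.integral_const_mul,
      integral_radPhi_sub, ← hp, hs, div_mul_cancel₀ _ hD.ne', sub_self])
  have e1 := integral_form_radPhi (n := n) hw hwR
  have e2 := integral_form_radPhi (n := n) (R := R) hf (sub_self _)
  simp only [(hfd _).deriv] at e2
  rw [integral_radPhi_sub] at e2
  rw [← hp] at e1
  have i0 := hw.intervalIntegrable_form (k := fun r => r ^ (n + 1)) (by fun_prop) 0 R
  have i1 : IntervalIntegrable (fun r => (deriv w r * -radPsi n r -
      w r * (radPhi n r - radPhi n R)) * r ^ (n + 1)) volume 0 R := by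
    have a1 := hw.intervalIntegrable_deriv_mul (k := fun r => -radPsi n r * r ^ (n + 1))
      (by fun_prop) 0 R
    have a2 : IntervalIntegrable (fun r => w r * (radPhi n r - radPhi n R) * r ^ (n + 1))
      volume 0 R := (by fun_prop : Continuous _).intervalIntegrable _ _
    refine (a1.sub a2).congr (fun r _ => ?_)
    ring
  have i2 : IntervalIntegrable (fun r => (-radPsi n r * -radPsi n r -
      (radPhi n r - radPhi n R) * (radPhi n r - radPhi n R)) * r ^ (n + 1)) volume 0 R :=
    (by fun_prop : Continuous _).intervalIntegrable _ _
  have e3 : ∫ r in (0 : ℝ)..R, (deriv (fun r => w r - s * (radPhi n r - radPhi n R)) r ^ 2 -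
      (w r - s * (radPhi n r - radPhi n R)) ^ 2) * r ^ (n + 1) =
      (∫ r in (0 : ℝ)..R, (deriv w r ^ 2 - w r ^ 2) * r ^ (n + 1)) - 2 * s * (radPhi n R * p) +
        s ^ 2 * (radPhi n R * radD n R) := by
    rw [← e1, ← e2, ← intervalIntegral.integral_const_mul, ← intervalIntegral.integral_const_mul,
      ← intervalIntegral.integral_sub i0 (i1.const_mul _), ← intervalIntegral.integral_add
      (i0.sub (i1.const_mul _)) (i2.const_mul _)]
    refine intervalIntegral.integral_congr_ae ?_
    filter_upwards [hw.ae_differentiableAt_real] with r hr _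
    have hd : HasDerivAt (fun r => w r - s * (radPhi n r - radPhi n R))
        (deriv w r - s * -radPsi n r) r := hr.hasDerivAt.sub ((hfd r).const_mul s)
    rw [hd.deriv]
    ring
  rw [e3] at h0
  have : radC n R * p ^ 2 = 2 * s * (radPhi n R * p) - s ^ 2 * (radPhi n R * radD n R) := by
    rw [radC, hs]
    field_simp
    ring
  linarith

end RadialInequality

section BallVolume

/-- Euclidean space of dimension `n + 2`. -/
abbrev Euc (n : ℕ) := EuclideanSpace ℝ (Fin (n + 2))

variable {n : ℕ}

theorem volume_ball_eq (x : Euc n) (r : ℝ) :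
    volume (ball x r) = ENNReal.ofReal r ^ (n + 2) * volume (ball (0 : Euc n) 1) := by
  rcases le_or_gt r 0 with hr | hr
  · rw [ball_eq_empty.2 hr, ENNReal.ofReal_of_nonpos hr]
    simp
  · rw [Measure.addHaar_ball volume x hr.le, finrank_euclideanSpace_fin,
      ENNReal.ofReal_pow hr.le]

theorem volume_unitBall_ne_zero : volume (ball (0 : Euc n) 1) ≠ 0 :=
  (measure_ball_pos volume _ one_pos).ne'

theorem volume_unitBall_ne_top : volume (ball (0 : Euc n) 1) ≠ ⊤ :=
  measure_ball_lt_top.ne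

theorem volume_ball_lt_iff {x y : Euc n} {r s : ℝ} (hr : 0 ≤ r) :
    volume (ball x r) < volume (ball y s) ↔ r < s := by
  rw [volume_ball_eq x, volume_ball_eq y,
    ENNReal.mul_lt_mul_iff_left volume_unitBall_ne_zero volume_unitBall_ne_top,
    ENNReal.pow_lt_pow_left_iff (by omega), ENNReal.ofReal_lt_ofReal_iff_of_nonneg hr]

theorem volume_ball_le_iff {x y : Euc n} {r s : ℝ} (hs : 0 ≤ s) :
    volume (ball x r) ≤ volume (ball y s) ↔ r ≤ s := by
  rw [← not_lt, volume_ball_lt_iff hs, not_lt]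

theorem exists_volume_ball_eq {v : ℝ≥0∞} (hv : v ≠ ⊤) :
    ∃ r, 0 ≤ r ∧ volume (ball (0 : Euc n) r) = v := by
  have h : v / volume (ball (0 : Euc n) 1) ≠ ⊤ := ENNReal.div_ne_top hv volume_unitBall_ne_zero
  refine ⟨(v / volume (ball (0 : Euc n) 1)).toReal ^ (1 / ((n + 2 : ℕ) : ℝ)), by positivity, ?_⟩
  rw [volume_ball_eq, ← ENNReal.ofReal_pow (by positivity), ← Real.rpow_natCast, ← Real.rpow_mul
    (by positivity), one_div_mul_cancel (by positivity), Real.rpow_one, ENNReal.ofReal_toReal h,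
    ENNReal.div_mul_cancel volume_unitBall_ne_zero volume_unitBall_ne_top]

end BallVolume

section Rearrangement

variable {n : ℕ}

/-- The profile of the symmetric decreasing rearrangement of `u`. -/
def symProfile (u : Euc n → ℝ) (r : ℝ) : ℝ :=
  sSup (insert 0 {t | 0 ≤ t ∧ volume (ball (0 : Euc n) r) < volume {x | t < u x}})

theorem exists_lt_measure_superlevel {u : Euc n → ℝ} {t : ℝ} {v : ℝ≥0∞}
    (h : v < volume {x | t < u x}) : ∃ s, t < s ∧ v < volume {x | s < u x} := by
  have e : {x | t < u x} = ⋃ k : ℕ, {x | t + 1 / ((k : ℝ) + 1) < u x} := by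
    ext x
    simp only [mem_ofPred_eq, mem_iUnion]
    constructor
    · intro hx
      obtain ⟨k, hk⟩ := exists_nat_one_div_lt (sub_pos.2 hx)
      exact ⟨k, by linarith⟩
    · rintro ⟨k, hk⟩
      have : (0 : ℝ) < 1 / ((k : ℝ) + 1) := by positivity
      linarith
  have hm : Monotone fun k : ℕ => {x | t + 1 / ((k : ℝ) + 1) < u x} := by
    intro k l hkl x hx
    simp only [mem_ofPred_eq] at hx ⊢
    have : 1 / ((l : ℝ) + 1) ≤ 1 / ((k : ℝ) + 1) := by gcongr
    linarith
  rw [e, hm.measure_iUnion, lt_iSup_iff] at h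
  obtain ⟨k, hk⟩ := h
  have : (0 : ℝ) < 1 / ((k : ℝ) + 1) := by positivity
  exact ⟨_, by linarith, hk⟩

theorem bddAbove_symProfile {u : Euc n → ℝ} {M : ℝ} (hM : ∀ x, u x ≤ M) (r : ℝ) :
    BddAbove (insert 0 {t | 0 ≤ t ∧ volume (ball (0 : Euc n) r) < volume {x | t < u x}}) := by
  refine BddAbove.insert _ ⟨M, ?_⟩
  rintro t ⟨-, ht⟩
  by_contra! h
  have : {x | t < u x} = ∅ := by
    ext x
    simp only [mem_ofPred_eq, mem_empty_iff_false, iff_false, not_lt]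
    exact (hM x).trans h.le
  rw [this] at ht
  simp at ht

theorem symProfile_nonneg {u : Euc n → ℝ} {M : ℝ} (hM : ∀ x, u x ≤ M) (r : ℝ) :
    0 ≤ symProfile u r :=
  le_csSup (bddAbove_symProfile hM r) (mem_insert _ _)

theorem lt_symProfile_iff {u : Euc n → ℝ} {M : ℝ} (hM : ∀ x, u x ≤ M) {t r : ℝ} (ht : 0 ≤ t) :
    t < symProfile u r ↔ volume (ball (0 : Euc n) r) < volume {x | t < u x} := by
  constructor
  · intro h
    obtain ⟨s, hs, hts⟩ := exists_lt_of_lt_csSup (insert_nonempty _ _) h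
    rcases hs with rfl | ⟨-, hs⟩
    · exact absurd hts (not_lt.2 ht)
    · exact hs.trans_le (measure_mono fun x hx => hts.trans hx)
  · intro h
    obtain ⟨s, hts, hs⟩ := exists_lt_measure_superlevel h
    exact hts.trans_le (le_csSup (bddAbove_symProfile hM r) (Or.inr ⟨ht.trans hts.le, hs⟩))

theorem symProfile_eq_zero {u : Euc n → ℝ} {M : ℝ} (hM : ∀ x, u x ≤ M) {r : ℝ}
    (h : volume {x | 0 < u x} ≤ volume (ball (0 : Euc n) r)) : symProfile u r = 0 := by
  refine le_antisymm ?_ (symProfile_nonneg hM r)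
  rw [← not_lt, lt_symProfile_iff hM le_rfl, not_lt]
  exact h

theorem symProfile_antitone {u : Euc n → ℝ} {M : ℝ} (hM : ∀ x, u x ≤ M) :
    Antitone (symProfile u) := by
  intro r s hrs
  refine le_of_forall_lt fun t ht => ?_
  rcases lt_or_ge t 0 with h0 | h0
  · exact h0.trans_le (symProfile_nonneg hM r)
  · rw [lt_symProfile_iff hM h0] at ht ⊢
    exact (measure_mono (ball_subset_ball hrs)).trans_lt ht

theorem thickening_superlevel_subset {u : Euc n → ℝ} {K : NNReal} (hu : LipschitzWith K u)
    {t s : ℝ} : thickening s {x | t < u x} ⊆ {x | t - K * s < u x} := by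
  intro x hx
  obtain ⟨y, hy, hxy⟩ := mem_thickening_iff.1 hx
  have h1 := hu.dist_le_mul x y
  rw [Real.dist_eq] at h1
  have h2 := (abs_le.1 h1).1
  have h3 : (K : ℝ) * dist x y ≤ K * s := by gcongr
  simp only [mem_ofPred_eq] at hy ⊢
  linarith

theorem measure_superlevel_ne_top {u : Euc n → ℝ} {ρ : ℝ} (hb : ∀ x, ρ ≤ ‖x‖ → u x = 0) {t : ℝ}
    (ht : 0 ≤ t) : volume {x | t < u x} ≠ ⊤ := by
  refine ((measure_mono (t := ball 0 ρ) fun x hx => ?_).trans_lt measure_ball_lt_top).ne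
  rw [mem_ball_zero_iff]
  by_contra! h
  rw [mem_ofPred_eq, hb x h] at hx
  linarith

theorem lipschitzWith_symProfile {u : Euc n → ℝ} {K : NNReal} (hu : LipschitzWith K u) {M ρ : ℝ}
    (hM : ∀ x, u x ≤ M) (hb : ∀ x, ρ ≤ ‖x‖ → u x = 0) : LipschitzWith K (symProfile u) := by
  refine LipschitzWith.of_le_add_mul _ fun r r' => ?_
  rcases le_or_gt r' r with hr | hr
  · have := symProfile_antitone hM hr
    have : 0 ≤ K * dist r r' := by positivity
    linarith
  rw [dist_comm, Real.dist_eq, abs_of_pos (sub_pos.2 hr)]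
  refine le_of_forall_lt fun t ht => ?_
  have h0 := symProfile_nonneg hM r'
  have hK : 0 ≤ K * (r' - r) := mul_nonneg K.2 (sub_pos.2 hr).le
  rcases lt_or_ge (t - K * (r' - r)) 0 with h | h
  · linarith
  have ht0 : 0 ≤ t := by linarith
  rw [lt_symProfile_iff hM ht0] at ht
  obtain ⟨q, hq0, hq⟩ := exists_volume_ball_eq (n := n) (measure_superlevel_ne_top hb ht0)
  rw [← hq] at ht
  have hrq : r < q := by
    by_contra! hqr
    exact absurd ht (not_lt.2 (measure_mono (ball_subset_ball hqr)))
  have hq1 : 0 < q := by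
    refine lt_of_le_of_ne hq0 fun h => ?_
    rw [← h] at ht
    simp at ht
  have := volume_ball_add_le_thickening (measurableSet_lt measurable_const hu.continuous.measurable)
    hq1 (sub_pos.2 hr) hq.le
  have h1 := this.trans (measure_mono (thickening_superlevel_subset hu))
  have h2 : volume (ball (0 : Euc n) r') < volume {x | t - K * (r' - r) < u x} := by
    refine lt_of_lt_of_le ?_ h1
    rcases le_or_gt 0 r' with h0 | h0
    · rw [volume_ball_lt_iff h0]
      linarith
    · rw [ball_eq_empty.2 h0.le, measure_empty]
      exact measure_ball_pos _ _ (by linarith)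
  rw [← lt_symProfile_iff hM h] at h2
  linarith

theorem superlevel_symProfile {u : Euc n → ℝ} {M : ℝ} (hM : ∀ x, u x ≤ M) {t q : ℝ} (ht : 0 ≤ t)
    (hq : volume (ball (0 : Euc n) q) = volume {x | t < u x}) :
    {x : Euc n | t < symProfile u ‖x‖} = ball 0 q := by
  ext x
  rw [mem_ofPred_eq, lt_symProfile_iff hM ht, ← hq, volume_ball_lt_iff (norm_nonneg x),
    mem_ball_zero_iff]

theorem measure_superlevel_symProfile {u : Euc n → ℝ} {M ρ : ℝ} (hM : ∀ x, u x ≤ M)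
    (hb : ∀ x, ρ ≤ ‖x‖ → u x = 0) {t : ℝ} (ht : 0 ≤ t) :
    volume {x : Euc n | t < symProfile u ‖x‖} = volume {x | t < u x} := by
  obtain ⟨q, hq0, hq⟩ := exists_volume_ball_eq (n := n) (measure_superlevel_ne_top hb ht)
  rw [superlevel_symProfile hM ht hq, hq]

theorem lintegral_le_of_superlevel {f g : Euc n → ℝ} (hf : Measurable f) (hg : Measurable g)
    (hf0 : ∀ x, 0 ≤ f x) (hg0 : ∀ x, 0 ≤ g x)
    (h : ∀ t, 0 ≤ t → volume {x | t < f x} ≤ volume {x | t < g x}) :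
    ∫⁻ x, ENNReal.ofReal (f x) ≤ ∫⁻ x, ENNReal.ofReal (g x) := by
  rw [lintegral_eq_lintegral_meas_lt _ (ae_of_all _ hf0) hf.aemeasurable,
    lintegral_eq_lintegral_meas_lt _ (ae_of_all _ hg0) hg.aemeasurable]
  exact setLIntegral_mono' measurableSet_Ioi fun t ht => h t (le_of_lt ht)

theorem integral_eq_of_superlevel {f g : Euc n → ℝ} (hf : Measurable f) (hg : Measurable g)
    (hf0 : ∀ x, 0 ≤ f x) (hg0 : ∀ x, 0 ≤ g x)
    (h : ∀ t, 0 ≤ t → volume {x | t < f x} = volume {x | t < g x}) :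
    ∫ x, f x = ∫ x, g x := by
  rw [integral_eq_lintegral_of_nonneg_ae (ae_of_all _ hf0) hf.aestronglyMeasurable,
    integral_eq_lintegral_of_nonneg_ae (ae_of_all _ hg0) hg.aestronglyMeasurable,
    (lintegral_le_of_superlevel hf hg hf0 hg0 fun t ht => (h t ht).le).antisymm
      (lintegral_le_of_superlevel hg hf hg0 hf0 fun t ht => (h t ht).ge)]

theorem integral_sq_eq_of_superlevel {f g : Euc n → ℝ} (hf : Measurable f) (hg : Measurable g)
    (hf0 : ∀ x, 0 ≤ f x) (hg0 : ∀ x, 0 ≤ g x)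
    (h : ∀ t, 0 ≤ t → volume {x | t < f x} = volume {x | t < g x}) :
    ∫ x, f x ^ 2 = ∫ x, g x ^ 2 := by
  refine integral_eq_of_superlevel (hf.pow_const 2) (hg.pow_const 2) (fun x => sq_nonneg _)
    (fun x => sq_nonneg _) fun t ht => ?_
  simpa only [← Real.sqrt_lt_sqrt_iff ht, Real.sqrt_sq (hf0 _), Real.sqrt_sq (hg0 _)] using
    h (√t) (Real.sqrt_nonneg t)

end Rearrangement

section SupConvolution

variable {n : ℕ}

/-- The quadratic sup-convolution of `u`. -/
def supConv (ε : ℝ) (u : Euc n → ℝ) (x : Euc n) : ℝ :=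
  ⨆ y, (u y - ‖x - y‖ ^ 2 / (2 * ε))

variable {u : Euc n → ℝ} {K : NNReal} {ε : ℝ}

theorem sub_le_of_lipschitz (hu : LipschitzWith K u) (x y : Euc n) :
    u y - u x ≤ K * ‖x - y‖ := by
  have := hu.dist_le_mul y x
  rw [Real.dist_eq, dist_comm, dist_eq_norm] at this
  exact (le_abs_self _).trans this

theorem linear_sub_quadratic_le (hε : 0 < ε) (k s : ℝ) :
    k * s - s ^ 2 / (2 * ε) ≤ ε * (k ^ 2 / 2) := by
  have : ε * (k ^ 2 / 2) - (k * s - s ^ 2 / (2 * ε)) = (s - ε * k) ^ 2 / (2 * ε) := by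
    field_simp
    ring
  have : 0 ≤ (s - ε * k) ^ 2 / (2 * ε) := by positivity
  linarith

theorem supConv_term_le (hu : LipschitzWith K u) (hε : 0 < ε) (x y : Euc n) :
    u y - ‖x - y‖ ^ 2 / (2 * ε) ≤ u x + ε * ((K : ℝ) ^ 2 / 2) := by
  have h1 := sub_le_of_lipschitz hu x y
  have h2 := linear_sub_quadratic_le hε K ‖x - y‖
  linarith

theorem bddAbove_supConv (hu : LipschitzWith K u) (hε : 0 < ε) (x : Euc n) :
    BddAbove (range fun y => u y - ‖x - y‖ ^ 2 / (2 * ε)) := by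
  refine ⟨u x + ε * ((K : ℝ) ^ 2 / 2), ?_⟩
  rintro _ ⟨y, rfl⟩
  exact supConv_term_le hu hε x y

theorem supConv_le (hu : LipschitzWith K u) (hε : 0 < ε) (x : Euc n) :
    supConv ε u x ≤ u x + ε * ((K : ℝ) ^ 2 / 2) :=
  ciSup_le fun y => supConv_term_le hu hε x y

theorem le_supConv_term (hu : LipschitzWith K u) (hε : 0 < ε) (x y : Euc n) :
    u y - ‖x - y‖ ^ 2 / (2 * ε) ≤ supConv ε u x :=
  le_ciSup (bddAbove_supConv hu hε x) y

theorem le_supConv (hu : LipschitzWith K u) (hε : 0 < ε) (x : Euc n) : u x ≤ supConv ε u x := by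
  simpa using le_supConv_term hu hε x x

theorem lt_supConv_iff (hu : LipschitzWith K u) (hε : 0 < ε) {x : Euc n} {t : ℝ} :
    t < supConv ε u x ↔ ∃ y, t < u y - ‖x - y‖ ^ 2 / (2 * ε) :=
  lt_ciSup_iff (bddAbove_supConv hu hε x)

theorem measurable_supConv (hu : LipschitzWith K u) (hε : 0 < ε) : Measurable (supConv ε u) := by
  refine measurable_of_Ioi fun t => IsOpen.measurableSet ?_
  have : supConv ε u ⁻¹' Ioi t = ⋃ y, {x | t < u y - ‖x - y‖ ^ 2 / (2 * ε)} := by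
    ext x
    simp only [mem_preimage, mem_Ioi, mem_iUnion, mem_ofPred_eq]
    exact lt_supConv_iff hu hε
  rw [this]
  exact isOpen_iUnion fun y => isOpen_lt continuous_const (by fun_prop)

/-- Far away points do not contribute to the sup-convolution. -/
theorem supConv_term_le_self (hu : LipschitzWith K u) (hε : 0 < ε) {x y : Euc n}
    (h : 2 * K * ε ≤ ‖x - y‖) : u y - ‖x - y‖ ^ 2 / (2 * ε) ≤ u x := by
  have h1 := sub_le_of_lipschitz hu x y
  have h2 : K * ‖x - y‖ ≤ ‖x - y‖ ^ 2 / (2 * ε) := by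
    rw [le_div_iff₀ (by positivity)]
    nlinarith [norm_nonneg (x - y)]
  linarith

theorem supConv_eq_zero (hu : LipschitzWith K u) (hu0 : ∀ x, 0 ≤ u x) {ρ : ℝ}
    (hb : ∀ x, ρ ≤ ‖x‖ → u x = 0) (hε : 0 < ε) {x : Euc n} (hx : ρ + 2 * K * ε ≤ ‖x‖) :
    supConv ε u x = 0 := by
  have hK : 0 ≤ 2 * K * ε := by positivity
  have hx0 : u x = 0 := hb x (by linarith)
  refine le_antisymm (ciSup_le fun y => ?_) ((hu0 x).trans (le_supConv hu hε x))
  rcases le_or_gt ρ ‖y‖ with h | h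
  · rw [hb y h]
    have : 0 ≤ ‖x - y‖ ^ 2 / (2 * ε) := by positivity
    linarith
  · rw [← hx0]
    refine supConv_term_le_self hu hε ?_
    have := norm_sub_norm_le x y
    linarith

theorem tendsto_supConv_div (hu : LipschitzWith K u) {x g : Euc n} (hg : HasGradientAt u g x) :
    Tendsto (fun ε => (supConv ε u x - u x) / ε) (nhdsWithin 0 (Ioi 0)) (nhds (‖g‖ ^ 2 / 2)) := by
  have hlittle := hasGradientAt_iff_isLittleO.1 hg
  have ub : ∀ η > 0, ∀ᶠ ε in nhdsWithin (0 : ℝ) (Ioi 0),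
      (supConv ε u x - u x) / ε ≤ (‖g‖ + η) ^ 2 / 2 := by
    intro η hη
    obtain ⟨δ, hδ, hball⟩ := Metric.eventually_nhds_iff.1 (hlittle.def hη)
    have : ∀ᶠ ε in nhdsWithin (0 : ℝ) (Ioi 0), 2 * K * ε < δ := by
      have hc : Continuous fun ε : ℝ => 2 * (K : ℝ) * ε := by fun_prop
      have := hc.tendsto 0
      rw [mul_zero] at this
      exact (this.mono_left nhdsWithin_le_nhds).eventually_lt_const hδ
    filter_upwards [this, self_mem_nhdsWithin] with ε hεδ hε
    have hε : 0 < ε := hε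
    rw [div_le_iff₀ hε, sub_le_iff_le_add]
    refine ciSup_le fun y => ?_
    rcases le_or_gt (2 * K * ε) ‖x - y‖ with h | h
    · have := supConv_term_le_self hu hε h
      have : 0 ≤ (‖g‖ + η) ^ 2 / 2 * ε := by positivity
      linarith
    · have h1 := hball (y := y) (by rw [dist_comm, dist_eq_norm]; linarith)
      rw [Real.norm_eq_abs, norm_sub_rev y x] at h1
      have h2 := (abs_le.1 h1).2
      have h3 := real_inner_le_norm g (y - x)
      rw [norm_sub_rev y x] at h3
      have h4 := linear_sub_quadratic_le hε (‖g‖ + η) ‖x - y‖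
      linarith
  have lb : ∀ η > 0, ∀ᶠ ε in nhdsWithin (0 : ℝ) (Ioi 0),
      ‖g‖ ^ 2 / 2 - η * ‖g‖ ≤ (supConv ε u x - u x) / ε := by
    intro η hη
    obtain ⟨δ, hδ, hball⟩ := Metric.eventually_nhds_iff.1 (hlittle.def hη)
    have : ∀ᶠ ε in nhdsWithin (0 : ℝ) (Ioi 0), ε * ‖g‖ < δ := by
      have hc : Continuous fun ε : ℝ => ε * ‖g‖ := by fun_prop
      have := hc.tendsto 0
      rw [zero_mul] at this
      exact (this.mono_left nhdsWithin_le_nhds).eventually_lt_const hδ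
    filter_upwards [this, self_mem_nhdsWithin] with ε hεδ hε
    have hε : 0 < ε := hε
    have hn : ‖ε • g‖ = ε * ‖g‖ := by rw [norm_smul, Real.norm_of_nonneg hε.le]
    rw [le_div_iff₀ hε]
    have h1 := hball (y := x + ε • g) (by rwa [dist_eq_norm, add_sub_cancel_left, hn])
    rw [add_sub_cancel_left, hn, Real.norm_eq_abs, real_inner_smul_right,
      real_inner_self_eq_norm_sq] at h1
    have h2 := (abs_le.1 h1).1
    have h3 := le_supConv_term hu hε x (x + ε • g)
    rw [sub_add_cancel_left, norm_neg, hn] at h3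
    have h4 : (ε * ‖g‖) ^ 2 / (2 * ε) = ε * (‖g‖ ^ 2 / 2) := by
      field_simp
    rw [h4] at h3
    nlinarith
  refine tendsto_order.2 ⟨fun a ha => ?_, fun a ha => ?_⟩
  · have hc : Continuous fun η : ℝ => ‖g‖ ^ 2 / 2 - η * ‖g‖ := by fun_prop
    have h1 := (hc.tendsto 0).mono_left (nhdsWithin_le_nhds (s := Ioi 0))
    have h2 := (h1.eventually_const_lt (by simpa using ha)).and self_mem_nhdsWithin
    obtain ⟨η, h3, h4⟩ := h2.exists
    filter_upwards [lb η h4] with ε hε using h3.trans_le hε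
  · have hc : Continuous fun η : ℝ => (‖g‖ + η) ^ 2 / 2 := by fun_prop
    have h1 := (hc.tendsto 0).mono_left (nhdsWithin_le_nhds (s := Ioi 0))
    have h2 := (h1.eventually_lt_const (by simpa using ha)).and self_mem_nhdsWithin
    obtain ⟨η, h3, h4⟩ := h2.exists
    filter_upwards [ub η h4] with ε hε using hε.trans_lt h3

end SupConvolution

section PolyaSzego

variable {n : ℕ} {u : Euc n → ℝ} {K : NNReal} {ρ : ℝ}

theorem integrable_of_bounded_support {f : Euc n → ℝ} (hf : AEStronglyMeasurable f) {C : ℝ}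
    (hC : ∀ x, |f x| ≤ C) (hb : ∀ x, ρ ≤ ‖x‖ → f x = 0) : Integrable f := by
  refine Integrable.mono' (g := (closedBall (0 : Euc n) ρ).indicator fun _ => C)
    ((integrable_indicator_iff measurableSet_closedBall).2
      (integrableOn_const measure_closedBall_lt_top.ne)) hf (ae_of_all _ fun x => ?_)
  by_cases hx : x ∈ closedBall (0 : Euc n) ρ
  · rw [indicator_of_mem hx]
    exact hC x
  · rw [indicator_of_notMem hx, hb x (by
      rw [mem_closedBall_zero_iff] at hx
      linarith), norm_zero]

theorem abs_le_of_lipschitz_support (hu : LipschitzWith K u) (hb : ∀ x, ρ ≤ ‖x‖ → u x = 0)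
    (x : Euc n) : |u x| ≤ K * (2 * |ρ|) := by
  rcases le_or_gt ρ ‖x‖ with h | h
  · rw [hb x h, abs_zero]
    positivity
  · obtain ⟨y, hy⟩ : ∃ y : Euc n, ‖y‖ = |ρ| :=
      exists_norm_eq (Euc n) (abs_nonneg ρ)
    have h1 := hu.dist_le_mul x y
    rw [Real.dist_eq, hb y (hy ▸ le_abs_self ρ), sub_zero] at h1
    refine h1.trans ?_
    gcongr
    have := dist_le_norm_add_norm x y
    have := le_abs_self ρ
    linarith

theorem norm_gradient_eq (u : Euc n → ℝ) (x : Euc n) : ‖gradient u x‖ = ‖fderiv ℝ u x‖ := by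
  rw [gradient, LinearIsometryEquiv.norm_map]

theorem norm_gradient_le (hu : LipschitzWith K u) (x : Euc n) : ‖gradient u x‖ ≤ K := by
  rw [norm_gradient_eq]
  exact norm_fderiv_le_of_lipschitz ℝ hu

theorem measurable_gradient (u : Euc n → ℝ) : Measurable (gradient u) :=
  (LinearIsometryEquiv.continuous _).measurable.comp (measurable_fderiv ℝ u)

theorem gradient_eq_zero_of_isOpen {U : Set (Euc n)} (hU : IsOpen U) (h : ∀ x ∈ U, u x = 0)
    {x : Euc n} (hx : x ∈ U) : gradient u x = 0 := by
  have : u =ᶠ[nhds x] fun _ => 0 := by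
    filter_upwards [hU.mem_nhds hx] with y hy using h y hy
  rw [gradient, this.fderiv_eq]
  simp

theorem gradient_eq_zero_of_norm (hb : ∀ x, ρ ≤ ‖x‖ → u x = 0) {x : Euc n} (hx : ρ < ‖x‖) :
    gradient u x = 0 :=
  gradient_eq_zero_of_isOpen (isOpen_lt continuous_const continuous_norm)
    (fun y hy => hb y (le_of_lt hy)) hx

theorem integrable_norm_gradient_sq (hu : LipschitzWith K u) (hb : ∀ x, ρ ≤ ‖x‖ → u x = 0) :
    Integrable fun x => ‖gradient u x‖ ^ 2 := by
  refine integrable_of_bounded_support (ρ := ρ + 1) (C := (K : ℝ) ^ 2)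
    ((measurable_gradient u).norm.pow_const 2).aestronglyMeasurable (fun x => ?_) (fun x hx => ?_)
  · rw [abs_of_nonneg (sq_nonneg _)]
    exact pow_le_pow_left₀ (norm_nonneg _) (norm_gradient_le hu x) 2
  · rw [gradient_eq_zero_of_norm hb (by linarith)]
    simp

theorem integrable_of_lipschitz_support (hu : LipschitzWith K u) (hb : ∀ x, ρ ≤ ‖x‖ → u x = 0) :
    Integrable u :=
  integrable_of_bounded_support hu.continuous.aestronglyMeasurable
    (abs_le_of_lipschitz_support hu hb) hb

theorem integrable_sq_of_lipschitz_support (hu : LipschitzWith K u)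
    (hb : ∀ x, ρ ≤ ‖x‖ → u x = 0) : Integrable fun x => u x ^ 2 := by
  refine integrable_of_bounded_support (ρ := ρ) (C := (K * (2 * |ρ|)) ^ 2)
    (hu.continuous.pow 2).aestronglyMeasurable (fun x => ?_) (fun x hx => by simp [hb x hx])
  rw [abs_pow]
  exact pow_le_pow_left₀ (abs_nonneg _) (abs_le_of_lipschitz_support hu hb x) 2

theorem ae_hasGradientAt (hu : LipschitzWith K u) :
    ∀ᵐ x, HasGradientAt u (gradient u x) x := by
  filter_upwards [hu.ae_differentiableAt (μ := volume)] with x hx using hx.hasGradientAt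

theorem integrable_supConv (hu : LipschitzWith K u) (hu0 : ∀ x, 0 ≤ u x)
    (hb : ∀ x, ρ ≤ ‖x‖ → u x = 0) {ε : ℝ} (hε : 0 < ε) : Integrable (supConv ε u) := by
  refine integrable_of_bounded_support (ρ := ρ + 2 * K * ε)
    (C := K * (2 * |ρ|) + ε * ((K : ℝ) ^ 2 / 2))
    (measurable_supConv hu hε).aestronglyMeasurable (fun x => ?_)
    fun x hx => supConv_eq_zero hu hu0 hb hε hx
  rw [abs_of_nonneg ((hu0 x).trans (le_supConv hu hε x))]
  refine (supConv_le hu hε x).trans ?_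
  gcongr
  exact (le_abs_self _).trans (abs_le_of_lipschitz_support hu hb x)

theorem tendsto_integral_supConv (hu : LipschitzWith K u) (hu0 : ∀ x, 0 ≤ u x)
    (hb : ∀ x, ρ ≤ ‖x‖ → u x = 0) :
    Tendsto (fun ε => ((∫ x, supConv ε u x) - ∫ x, u x) / ε) (nhdsWithin 0 (Ioi 0))
      (nhds ((∫ x, ‖gradient u x‖ ^ 2) / 2)) := by
  have key : Tendsto (fun ε => ∫ x, (supConv ε u x - u x) / ε) (nhdsWithin 0 (Ioi 0))
      (nhds (∫ x, ‖gradient u x‖ ^ 2 / 2)) := by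
    refine tendsto_integral_filter_of_dominated_convergence
      ((closedBall (0 : Euc n) (ρ + 2 * K)).indicator fun _ => (K : ℝ) ^ 2 / 2) ?_ ?_ ?_ ?_
    · filter_upwards [self_mem_nhdsWithin] with ε hε
      exact (((measurable_supConv hu hε).sub hu.continuous.measurable).div_const
        ε).aestronglyMeasurable
    · filter_upwards [Ioo_mem_nhdsGT one_pos] with ε hε
      refine ae_of_all _ fun x => ?_
      have h1 := le_supConv hu hε.1 x
      rw [Real.norm_of_nonneg (div_nonneg (sub_nonneg.2 h1) hε.1.le)]
      by_cases hx : x ∈ closedBall (0 : Euc n) (ρ + 2 * K)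
      · rw [indicator_of_mem hx, div_le_iff₀ hε.1]
        have := supConv_le hu hε.1 x
        linarith
      · rw [indicator_of_notMem hx]
        rw [mem_closedBall_zero_iff, not_le] at hx
        have hKε : 2 * K * ε ≤ 2 * K := mul_le_of_le_one_right (by positivity) hε.2.le
        have hK0 : 0 ≤ 2 * (K : ℝ) := by positivity
        rw [supConv_eq_zero hu hu0 hb hε.1 (by linarith), hb x (by linarith)]
        simp
    · exact (integrable_indicator_iff measurableSet_closedBall).2
        (integrableOn_const measure_closedBall_lt_top.ne)
    · filter_upwards [ae_hasGradientAt hu] with x hx using tendsto_supConv_div hu hx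
  rw [integral_div] at key
  refine key.congr' ?_
  filter_upwards [self_mem_nhdsWithin] with ε hε
  rw [integral_div, integral_sub (integrable_supConv hu hu0 hb hε)
    (integrable_of_lipschitz_support hu hb)]

theorem exists_bound_of_lipschitz_support (hu : LipschitzWith K u)
    (hb : ∀ x, ρ ≤ ‖x‖ → u x = 0) : ∃ M, ∀ x, u x ≤ M :=
  ⟨_, fun x => (le_abs_self _).trans (abs_le_of_lipschitz_support hu hb x)⟩

theorem lipschitzWith_comp_norm {w : ℝ → ℝ} (hw : LipschitzWith K w) :
    LipschitzWith K fun x : Euc n => w ‖x‖ := by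
  have h := hw.comp (lipschitzWith_one_norm (E := Euc n))
  rwa [mul_one] at h

theorem measure_superlevel_supConv_symProfile_le (hu : LipschitzWith K u)
    (hb : ∀ x, ρ ≤ ‖x‖ → u x = 0) {ε t : ℝ} (hε : 0 < ε) (ht : 0 ≤ t) :
    volume {x | t < supConv ε (fun x : Euc n => symProfile u ‖x‖) x} ≤
      volume {x | t < supConv ε u x} := by
  obtain ⟨M, hM⟩ := exists_bound_of_lipschitz_support hu hb
  have hw := lipschitzWith_comp_norm (n := n) (lipschitzWith_symProfile hu hM hb)
  by_cases htop : volume {x | t < supConv ε u x} = ⊤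
  · rw [htop]
    exact le_top
  obtain ⟨P, hP0, hP⟩ := exists_volume_ball_eq (n := n) htop
  rw [← hP]
  refine measure_mono fun x hx => ?_
  obtain ⟨y, hy⟩ := (lt_supConv_iff hw hε).1 hx
  have hsq : 0 ≤ ‖x - y‖ ^ 2 / (2 * ε) := by positivity
  obtain ⟨s, hs1, hs2⟩ : ∃ s, t + ‖x - y‖ ^ 2 / (2 * ε) < s ∧ s < symProfile u ‖y‖ :=
    exists_between (by linarith)
  have hs0 : 0 ≤ s := by linarith
  have hst : 0 < s - t := by linarith
  set τ := √(2 * ε * (s - t)) with hτ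
  have hτ0 : 0 < τ := Real.sqrt_pos.2 (by positivity)
  have hxy : ‖x - y‖ < τ := by
    rw [hτ, Real.lt_sqrt (norm_nonneg _)]
    have := (div_lt_iff₀ (by positivity : 0 < 2 * ε)).1 (by linarith :
      ‖x - y‖ ^ 2 / (2 * ε) < s - t)
    linarith
  obtain ⟨q, hq0, hq⟩ := exists_volume_ball_eq (n := n) (measure_superlevel_ne_top hb hs0)
  have hyq : y ∈ ball (0 : Euc n) q := by
    rw [← superlevel_symProfile hM hs0 hq]
    exact hs2
  rw [mem_ball_zero_iff] at hyq
  have hq1 : 0 < q := (norm_nonneg y).trans_lt hyq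
  have hth := volume_ball_add_le_thickening
    (measurableSet_lt measurable_const hu.continuous.measurable) hq1 hτ0 hq.le
  have hsub : thickening τ {x | s < u x} ⊆ {x | t < supConv ε u x} := by
    intro z hz
    obtain ⟨v, hv, hzv⟩ := mem_thickening_iff.1 hz
    refine (lt_supConv_iff hu hε).2 ⟨v, ?_⟩
    rw [dist_eq_norm, hτ, Real.lt_sqrt (norm_nonneg _)] at hzv
    have : ‖z - v‖ ^ 2 / (2 * ε) < s - t := by
      rw [div_lt_iff₀ (by positivity)]
      linarith
    simp only [mem_ofPred_eq] at hv
    linarith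
  have := hth.trans (measure_mono hsub)
  rw [← hP, volume_ball_le_iff hP0] at this
  rw [mem_ball_zero_iff]
  have h1 := norm_le_norm_add_norm_sub' x y
  linarith

theorem symProfile_eq_zero_of_le (hM : ∃ M, ∀ x, u x ≤ M) (hb : ∀ x, ρ ≤ ‖x‖ → u x = 0)
    {r : ℝ} (hr : ρ ≤ r) : symProfile u r = 0 := by
  obtain ⟨M, hM⟩ := hM
  refine symProfile_eq_zero hM (measure_mono fun x hx => ?_)
  rw [mem_ball_zero_iff]
  by_contra! h
  rw [mem_ofPred_eq, hb x (hr.trans h)] at hx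
  exact lt_irrefl _ hx

/-- The Pólya–Szegő inequality for Lipschitz functions. -/
theorem polya_szego (hu : LipschitzWith K u) (hu0 : ∀ x, 0 ≤ u x)
    (hb : ∀ x, ρ ≤ ‖x‖ → u x = 0) :
    ∫ x, ‖gradient (fun x : Euc n => symProfile u ‖x‖) x‖ ^ 2 ≤ ∫ x, ‖gradient u x‖ ^ 2 := by
  obtain ⟨M, hM⟩ := exists_bound_of_lipschitz_support hu hb
  have hw := lipschitzWith_comp_norm (n := n) (lipschitzWith_symProfile hu hM hb)
  have hw0 : ∀ x : Euc n, 0 ≤ symProfile u ‖x‖ := fun x => symProfile_nonneg hM _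
  have hwb : ∀ x : Euc n, ρ ≤ ‖x‖ → symProfile u ‖x‖ = 0 := fun x hx =>
    symProfile_eq_zero_of_le ⟨M, hM⟩ hb hx
  have hint : ∫ x : Euc n, symProfile u ‖x‖ = ∫ x, u x :=
    integral_eq_of_superlevel hw.continuous.measurable hu.continuous.measurable hw0 hu0
      fun t ht => measure_superlevel_symProfile hM hb ht
  refine le_of_mul_le_mul_right ?_ (by norm_num : (0 : ℝ) < 1 / 2)
  have h1 := tendsto_integral_supConv hw hw0 hwb
  have h2 := tendsto_integral_supConv hu hu0 hb
  rw [← div_eq_mul_one_div, ← div_eq_mul_one_div]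
  refine le_of_tendsto_of_tendsto h1 h2 ?_
  filter_upwards [self_mem_nhdsWithin] with ε hε
  have hε : 0 < ε := hε
  rw [hint]
  refine div_le_div_of_nonneg_right (sub_le_sub_right ?_ _) hε.le
  have hq0 : ∀ x, 0 ≤ supConv ε u x := fun x => (hu0 x).trans (le_supConv hu hε x)
  have hqw0 : ∀ x, 0 ≤ supConv ε (fun x : Euc n => symProfile u ‖x‖) x := fun x =>
    (hw0 x).trans (le_supConv hw hε x)
  have h := lintegral_le_of_superlevel (measurable_supConv hw hε) (measurable_supConv hu hε)
    hqw0 hq0 fun t ht => measure_superlevel_supConv_symProfile_le hu hb hε ht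
  rw [← ofReal_integral_eq_lintegral_ofReal (integrable_supConv hw hw0 hwb hε)
    (ae_of_all _ hqw0), ← ofReal_integral_eq_lintegral_ofReal (integrable_supConv hu hu0 hb hε)
    (ae_of_all _ hq0)] at h
  exact (ENNReal.ofReal_le_ofReal_iff (integral_nonneg hq0)).1 h

theorem abs_deriv_le_norm_gradient {w : ℝ → ℝ} {x : Euc n} (hx : x ≠ 0)
    (hd : DifferentiableAt ℝ (fun x : Euc n => w ‖x‖) x) :
    |deriv w ‖x‖| ≤ ‖gradient (fun x : Euc n => w ‖x‖) x‖ := by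
  rw [norm_gradient_eq]
  have hx0 : 0 < ‖x‖ := norm_pos_iff.2 hx
  have hl : HasDerivAt (fun r : ℝ => (r / ‖x‖) • x) ((1 / ‖x‖) • x) ‖x‖ :=
    ((hasDerivAt_id ‖x‖).div_const ‖x‖).smul_const x
  have hc : HasDerivAt (fun r : ℝ => w ‖(r / ‖x‖) • x‖)
      (fderiv ℝ (fun x : Euc n => w ‖x‖) x ((1 / ‖x‖) • x)) ‖x‖ := by
    refine HasFDerivAt.comp_hasDerivAt (l := fun x : Euc n => w ‖x‖) ‖x‖ ?_ hl
    rw [div_self hx0.ne', one_smul]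
    exact hd.hasFDerivAt
  have he : w =ᶠ[nhds ‖x‖] fun r : ℝ => w ‖(r / ‖x‖) • x‖ := by
    filter_upwards [lt_mem_nhds hx0] with r hr
    rw [norm_smul, norm_div, norm_norm, Real.norm_of_nonneg hr.le, div_mul_cancel₀ _ hx0.ne']
  rw [he.deriv_eq, hc.deriv]
  have := (fderiv ℝ (fun x : Euc n => w ‖x‖) x).le_opNorm ((1 / ‖x‖) • x)
  rwa [norm_smul, norm_div, norm_one, norm_norm, one_div_mul_cancel hx0.ne', mul_one] at this

end PolyaSzego

section BoundedLipschitz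

variable {n : ℕ}

/-- Lipschitz functions with bounded support. -/
def IsBLip (u : Euc n → ℝ) : Prop :=
  (∃ K, LipschitzWith K u) ∧ ∃ ρ, ∀ x, ρ ≤ ‖x‖ → u x = 0

/-- The quadratic form `∫ |∇u|² - ∫ u²`. -/
def qform (u : Euc n → ℝ) : ℝ := (∫ x, ‖gradient u x‖ ^ 2) - ∫ x, u x ^ 2

variable {u v : Euc n → ℝ}

theorem IsBLip.add (hu : IsBLip u) (hv : IsBLip v) : IsBLip fun x => u x + v x := by
  obtain ⟨⟨K, hK⟩, ρ, hρ⟩ := hu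
  obtain ⟨⟨L, hL⟩, σ, hσ⟩ := hv
  refine ⟨⟨K + L, hK.add hL⟩, max ρ σ, fun x hx => ?_⟩
  simp [hρ x ((le_max_left _ _).trans hx), hσ x ((le_max_right _ _).trans hx)]

theorem IsBLip.const_mul (hu : IsBLip u) (s : ℝ) : IsBLip fun x => s * u x := by
  obtain ⟨⟨K, hK⟩, ρ, hρ⟩ := hu
  exact ⟨⟨_, (lipschitzWith_smul s).comp hK⟩, ρ, fun x hx => by simp [hρ x hx]⟩

theorem IsBLip.neg (hu : IsBLip u) : IsBLip fun x => -u x := by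
  simpa using hu.const_mul (-1)

theorem IsBLip.posPart (hu : IsBLip u) : IsBLip fun x => max (u x) 0 := by
  obtain ⟨⟨K, hK⟩, ρ, hρ⟩ := hu
  exact ⟨⟨K, hK.max_const 0⟩, ρ, fun x hx => by simp [hρ x hx]⟩

theorem IsBLip.continuous (hu : IsBLip u) : Continuous u := by
  obtain ⟨⟨K, hK⟩, ρ, hρ⟩ := hu
  exact hK.continuous

theorem IsBLip.integrable (hu : IsBLip u) : Integrable u := by
  obtain ⟨⟨K, hK⟩, ρ, hρ⟩ := hu
  exact integrable_of_lipschitz_support hK hρ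

theorem IsBLip.integrable_sq (hu : IsBLip u) : Integrable fun x => u x ^ 2 := by
  obtain ⟨⟨K, hK⟩, ρ, hρ⟩ := hu
  exact integrable_sq_of_lipschitz_support hK hρ

theorem IsBLip.integrable_norm_gradient_sq (hu : IsBLip u) :
    Integrable fun x => ‖gradient u x‖ ^ 2 := by
  obtain ⟨⟨K, hK⟩, ρ, hρ⟩ := hu
  exact _root_.integrable_norm_gradient_sq hK hρ

theorem IsBLip.ae_hasGradientAt (hu : IsBLip u) : ∀ᵐ x, HasGradientAt u (gradient u x) x := by
  obtain ⟨⟨K, hK⟩, -⟩ := hu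
  exact _root_.ae_hasGradientAt hK

theorem IsBLip.integrable_mul (hu : IsBLip u) (hv : IsBLip v) :
    Integrable fun x => u x * v x := by
  refine (((hu.add hv).integrable_sq.sub hu.integrable_sq).sub hv.integrable_sq).div_const 2
    |>.congr (ae_of_all _ fun x => ?_)
  simp only [Pi.sub_apply]
  ring

theorem HasGradientAt.add_const_mul {a b x : Euc n} (hu : HasGradientAt u a x)
    (hv : HasGradientAt v b x) (s : ℝ) :
    HasGradientAt (fun x => u x + s * v x) (a + s • b) x := by
  rw [hasGradientAt_iff_hasFDerivAt] at *
  refine (hu.add (hv.const_mul s)).congr_fderiv ?_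
  simp

theorem IsBLip.integrable_inner_gradient (hu : IsBLip u) (hv : IsBLip v) :
    Integrable fun x => inner ℝ (gradient u x) (gradient v x) := by
  refine (((hu.add (hv.const_mul 1)).integrable_norm_gradient_sq.sub
    hu.integrable_norm_gradient_sq).sub hv.integrable_norm_gradient_sq).div_const 2 |>.congr ?_
  filter_upwards [hu.ae_hasGradientAt, hv.ae_hasGradientAt] with x h1 h2
  simp only [Pi.sub_apply]
  rw [(h1.add_const_mul h2 1).gradient, one_smul, norm_add_sq_real]
  ring

theorem integral_add_const_mul_add_const_mul {f g h : Euc n → ℝ} (hf : Integrable f)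
    (hg : Integrable g) (hh : Integrable h) (a b : ℝ) :
    ∫ x, (f x + a * g x + b * h x) = (∫ x, f x) + a * (∫ x, g x) + b * ∫ x, h x := by
  have h1 : Integrable fun x => f x + a * g x := hf.add (hg.const_mul a)
  rw [integral_add h1 (hh.const_mul b), integral_add hf (hg.const_mul a), integral_const_mul,
    integral_const_mul]

theorem qform_add_const_mul (hu : IsBLip u) (hv : IsBLip v) (s : ℝ) :
    qform (fun x => u x + s * v x) = qform u +
      s * (2 * ((∫ x, inner ℝ (gradient u x) (gradient v x)) - ∫ x, u x * v x)) +
        s ^ 2 * qform v := by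
  have e1 : ∫ x, ‖gradient (fun x => u x + s * v x) x‖ ^ 2 = ∫ x, (‖gradient u x‖ ^ 2 +
      2 * s * inner ℝ (gradient u x) (gradient v x) + s ^ 2 * ‖gradient v x‖ ^ 2) := by
    refine integral_congr_ae ?_
    filter_upwards [hu.ae_hasGradientAt, hv.ae_hasGradientAt] with x h1 h2
    rw [(h1.add_const_mul h2 s).gradient, norm_add_sq_real, inner_smul_right, norm_smul, mul_pow,
      Real.norm_eq_abs, sq_abs]
    ring
  have e2 : ∫ x, (u x + s * v x) ^ 2 = ∫ x, (u x ^ 2 + 2 * s * (u x * v x) + s ^ 2 * v x ^ 2) := by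
    congr 1
    ext x
    ring
  rw [qform, e1, e2, integral_add_const_mul_add_const_mul hu.integrable_norm_gradient_sq
    (hu.integrable_inner_gradient hv) hv.integrable_norm_gradient_sq,
    integral_add_const_mul_add_const_mul hu.integrable_sq (hu.integrable_mul hv) hv.integrable_sq,
    qform, qform]
  ring

theorem qform_const_mul (hu : IsBLip u) (s : ℝ) : qform (fun x => s * u x) = s ^ 2 * qform u := by
  have h0 : IsBLip fun _ : Euc n => (0 : ℝ) := by simpa using hu.const_mul 0
  have hg : ∀ x, gradient (fun _ : Euc n => (0 : ℝ)) x = 0 := fun x => gradient_const x 0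
  have := qform_add_const_mul h0 hu s
  simpa [qform, hg] using this

/-- Differentiable functions with vanishing product have orthogonal gradients. -/
theorem inner_gradient_eq_zero {a b x : Euc n} (hu : HasGradientAt u a x)
    (hv : HasGradientAt v b x) (huv : ∀ y, u y * v y = 0) : inner ℝ a b = 0 := by
  have zero_of_ne : ∀ {u v : Euc n → ℝ} {a b : Euc n}, HasGradientAt u a x →
      HasGradientAt v b x → (∀ y, u y * v y = 0) → u x ≠ 0 → b = 0 := by
    intro u v a b hu hv huv hx
    have : v =ᶠ[nhds x] fun _ => 0 := by
      filter_upwards [hu.continuousAt.eventually_ne hx] with y hy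
      exact (mul_eq_zero.1 (huv y)).resolve_left hy
    exact (hv.congr_of_eventuallyEq this.symm).unique (hasGradientAt_const x 0)
  by_cases hx : u x = 0
  swap
  · rw [zero_of_ne hu hv huv hx, inner_zero_right]
  by_cases hx' : v x = 0
  swap
  · rw [zero_of_ne hv hu (fun y => by rw [mul_comm, huv]) hx', inner_zero_left]
  have hline : HasDerivAt (fun t : ℝ => x + t • a) a 0 := by
    simpa using ((hasDerivAt_id (0 : ℝ)).smul_const a).const_add x
  have slope : ∀ {f : Euc n → ℝ} {c : Euc n}, HasGradientAt f c x → f x = 0 →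
      Tendsto (fun t : ℝ => t⁻¹ * f (x + t • a)) (nhdsWithin 0 {0}ᶜ) (nhds (inner ℝ c a)) := by
    intro f c hf hf0
    have h1 : HasDerivAt (fun t : ℝ => f (x + t • a)) (inner ℝ c a) 0 := by
      have := HasFDerivAt.comp_hasDerivAt (l := f) (0 : ℝ)
        (by simpa using hf.hasFDerivAt) hline
      rwa [InnerProductSpace.toDual_apply_apply] at this
    have := h1.tendsto_slope_zero
    simpa [hf0] using this
  have h1 := (slope hu hx).mul (slope hv hx')
  have h2 : (fun t : ℝ => t⁻¹ * u (x + t • a) * (t⁻¹ * v (x + t • a))) = fun _ => 0 := by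
    ext t
    rw [mul_mul_mul_comm, huv, mul_zero]
  rw [h2] at h1
  have h3 := tendsto_nhds_unique h1 tendsto_const_nhds
  rw [mul_eq_zero, inner_self_eq_zero, real_inner_comm] at h3
  rcases h3 with h3 | h3
  · rw [h3, inner_zero_left]
  · exact h3

theorem qform_add_of_mul_eq_zero (hu : IsBLip u) (hv : IsBLip v) (huv : ∀ y, u y * v y = 0) :
    qform (fun x => u x + v x) = qform u + qform v := by
  have h := qform_add_const_mul hu hv 1
  have h1 : ∫ x, inner ℝ (gradient u x) (gradient v x) = 0 := by
    rw [← integral_zero (Euc n) ℝ]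
    refine integral_congr_ae ?_
    filter_upwards [hu.ae_hasGradientAt, hv.ae_hasGradientAt] with x h1 h2
    exact inner_gradient_eq_zero h1 h2 huv
  simp only [h1, huv, integral_zero, sub_zero, mul_zero, one_mul, one_pow, add_zero] at h
  exact h

/-- Restricting a Lipschitz function to one of two disjoint open sets carrying it. -/
theorem LipschitzWith.indicator_of_disjoint {K : NNReal} {U V : Set (Euc n)}
    (hu : LipschitzWith K u) (hU : IsOpen U) (hV : IsOpen V) (hUV : Disjoint U V)
    (h0 : ∀ x ∉ U ∪ V, u x = 0) : LipschitzWith K (U.indicator u) := by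
  have key : ∀ x ∈ U, ∀ y ∉ U, |u x| ≤ K * dist x y := by
    intro x hx y hy
    obtain ⟨z, hz, hzU⟩ : ∃ z ∈ segment ℝ x y, z ∉ U ∪ V := by
      by_contra! h
      have hyV := (h y (right_mem_segment ℝ x y)).resolve_left hy
      obtain ⟨z, -, hz⟩ := (convex_segment (𝕜 := ℝ) x y).isPreconnected U V hU hV h
        ⟨x, left_mem_segment ℝ x y, hx⟩ ⟨y, right_mem_segment ℝ x y, hyV⟩
      exact disjoint_left.1 hUV hz.1 hz.2
    have h1 := hu.dist_le_mul x z
    rw [Real.dist_eq, h0 z hzU, sub_zero] at h1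
    refine h1.trans ?_
    gcongr
    have := dist_add_dist_of_mem_segment hz
    have := dist_nonneg (x := z) (y := y)
    linarith
  refine LipschitzWith.of_dist_le_mul fun x y => ?_
  by_cases hx : x ∈ U <;> by_cases hy : y ∈ U
  · rw [indicator_of_mem hx, indicator_of_mem hy]
    exact hu.dist_le_mul x y
  · rw [indicator_of_mem hx, indicator_of_notMem hy, Real.dist_eq, sub_zero]
    exact key x hx y hy
  · rw [indicator_of_notMem hx, indicator_of_mem hy, dist_comm, Real.dist_eq, sub_zero, dist_comm]
    exact key y hy x hx
  · rw [indicator_of_notMem hx, indicator_of_notMem hy, dist_self]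
    positivity

end BoundedLipschitz

section BallInequality

/-- The surface measure of the unit sphere in dimension `n + 2`. -/
def ballConst (n : ℕ) : ℝ := (n + 2) * volume.real (ball (0 : Euc n) 1)

variable {n : ℕ}

theorem ballConst_pos (n : ℕ) : 0 < ballConst n :=
  mul_pos (by positivity) (ENNReal.toReal_pos volume_unitBall_ne_zero volume_unitBall_ne_top)

theorem toReal_volume_ball (x : Euc n) {r : ℝ} (hr : 0 ≤ r) :
    (volume (ball x r)).toReal = ballConst n * (r ^ (n + 2) / (n + 2)) := by
  rw [volume_ball_eq, ENNReal.toReal_mul, ENNReal.toReal_pow, ENNReal.toReal_ofReal hr, ballConst,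
    Measure.real]
  field_simp

theorem integral_radial {f : ℝ → ℝ} {R : ℝ} (hR : 0 ≤ R) (hf : ∀ r, R < r → f r = 0) :
    ∫ x : Euc n, f ‖x‖ = ballConst n * ∫ r in (0 : ℝ)..R, f r * r ^ (n + 1) := by
  have h := setIntegral_eq_of_subset_of_forall_sdiff_eq_zero (μ := volume)
    (f := fun r => f r * r ^ (n + 1)) measurableSet_Ioi (Ioc_subset_Ioi_self : Ioc 0 R ⊆ Ioi 0)
    (fun r hr => by
      rw [hf r (by
        by_contra! h
        exact hr.2 ⟨hr.1, h⟩), zero_mul])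
  rw [integral_fun_norm_addHaar volume f, finrank_euclideanSpace_fin,
    intervalIntegral.integral_of_le hR, ← h, ballConst]
  simp only [nsmul_eq_mul, smul_eq_mul, Nat.add_succ_sub_one]
  push_cast
  rw [mul_assoc]
  congr 2
  refine integral_congr_ae (ae_of_all _ fun r => ?_)
  simp only
  ring

/-- The sharp spectral inequality for nonnegative functions with small support. -/
theorem qform_ge_of_nonneg {R : ℝ} (hR : IsAdmRadius n R) {u : Euc n → ℝ} (hu : IsBLip u)
    (hu0 : ∀ x, 0 ≤ u x) (hvol : volume {x | 0 < u x} ≤ volume (ball (0 : Euc n) R)) :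
    radC n R / ballConst n * (∫ x, u x) ^ 2 ≤ qform u := by
  obtain ⟨⟨K, hK⟩, ρ, hρ⟩ := hu
  obtain ⟨M, hM⟩ := exists_bound_of_lipschitz_support hK hρ
  have hκ := ballConst_pos n
  set w := symProfile u with hw
  have hwl : LipschitzWith K w := lipschitzWith_symProfile hK hM hρ
  have hwx := lipschitzWith_comp_norm (n := n) hwl
  have hwR : ∀ r, R ≤ r → w r = 0 := fun r hr =>
    symProfile_eq_zero hM (hvol.trans (measure_mono (ball_subset_ball hr)))
  have hw0 : ∀ r, 0 ≤ w r := symProfile_nonneg hM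
  have hdw : ∀ r, R < r → deriv w r = 0 := by
    intro r hr
    have : w =ᶠ[nhds r] fun _ => 0 := by
      filter_upwards [lt_mem_nhds hr] with s hs using hwR s hs.le
    rw [this.deriv_eq, deriv_const]
  have hlev : ∀ t, 0 ≤ t → volume {x : Euc n | t < w ‖x‖} = volume {x | t < u x} := fun t ht =>
    measure_superlevel_symProfile hM hρ ht
  have e1 : ∫ x, u x = ballConst n * ∫ r in (0 : ℝ)..R, w r * r ^ (n + 1) := by
    rw [← integral_radial hR.1.le fun r hr => hwR r hr.le]
    exact (integral_eq_of_superlevel hwx.continuous.measurable hK.continuous.measurable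
      (fun x => hw0 _) hu0 hlev).symm
  have e2 : ∫ x, u x ^ 2 = ballConst n * ∫ r in (0 : ℝ)..R, w r ^ 2 * r ^ (n + 1) := by
    rw [← integral_radial (f := fun r => w r ^ 2) hR.1.le fun r hr => by simp [hwR r hr.le]]
    exact (integral_sq_eq_of_superlevel hwx.continuous.measurable hK.continuous.measurable
      (fun x => hw0 _) hu0 hlev).symm
  have e3 : ballConst n * ∫ r in (0 : ℝ)..R, deriv w r ^ 2 * r ^ (n + 1) ≤
      ∫ x, ‖gradient u x‖ ^ 2 := by
    rw [← integral_radial (f := fun r => deriv w r ^ 2) hR.1.le fun r hr => by simp [hdw r hr]]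
    refine le_trans ?_ (polya_szego hK hu0 hρ)
    have hb : ∀ x : Euc n, R ≤ ‖x‖ → w ‖x‖ = 0 := fun x hx => hwR _ hx
    refine integral_mono_of_nonneg (ae_of_all _ fun x => sq_nonneg _)
      (integrable_norm_gradient_sq hwx hb) ?_
    filter_upwards [hwx.ae_differentiableAt (μ := volume),
      Measure.ae_ne volume (0 : Euc n)] with x hx hx0
    rw [← sq_abs]
    exact pow_le_pow_left₀ (abs_nonneg _) (abs_deriv_le_norm_gradient hx0 hx) 2
  have h := radial_inequality hR hwl (hwR R le_rfl)
  have hwc := hwl.continuous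
  have i1 : IntervalIntegrable (fun r => w r ^ 2 * r ^ (n + 1)) volume 0 R :=
    (by fun_prop : Continuous _).intervalIntegrable _ _
  have i2 := hwl.intervalIntegrable_deriv_sq_mul (k := fun r => r ^ (n + 1)) (by fun_prop) 0 R
  simp only [sub_mul] at h
  rw [intervalIntegral.integral_sub i2 i1] at h
  rw [qform, e1, e2]
  have h' := mul_le_mul_of_nonneg_left h hκ.le
  calc _ = ballConst n * (radC n R * (∫ r in (0 : ℝ)..R, w r * r ^ (n + 1)) ^ 2) := by
        field_simp
    _ ≤ _ := h'
    _ ≤ _ := by linarith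

/-- The radial extremal function of a ball. -/
def ballFun (n : ℕ) (p : Euc n) (R : ℝ) (x : Euc n) : ℝ :=
  radPhi n (min ‖x - p‖ R) - radPhi n R

variable {p : Euc n} {R : ℝ}

theorem ballFun_eq_zero {x : Euc n} (hx : R ≤ ‖x - p‖) : ballFun n p R x = 0 := by
  rw [ballFun, min_eq_right hx, sub_self]

theorem ballFun_pos (hR : IsAdmRadius n R) {x : Euc n} (hx : ‖x - p‖ < R) :
    0 < ballFun n p R x := by
  rw [ballFun, min_eq_left hx.le, sub_pos]
  exact hR.radPhi_lt (norm_nonneg _) hx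

theorem ballFun_nonneg (hR : IsAdmRadius n R) (x : Euc n) : 0 ≤ ballFun n p R x := by
  rcases lt_or_ge ‖x - p‖ R with h | h
  · exact (ballFun_pos hR h).le
  · rw [ballFun_eq_zero h]

theorem isBLip_ballFun (n : ℕ) (p : Euc n) (R : ℝ) : IsBLip (ballFun n p R) := by
  obtain ⟨L, hL⟩ := lipschitzWith_radPhi n
  refine ⟨⟨L, LipschitzWith.of_dist_le_mul fun x y => ?_⟩, R + ‖p‖, fun x hx => ?_⟩
  · rw [ballFun, ballFun, dist_sub_right]
    refine (hL.dist_le_mul _ _).trans ?_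
    gcongr
    rw [Real.dist_eq]
    refine (abs_min_sub_min_le_max _ _ _ _).trans ?_
    rw [sub_self, abs_zero, max_eq_left (abs_nonneg _), dist_eq_norm]
    refine (abs_norm_sub_norm_le _ _).trans ?_
    rw [sub_sub_sub_cancel_right]
  · refine ballFun_eq_zero ?_
    have := norm_sub_norm_le x p
    linarith

theorem integral_ballFun (p : Euc n) (hR : 0 ≤ R) :
    ∫ x, ballFun n p R x = ballConst n * radD n R := by
  rw [← integral_radPhi_sub]
  have h1 := integral_sub_right_eq_self (μ := volume)
    (fun x : Euc n => radPhi n (min ‖x‖ R) - radPhi n R) p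
  have h2 := integral_radial (n := n) (f := fun r => radPhi n (min r R) - radPhi n R) hR
    fun r hr => by simp [min_eq_right hr.le]
  simp only [ballFun]
  rw [h1, h2]
  congr 1
  refine intervalIntegral.integral_congr fun r hr => ?_
  rw [uIcc_of_le hR] at hr
  simp only [min_eq_left hr.2]

theorem integral_form_self (n : ℕ) (R : ℝ) :
    ∫ r in (0 : ℝ)..R, (radPsi n r ^ 2 - (radPhi n r - radPhi n R) ^ 2) * r ^ (n + 1) =
      radPhi n R * radD n R := by
  obtain ⟨L, hL⟩ := lipschitzWith_radPhi n
  have hf : LipschitzWith L fun r => radPhi n r - radPhi n R := by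
    refine LipschitzWith.of_dist_le_mul fun x y => ?_
    rw [dist_sub_right]
    exact hL.dist_le_mul x y
  have hfd : ∀ r, HasDerivAt (fun r => radPhi n r - radPhi n R) (-radPsi n r) r :=
    fun r => (hasDerivAt_radPhi n r).sub_const _
  have e2 := integral_form_radPhi (n := n) (R := R) hf (sub_self _)
  simp only [(hfd _).deriv] at e2
  rw [integral_radPhi_sub] at e2
  rw [← e2]
  congr 1
  ext r
  ring

theorem norm_gradient_ballFun_le {x : Euc n} (hx : ‖x - p‖ < R) (hxp : x ≠ p) :
    ‖gradient (ballFun n p R) x‖ ≤ |radPsi n ‖x - p‖| := by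
  have hloc : ballFun n p R =ᶠ[nhds x] fun y => radPhi n ‖y - p‖ - radPhi n R := by
    have : ContinuousAt (fun y => ‖y - p‖) x := by fun_prop
    filter_upwards [this.eventually_lt_const hx] with y hy
    rw [ballFun, min_eq_left hy.le]
  have hd : DifferentiableAt ℝ (fun y => ‖y - p‖) x :=
    (differentiableAt_id.sub_const p).norm ℝ (sub_ne_zero.2 hxp)
  have h1 : HasFDerivAt (fun y => radPhi n ‖y - p‖ - radPhi n R)
      (-radPsi n ‖x - p‖ • fderiv ℝ (fun y => ‖y - p‖) x) x :=
    (((hasDerivAt_radPhi n ‖x - p‖).comp_hasFDerivAt x hd.hasFDerivAt).sub_const _)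
  rw [norm_gradient_eq, hloc.fderiv_eq, h1.fderiv, norm_smul, norm_neg, Real.norm_eq_abs]
  refine mul_le_of_le_one_right (abs_nonneg _) ?_
  have hl : LipschitzWith 1 fun y : Euc n => ‖y - p‖ := by
    refine LipschitzWith.of_dist_le_mul fun y z => ?_
    rw [NNReal.coe_one, one_mul, dist_eq_norm y z, Real.dist_eq]
    refine (abs_norm_sub_norm_le _ _).trans ?_
    rw [sub_sub_sub_cancel_right]
  simpa using norm_fderiv_le_of_lipschitz ℝ hl

theorem qform_ballFun_le (p : Euc n) (hR : 0 < R) :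
    qform (ballFun n p R) ≤ ballConst n * (radPhi n R * radD n R) := by
  have hpsi := continuous_radPsi n
  have hphi := continuous_radPhi n
  set G : ℝ → ℝ := fun r => if r ≤ R then radPsi n r ^ 2 else 0 with hG
  have hG0 : ∀ r, 0 ≤ G r := fun r => by
    simp only [hG]
    split_ifs <;> positivity
  have e1 : ∫ x : Euc n, G ‖x - p‖ =
      ballConst n * ∫ r in (0 : ℝ)..R, radPsi n r ^ 2 * r ^ (n + 1) := by
    rw [integral_sub_right_eq_self (μ := volume) (fun x : Euc n => G ‖x‖) p,
      integral_radial (f := G) hR.le fun r hr => if_neg (not_le.2 hr)]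
    congr 1
    refine intervalIntegral.integral_congr fun r hr => ?_
    rw [uIcc_of_le hR.le] at hr
    simp only [hG, if_pos hr.2]
  have e2 : ∫ x, ballFun n p R x ^ 2 =
      ballConst n * ∫ r in (0 : ℝ)..R, (radPhi n r - radPhi n R) ^ 2 * r ^ (n + 1) := by
    have h1 := integral_sub_right_eq_self (μ := volume)
      (fun x : Euc n => (radPhi n (min ‖x‖ R) - radPhi n R) ^ 2) p
    have h2 := integral_radial (n := n) (f := fun r => (radPhi n (min r R) - radPhi n R) ^ 2) hR.le
      fun r hr => by simp [min_eq_right hr.le]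
    simp only [ballFun]
    rw [h1, h2]
    congr 1
    refine intervalIntegral.integral_congr fun r hr => ?_
    rw [uIcc_of_le hR.le] at hr
    simp only [min_eq_left hr.2]
  have hGint : Integrable fun x : Euc n => G ‖x - p‖ := by
    have hc : ContinuousOn (fun x : Euc n => radPsi n ‖x - p‖ ^ 2) (closedBall p R) := by fun_prop
    refine ((hc.integrableOn_compact (isCompact_closedBall p R)).integrable_indicator
      measurableSet_closedBall).congr (ae_of_all _ fun x => ?_)
    simp only [indicator, mem_closedBall, dist_eq_norm, hG]
  have e3 : ∫ x, ‖gradient (ballFun n p R) x‖ ^ 2 ≤ ∫ x : Euc n, G ‖x - p‖ := by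
    refine integral_mono_of_nonneg (ae_of_all _ fun x => sq_nonneg _) hGint ?_
    have hs : ∀ᵐ x : Euc n, x ∉ sphere p R :=
      measure_eq_zero_iff_ae_notMem.1 (Measure.addHaar_sphere_of_ne_zero volume p hR.ne')
    filter_upwards [hs, Measure.ae_ne volume p] with x hxs hxp
    rw [mem_sphere, dist_eq_norm] at hxs
    rcases lt_or_gt_of_ne hxs with h | h
    · simp only [hG, if_pos h.le]
      rw [← sq_abs (radPsi n _)]
      exact pow_le_pow_left₀ (norm_nonneg _) (norm_gradient_ballFun_le h hxp) 2
    · rw [gradient_eq_zero_of_isOpen (U := {x | R < ‖x - p‖})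
        (isOpen_lt continuous_const (by fun_prop)) (fun y hy => ballFun_eq_zero (le_of_lt hy)) h]
      simpa using hG0 _
  rw [qform, e2, ← integral_form_self]
  simp only [sub_mul]
  rw [intervalIntegral.integral_sub ((by fun_prop : Continuous _).intervalIntegrable _ _)
    ((by fun_prop : Continuous _).intervalIntegrable _ _)]
  linarith

theorem exists_linear_le_radPhi_sub (hR : IsAdmRadius n R) :
    ∃ c, 0 < c ∧ ∀ r, 0 ≤ r → r ≤ R → c * (R - r) ≤ radPhi n r - radPhi n R := by
  have hR0 := hR.1
  obtain ⟨q, hq, hmin⟩ := (isCompact_Icc (a := R / 2) (b := R)).exists_isMinOn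
    ⟨R, by constructor <;> linarith⟩ (continuous_radPsi n).continuousOn
  have hc : 0 < radPsi n q := (hR.mono (by linarith [hq.1]) hq.2).radPsi_pos
  have key : ∀ r, R / 2 ≤ r → r ≤ R → radPsi n q * (R - r) ≤ radPhi n r - radPhi n R := by
    intro r h1 h2
    have := (convex_Icc (R / 2) R).image_sub_le_mul_sub_of_deriv_le (f := radPhi n)
      (C := -radPsi n q) (continuous_radPhi n).continuousOn
      (fun s _ => (hasDerivAt_radPhi n s).differentiableAt.differentiableWithinAt) (fun s hs => by
        rw [(hasDerivAt_radPhi n s).deriv]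
        exact neg_le_neg (hmin (interior_subset hs))) r ⟨h1, h2⟩ R ⟨by linarith, le_rfl⟩ h2
    linarith
  refine ⟨radPsi n q / 2, by positivity, fun r h1 h2 => ?_⟩
  rcases le_or_gt (R / 2) r with h | h
  · have := key r h h2
    have := mul_nonneg hc.le (sub_nonneg.2 h2)
    linarith
  · have h3 := key (R / 2) le_rfl (by linarith)
    have h4 := (hR.mono (by linarith) (by linarith : R / 2 ≤ R)).radPhi_lt h1 h
    have : radPsi n q / 2 * (R - r) ≤ radPsi n q * (R - R / 2) := by
      nlinarith
    linarith

theorem abs_le_mul_ballFun (hR : IsAdmRadius n R) {u : Euc n → ℝ} {K : NNReal}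
    (hu : LipschitzWith K u) (h0 : ∀ x ∉ ball p R, u x = 0) :
    ∃ C, 0 < C ∧ ∀ x, |u x| ≤ C * ballFun n p R x := by
  have hR0 := hR.1
  obtain ⟨c, hc, hlin⟩ := exists_linear_le_radPhi_sub hR
  refine ⟨K / c + 1, by positivity, fun x => ?_⟩
  rcases lt_or_ge ‖x - p‖ R with h | h
  swap
  · rw [h0 x (by rwa [mem_ball, dist_eq_norm, not_lt]), ballFun_eq_zero h]
    simp
  have h1 : |u x| ≤ K * (R - ‖x - p‖) := by
    obtain ⟨e, he1, he2⟩ : ∃ e : Euc n, ‖e‖ = 1 ∧ x - p = ‖x - p‖ • e := by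
      by_cases hx : x - p = 0
      · obtain ⟨e, he⟩ := exists_norm_eq (Euc n) zero_le_one
        exact ⟨e, he, by simp [hx]⟩
      · have hx' := norm_ne_zero_iff.2 hx
        refine ⟨‖x - p‖⁻¹ • (x - p), ?_, ?_⟩
        · rw [norm_smul, norm_inv, norm_norm, inv_mul_cancel₀ hx']
        · rw [smul_smul, mul_inv_cancel₀ hx', one_smul]
    have hy : p + R • e ∉ ball p R := by
      rw [mem_ball, dist_eq_norm, add_sub_cancel_left, norm_smul, he1, Real.norm_of_nonneg hR0.le]
      simp
    have h2 := hu.dist_le_mul x (p + R • e)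
    rw [h0 _ hy, Real.dist_eq, sub_zero, dist_eq_norm, show x - (p + R • e) =
      (‖x - p‖ - R) • e by rw [sub_smul, ← he2]; abel, norm_smul, he1, mul_one, Real.norm_eq_abs,
      abs_sub_comm, abs_of_pos (sub_pos.2 h)] at h2
    exact h2
  have h2 := hlin _ (norm_nonneg (x - p)) h.le
  have h3 : ballFun n p R x = radPhi n ‖x - p‖ - radPhi n R := by
    rw [ballFun, min_eq_left h.le]
  have h4 : K / c * (c * (R - ‖x - p‖)) ≤ K / c * ballFun n p R x := by
    rw [h3]
    gcongr
  have h5 : K / c * (c * (R - ‖x - p‖)) = K * (R - ‖x - p‖) := by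
    field_simp
  have := ballFun_nonneg hR (p := p) x
  linarith

/-- The sharp spectral inequality for sign-changing functions on a ball. -/
theorem qform_ge_of_ball (hR : IsAdmRadius n R) {u : Euc n → ℝ} (hu : ∃ K, LipschitzWith K u)
    (h0 : ∀ x ∉ ball p R, u x = 0) :
    radC n R / ballConst n * (∫ x, u x) ^ 2 ≤ qform u := by
  have hκ := ballConst_pos n
  have hD := hR.radD_pos
  have huB : IsBLip u := ⟨hu, R + ‖p‖, fun x hx => h0 x (by
    rw [mem_ball, dist_eq_norm, not_lt]
    have := norm_sub_norm_le x p
    linarith)⟩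
  obtain ⟨K, hK⟩ := hu
  obtain ⟨C, hC, hle⟩ := abs_le_mul_ballFun hR hK h0
  have hF := isBLip_ballFun n p R
  have hsupp : ∀ s : ℝ, ∀ x, x ∉ ball p R → u x + s * ballFun n p R x = 0 := fun s x hx => by
    rw [h0 x hx, ballFun_eq_zero (by rwa [mem_ball, dist_eq_norm, not_lt] at hx)]
    simp
  have hvolle : ∀ v : Euc n → ℝ, (∀ x ∉ ball p R, v x = 0) →
      volume {x | 0 < v x} ≤ volume (ball (0 : Euc n) R) := fun v hv => by
    rw [volume_ball_eq, ← volume_ball_eq p]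
    refine measure_mono fun x hx => ?_
    by_contra h
    rw [mem_ofPred_eq, hv x h] at hx
    exact lt_irrefl _ hx
  have hint : ∀ s : ℝ, ∫ x, (u x + s * ballFun n p R x) =
      (∫ x, u x) + s * (ballConst n * radD n R) := fun s => by
    rw [integral_add huB.integrable (hF.const_mul s).integrable, integral_const_mul,
      integral_ballFun p hR.1.le]
  have hQF : qform (ballFun n p R) ≤ radC n R / ballConst n * (ballConst n * radD n R) ^ 2 := by
    refine (qform_ballFun_le p hR.1).trans_eq ?_
    rw [radC]
    field_simp
  have hpos := qform_ge_of_nonneg hR (huB.add (hF.const_mul C)) (fun x => by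
    have := (abs_le.1 (hle x)).1
    linarith) (hvolle _ (hsupp C))
  have hneg := qform_ge_of_nonneg hR (huB.add (hF.const_mul (-C))).neg (fun x => by
    have := (abs_le.1 (hle x)).2
    linarith) (hvolle _ fun x hx => by rw [hsupp (-C) x hx, neg_zero])
  have hqneg : qform (fun x => -(u x + -C * ballFun n p R x)) =
      qform fun x => u x + -C * ballFun n p R x := by
    simpa using qform_const_mul (huB.add (hF.const_mul (-C))) (-1)
  rw [hint, qform_add_const_mul huB hF] at hpos
  rw [hqneg, integral_neg, neg_sq, hint, qform_add_const_mul huB hF] at hneg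
  have hC2 := mul_le_mul_of_nonneg_left hQF (sq_nonneg C)
  nlinarith

end BallInequality

section Scaling

variable {n : ℕ} {s : ℝ} {Ω : Set (Euc n)} {g : Euc n → ℝ}

theorem rayleigh_comp_smul (hs : 0 < s) (u : Euc n → ℝ) :
    rayleigh (n + 2) (fun x => u (s • x)) = s ^ 2 * rayleigh (n + 2) u := by
  have hc : (0 : ℝ) < |(s ^ Module.finrank ℝ (Euc n))⁻¹| := by positivity
  have h1 : ∫ x : Euc n, ‖gradient (fun x => u (s • x)) x‖ ^ 2 =
      |(s ^ Module.finrank ℝ (Euc n))⁻¹| * (s ^ 2 * ∫ x, ‖gradient u x‖ ^ 2) := by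
    have : ∀ x, ‖gradient (fun x => u (s • x)) x‖ ^ 2 =
        (fun y => s ^ 2 * ‖gradient u y‖ ^ 2) (s • x) := by
      intro x
      simp only [norm_gradient_eq]
      rw [fderiv_comp_smul s, norm_smul, mul_pow, Real.norm_eq_abs, sq_abs]
    simp_rw [this]
    rw [Measure.integral_comp_smul volume (fun y => s ^ 2 * ‖gradient u y‖ ^ 2) s,
      integral_const_mul, smul_eq_mul]
  have h2 : ∫ x : Euc n, u (s • x) ^ 2 =
      |(s ^ Module.finrank ℝ (Euc n))⁻¹| * ∫ x, u x ^ 2 := by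
    rw [Measure.integral_comp_smul volume (fun y => u y ^ 2) s, smul_eq_mul]
  rw [rayleigh, rayleigh, h1, h2, mul_div_mul_left _ _ hc.ne', mul_div_assoc]

/-- The values of the Rayleigh quotient on trial functions for the twisted eigenvalue. -/
def trialValues (Ω : Set (Euc n)) (g : Euc n → ℝ) : Set ℝ :=
  {r | ∃ u, IsDirTrial (n + 2) Ω u ∧ (∫ x, u x * g x) = 0 ∧ rayleigh (n + 2) u = r}

theorem IsDirTrial.comp_smul (hs : 0 < s) {u : Euc n → ℝ} (hu : IsDirTrial (n + 2) Ω u) :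
    IsDirTrial (n + 2) ((fun x => s • x) ⁻¹' Ω) fun x => u (s • x) := by
  obtain ⟨⟨K, hK⟩, h0, h1⟩ := hu
  refine ⟨⟨K * ‖s‖₊, hK.comp (lipschitzWith_smul s)⟩, fun x hx => h0 _ hx, fun h => h1 ?_⟩
  have hc : Continuous fun x : Euc n => u (s • x) := hK.continuous.comp (continuous_const_smul s)
  have h2 := (hc.ae_eq_iff_eq volume continuous_const).1 h
  refine Eventually.of_forall fun x => ?_
  have := congrFun h2 (s⁻¹ • x)
  simpa [smul_smul, hs.ne'] using this

theorem mul_mem_trialValues (hs : 0 < s) {r : ℝ} (hr : r ∈ trialValues Ω g) :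
    s ^ 2 * r ∈ trialValues ((fun x => s • x) ⁻¹' Ω) fun x => g (s • x) := by
  obtain ⟨u, hu, h0, rfl⟩ := hr
  refine ⟨_, hu.comp_smul hs, ?_, rayleigh_comp_smul hs u⟩
  rw [Measure.integral_comp_smul volume (fun y => u y * g y) s, h0, smul_zero]

open scoped Pointwise in
theorem twistedEV_preimage_smul (hs : 0 < s) (Ω : Set (Euc n)) (g : Euc n → ℝ) :
    twistedEV (n + 2) ((fun x => s • x) ⁻¹' Ω) (fun x => g (s • x)) =
      s ^ 2 * twistedEV (n + 2) Ω g := by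
  have h : trialValues ((fun x => s • x) ⁻¹' Ω) (fun x => g (s • x)) =
      s ^ 2 • trialValues Ω g := by
    ext r
    rw [mem_smul_set_iff_inv_smul_mem₀ (by positivity), smul_eq_mul]
    constructor
    · intro hr
      have := mul_mem_trialValues (inv_pos.2 hs) hr
      simpa [preimage_preimage, smul_smul, hs.ne'] using this
    · intro hr
      have := mul_mem_trialValues hs hr
      rwa [mul_inv_cancel_left₀ (by positivity)] at this
  change sInf (trialValues _ _) = s ^ 2 * sInf (trialValues Ω g)
  rw [h, Real.sInf_smul_of_nonneg (by positivity), smul_eq_mul]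

theorem toReal_volume_preimage_smul (hs : 0 < s) (Ω : Set (Euc n)) :
    (volume ((fun x => s • x) ⁻¹' Ω)).toReal = (volume Ω).toReal / s ^ (n + 2) := by
  rw [Measure.addHaar_preimage_smul volume hs.ne', finrank_euclideanSpace_fin,
    abs_of_pos (by positivity), ENNReal.toReal_mul, ENNReal.toReal_ofReal (by positivity)]
  field_simp

theorem preimage_smul_ball (hs : 0 < s) (c : Euc n) (r : ℝ) :
    (fun x => s • x) ⁻¹' ball c r = ball (s⁻¹ • c) (r / s) := by
  ext x
  have : s • x - c = s • (x - s⁻¹ • c) := by simp [smul_sub, smul_smul, hs.ne']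
  simp only [mem_preimage, mem_ball, dist_eq_norm]
  rw [this, norm_smul, Real.norm_of_nonneg hs.le, lt_div_iff₀ hs, mul_comm]

/-- The scale invariant form of the twisted eigenvalue. -/
def scaledEV (Ω : Set (Euc n)) (g : Euc n → ℝ) : ℝ :=
  (volume Ω).toReal ^ ((2 : ℝ) / (n + 2 : ℕ)) * twistedEV (n + 2) Ω g

theorem scaledEV_preimage_smul (hs : 0 < s) (Ω : Set (Euc n)) (g : Euc n → ℝ) :
    scaledEV ((fun x => s • x) ⁻¹' Ω) (fun x => g (s • x)) = scaledEV Ω g := by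
  have h : (s ^ (n + 2)) ^ ((2 : ℝ) / (n + 2 : ℕ)) = s ^ 2 := by
    rw [← Real.rpow_natCast s (n + 2), ← Real.rpow_mul hs.le, mul_div_cancel₀ _ (by positivity)]
    exact_mod_cast Real.rpow_natCast s 2
  rw [scaledEV, scaledEV, twistedEV_preimage_smul hs, toReal_volume_preimage_smul hs,
    Real.div_rpow ENNReal.toReal_nonneg (by positivity), h]
  field_simp

end Scaling

section Bounds

variable {n : ℕ} {Ω : Set (Euc n)} {g u : Euc n → ℝ} {α v : ℝ}

theorem isBLip_of_isBounded (hΩ : Bornology.IsBounded Ω) (hu : ∃ K, LipschitzWith K u)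
    (h0 : ∀ x ∉ Ω, u x = 0) : IsBLip u := by
  obtain ⟨r, hr⟩ := hΩ.subset_ball (0 : Euc n)
  refine ⟨hu, r, fun x hx => h0 x fun h => ?_⟩
  have := hr h
  rw [mem_ball_zero_iff] at this
  linarith

theorem IsBLip.integral_sq_pos (hu : IsBLip u) (h : ¬ u =ᵐ[volume] fun _ => (0 : ℝ)) :
    0 < ∫ x, u x ^ 2 := by
  refine lt_of_le_of_ne (integral_nonneg fun x => sq_nonneg _) fun h0 => h ?_
  have := (integral_eq_zero_iff_of_nonneg (fun x => sq_nonneg (u x)) hu.integrable_sq).1 h0.symm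
  filter_upwards [this] with x hx
  simpa using hx

theorem one_le_rayleigh (hu : IsBLip u) (h : ¬ u =ᵐ[volume] fun _ => (0 : ℝ))
    (hq : 0 ≤ qform u) : 1 ≤ rayleigh (n + 2) u := by
  rw [rayleigh, one_le_div (hu.integral_sq_pos h)]
  rw [qform] at hq
  linarith

theorem rayleigh_le_one (hu : IsBLip u) (h : ¬ u =ᵐ[volume] fun _ => (0 : ℝ))
    (hq : qform u ≤ 0) : rayleigh (n + 2) u ≤ 1 := by
  rw [rayleigh, div_le_one (hu.integral_sq_pos h)]
  rw [qform] at hq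
  linarith

theorem IsBLip.integrable_mul_of_bounded (hu : IsBLip u) (hg : Measurable g)
    (hgα : ∀ᵐ x, α ≤ g x ∧ g x ≤ 1) : Integrable fun x => u x * g x := by
  refine hu.integrable.mul_bdd (c := max |α| 1) hg.aestronglyMeasurable ?_
  filter_upwards [hgα] with x hx
  rw [Real.norm_eq_abs, abs_le]
  have h1 := neg_abs_le α
  have h2 := le_max_left |α| 1
  have h3 := le_max_right |α| 1
  constructor <;> linarith

theorem IsBLip.mul_integral_le (hu : IsBLip u) (hg : Measurable g)
    (hgα : ∀ᵐ x, α ≤ g x ∧ g x ≤ 1) (hu0 : ∀ x, 0 ≤ u x) :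
    α * (∫ x, u x) ≤ ∫ x, u x * g x := by
  rw [← integral_const_mul]
  refine integral_mono_ae (hu.integrable.const_mul α) (hu.integrable_mul_of_bounded hg hgα) ?_
  filter_upwards [hgα] with z hz
  have := mul_le_mul_of_nonneg_left hz.1 (hu0 z)
  linarith

theorem IsBLip.integral_mul_le (hu : IsBLip u) (hg : Measurable g)
    (hgα : ∀ᵐ x, α ≤ g x ∧ g x ≤ 1) (hu0 : ∀ x, 0 ≤ u x) :
    ∫ x, u x * g x ≤ ∫ x, u x := by
  refine integral_mono_ae (hu.integrable_mul_of_bounded hg hgα) hu.integrable ?_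
  filter_upwards [hgα] with z hz
  have := mul_le_mul_of_nonneg_left hz.2 (hu0 z)
  linarith

theorem IsBLip.integral_pos (hu : IsBLip u) (hu0 : ∀ x, 0 ≤ u x) {y : Euc n} (hy : 0 < u y) :
    0 < ∫ x, u x :=
  integral_pos_of_integrable_nonneg_nonzero hu.continuous hu.integrable hu0 hy.ne'

/-- Lower bound for the quadratic form of a nonnegative function with given support volume. -/
theorem qform_ge_volC (hv : 0 < v) (hv2 : v ≤ 2 * volZero n) (hu : IsBLip u)
    (hu0 : ∀ x, 0 ≤ u x) (hvol : (volume {x | 0 < u x}).toReal = ballConst n * v) :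
    volC n v * (∫ x, u x) ^ 2 ≤ ballConst n * qform u := by
  have hκ := ballConst_pos n
  have hr := radOf_pos n hv
  have hle : volume {x | 0 < u x} ≤ volume (ball (0 : Euc n) (radOf n v)) := by
    refine (ENNReal.toReal_le_toReal ?_ measure_ball_lt_top.ne).1 ?_
    · intro h
      rw [h, ENNReal.toReal_top] at hvol
      have := mul_pos hκ hv
      linarith
    · rw [hvol, toReal_volume_ball 0 hr.le, radOf_pow n hv.le]
      field_simp
      exact le_rfl
  have := qform_ge_of_nonneg (isAdmRadius_radOf hv hv2) hu hu0 hle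
  rw [div_mul_eq_mul_div, div_le_iff₀ hκ] at this
  rw [volC]
  linarith

theorem add_sq_mul_nonneg {A B p q : ℝ} (hα : 0 < α) (hp : 0 < p) (hq : 0 < q)
    (hpq : α * p ≤ q) (hqp : α * q ≤ p) (h1 : 0 ≤ A + α ^ 2 * B) (h2 : 0 ≤ B + α ^ 2 * A) :
    0 ≤ A * p ^ 2 + B * q ^ 2 := by
  have e1 : (α * p) ^ 2 ≤ q ^ 2 := by gcongr
  have e2 : (α * q) ^ 2 ≤ p ^ 2 := by gcongr
  rcases le_or_gt 0 A with hA | hA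
  · rcases le_or_gt 0 B with hB | hB
    · positivity
    · nlinarith [mul_nonneg h1 (sq_nonneg q)]
  · rcases le_or_gt 0 B with hB | hB
    · nlinarith [mul_nonneg h2 (sq_nonneg p)]
    · nlinarith [mul_neg_of_pos_of_neg (pow_pos hα 2) hB]

/-- The quadratic form is nonnegative under a weighted mean constraint, for support volumes at
most the optimal one. -/
theorem qform_nonneg_of_constraint (hα0 : 0 < α) {x y : ℝ} (hxy : x + y ≤ 2 * volZero n)
    (hx0 : volC n x + α ^ 2 * volC n y = 0)
    (huniq : ∀ x' y', 0 < x' → 0 < y' → x' + y' ≤ x + y →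
      volC n x' + α ^ 2 * volC n y' ≤ 0 → x' = x ∧ y' = y)
    (hΩ : Bornology.IsBounded Ω) (hvol : (volume Ω).toReal ≤ ballConst n * (x + y))
    (hg : Measurable g) (hgα : ∀ᵐ x, α ≤ g x ∧ g x ≤ 1) (hu : ∃ K, LipschitzWith K u)
    (h0 : ∀ x ∉ Ω, u x = 0) (hug : ∫ x, u x * g x = 0) : 0 ≤ qform u := by
  have hκ := ballConst_pos n
  have hfeas : ∀ a b, 0 < a → 0 < b → a + b ≤ x + y → 0 ≤ volC n a + α ^ 2 * volC n b := by
    intro a b ha hb hab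
    by_contra! h
    obtain ⟨rfl, rfl⟩ := huniq a b ha hb hab h.le
    linarith
  have huB := isBLip_of_isBounded hΩ hu h0
  have hP := huB.posPart
  have hN := huB.neg.posPart
  have hdec : ∀ z, u z = max (u z) 0 + (-1) * max (-u z) 0 := by
    intro z
    rcases le_total 0 (u z) with h | h
    · rw [max_eq_left h, max_eq_right (by linarith)]; ring
    · rw [max_eq_right h, max_eq_left (by linarith)]; ring
  have hq : qform u = qform (fun z => max (u z) 0) + qform fun z => max (-u z) 0 := by
    have h1 := qform_add_of_mul_eq_zero hP (hN.const_mul (-1)) fun z => by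
      rcases le_total 0 (u z) with h | h
      · rw [max_eq_right (by linarith : -u z ≤ 0)]; ring
      · rw [max_eq_right h]; ring
    rw [qform_const_mul hN] at h1
    rw [neg_one_sq, one_mul] at h1
    rw [← h1]
    exact congrArg qform (funext hdec)
  have hPg := hP.integrable_mul_of_bounded hg hgα
  have hNg := hN.integrable_mul_of_bounded hg hgα
  have heq : ∫ z, max (u z) 0 * g z = ∫ z, max (-u z) 0 * g z := by
    have : ∫ z, u z * g z = ∫ z, (max (u z) 0 * g z - max (-u z) 0 * g z) := by
      congr 1 with z
      conv_lhs => rw [hdec z]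
      ring
    rw [this, integral_sub hPg hNg] at hug
    linarith
  have hP0 : ∀ z, 0 ≤ max (u z) 0 := fun z => le_max_right _ _
  have hN0 : ∀ z, 0 ≤ max (-u z) 0 := fun z => le_max_right _ _
  set p := ∫ z, max (u z) 0 with hp
  set q := ∫ z, max (-u z) 0 with hqd
  have hpq : α * p ≤ q :=
    (hP.mul_integral_le hg hgα hP0).trans (heq.le.trans (hN.integral_mul_le hg hgα hN0))
  have hqp : α * q ≤ p :=
    (hN.mul_integral_le hg hgα hN0).trans (heq.ge.trans (hP.integral_mul_le hg hgα hP0))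
  by_cases hz : ∀ z, u z = 0
  · have : u = fun _ => 0 := funext hz
    rw [this]
    have hg : ∀ x, gradient (fun _ : Euc n => (0 : ℝ)) x = 0 := fun x => gradient_const x 0
    simp [qform, hg]
  push Not at hz
  obtain ⟨z, hz⟩ := hz
  have hpn : 0 ≤ p := integral_nonneg hP0
  have hqn : 0 ≤ q := integral_nonneg hN0
  have hpq' : 0 < p ∧ 0 < q := by
    rcases lt_or_gt_of_ne hz with h | h
    · have : 0 < q := hN.integral_pos hN0 (y := z) (lt_max_of_lt_left (by linarith))
      exact ⟨(mul_pos hα0 this).trans_le hqp, this⟩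
    · have : 0 < p := hP.integral_pos hP0 (y := z) (lt_max_of_lt_left h)
      exact ⟨this, (mul_pos hα0 this).trans_le hpq⟩
  obtain ⟨hp0, hq0⟩ := hpq'
  have hset : ∀ f : Euc n → ℝ, IsBLip f → (∀ z, 0 ≤ f z) → 0 < ∫ z, f z →
      (∀ z, 0 < f z → z ∈ Ω) → ∃ a, 0 < a ∧ (volume {z | 0 < f z}).toReal = ballConst n * a := by
    intro f hf hf0 hfp hfΩ
    refine ⟨(volume {z | 0 < f z}).toReal / ballConst n, ?_, by field_simp⟩
    refine div_pos (ENNReal.toReal_pos ?_ ?_) hκ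
    · have ho : IsOpen {z | 0 < f z} := isOpen_lt continuous_const hf.continuous
      refine (ho.measure_pos volume ?_).ne'
      by_contra! h
      have : ∀ z, f z = 0 := fun z => le_antisymm (not_lt.1 fun h' => by
        have : z ∈ {z | 0 < f z} := h'
        rw [h] at this
        exact this) (hf0 z)
      simp [this] at hfp
    · exact ((measure_mono hfΩ).trans_lt hΩ.measure_lt_top).ne
  have hPΩ : ∀ z, 0 < max (u z) 0 → z ∈ Ω := fun z hz => by
    by_contra h
    simp [h0 z h] at hz
  have hNΩ : ∀ z, 0 < max (-u z) 0 → z ∈ Ω := fun z hz => by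
    by_contra h
    simp [h0 z h] at hz
  obtain ⟨a, ha, hva⟩ := hset _ hP hP0 hp0 hPΩ
  obtain ⟨b, hb, hvb⟩ := hset _ hN hN0 hq0 hNΩ
  have hab : a + b ≤ x + y := by
    have hd : Disjoint {z | 0 < max (u z) 0} {z | 0 < max (-u z) 0} := by
      rw [Set.disjoint_left]
      intro z h1 h2
      simp only [mem_ofPred_eq, lt_max_iff, lt_irrefl, or_false] at h1 h2
      linarith
    have hm : MeasurableSet {z | 0 < max (-u z) 0} :=
      (isOpen_lt continuous_const hN.continuous).measurableSet
    have h1 := measure_union (μ := volume) hd hm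
    have h2 : volume ({z | 0 < max (u z) 0} ∪ {z | 0 < max (-u z) 0}) ≤ volume Ω :=
      measure_mono (union_subset hPΩ hNΩ)
    have h3 := ENNReal.toReal_mono hΩ.measure_lt_top.ne h2
    have f1 : volume {z | 0 < max (u z) 0} ≠ ⊤ :=
      ((measure_mono hPΩ).trans_lt hΩ.measure_lt_top).ne
    have f2 : volume {z | 0 < max (-u z) 0} ≠ ⊤ :=
      ((measure_mono hNΩ).trans_lt hΩ.measure_lt_top).ne
    rw [h1, ENNReal.toReal_add f1 f2, hva, hvb, ← mul_add] at h3
    exact le_of_mul_le_mul_left (h3.trans hvol) hκ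
  have hA := qform_ge_volC ha (by linarith) hP hP0 hva
  have hB := qform_ge_volC hb (by linarith) hN hN0 hvb
  have := add_sq_mul_nonneg hα0 hp0 hq0 hpq hqp (hfeas a b ha hb hab)
    (hfeas b a hb ha (by linarith))
  rw [hq]
  refine nonneg_of_mul_nonneg_right (b := qform _ + qform _) ?_ hκ
  rw [mul_add]
  linarith

end Bounds

section Trial

variable {n : ℕ} {Ω : Set (Euc n)} {g : Euc n → ℝ} {α : ℝ} {p q : Euc n} {r s : ℝ}

theorem ballFun_mul_ballFun (hd : Disjoint (ball p r) (ball q s)) (x : Euc n) :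
    ballFun n p r x * ballFun n q s x = 0 := by
  by_cases hx : x ∈ ball p r
  · have := Set.disjoint_left.1 hd hx
    rw [mem_ball, dist_eq_norm, not_lt] at this
    rw [ballFun_eq_zero this, mul_zero]
  · rw [mem_ball, dist_eq_norm, not_lt] at hx
    rw [ballFun_eq_zero hx, zero_mul]

/-- A combination of two radial functions on disjoint balls satisfying the constraint. -/
theorem exists_isDirTrial (hr : IsAdmRadius n r) (hs : IsAdmRadius n s)
    (hd : Disjoint (ball p r) (ball q s)) (hpΩ : ball p r ⊆ Ω) (hqΩ : ball q s ⊆ Ω)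
    (hα : 0 < α) (hg : Measurable g) (hgα : ∀ᵐ x, α ≤ g x ∧ g x ≤ 1) :
    ∃ u, IsDirTrial (n + 2) Ω u ∧ (∫ x, u x * g x) = 0 ∧ IsBLip u ∧
      qform u = (∫ x, ballFun n q s x * g x) ^ 2 * qform (ballFun n p r) +
        (∫ x, ballFun n p r x * g x) ^ 2 * qform (ballFun n q s) := by
  have hP := isBLip_ballFun n p r
  have hQ := isBLip_ballFun n q s
  set a := ∫ x, ballFun n p r x * g x with ha
  set b := ∫ x, ballFun n q s x * g x with hb
  have hb0 : 0 < b := by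
    have hq0 : 0 < ballFun n q s q := ballFun_pos hs (by simpa using hs.1)
    exact (mul_pos hα (hQ.integral_pos (ballFun_nonneg hs) hq0)).trans_le
      (hQ.mul_integral_le hg hgα (ballFun_nonneg hs))
  have hu := (hP.const_mul b).add (hQ.const_mul (-a))
  refine ⟨_, ⟨hu.1, fun x hx => ?_, fun h => ?_⟩, ?_, hu, ?_⟩
  · have h1 : r ≤ ‖x - p‖ := by
      by_contra! h
      exact hx (hpΩ (by rwa [mem_ball, dist_eq_norm]))
    have h2 : s ≤ ‖x - q‖ := by
      by_contra! h
      exact hx (hqΩ (by rwa [mem_ball, dist_eq_norm]))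
    simp [ballFun_eq_zero h1, ballFun_eq_zero h2]
  · have h1 := congrFun ((hu.continuous.ae_eq_iff_eq volume continuous_const).1 h) p
    have hp0 : 0 < ballFun n p r p := ballFun_pos hr (by simpa using hr.1)
    have h2 := ballFun_mul_ballFun hd p
    have h3 : ballFun n q s p = 0 := (mul_eq_zero.1 h2).resolve_left hp0.ne'
    simp only [h3, mul_zero, add_zero] at h1
    exact (mul_pos hb0 hp0).ne' h1
  · have : ∀ x, (b * ballFun n p r x + -a * ballFun n q s x) * g x =
        b * (ballFun n p r x * g x) + -a * (ballFun n q s x * g x) := fun x => by ring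
    simp_rw [this]
    rw [integral_add ((hP.integrable_mul_of_bounded hg hgα).const_mul b)
      ((hQ.integrable_mul_of_bounded hg hgα).const_mul (-a)), integral_const_mul,
      integral_const_mul, ← ha, ← hb]
    ring
  · rw [qform_add_of_mul_eq_zero (hP.const_mul b) (hQ.const_mul (-a)), qform_const_mul hP,
      qform_const_mul hQ, neg_sq]
    intro x
    linear_combination (-a * b) * ballFun_mul_ballFun hd x

theorem trialValues_nonempty (hΩ : IsOpen Ω) (hne : Ω.Nonempty) (hα : 0 < α)
    (hg : Measurable g) (hgα : ∀ᵐ x, α ≤ g x ∧ g x ≤ 1) : (trialValues Ω g).Nonempty := by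
  obtain ⟨z, hz⟩ := hne
  obtain ⟨ρ, hρ, hρΩ⟩ := Metric.isOpen_iff.1 hΩ z hz
  have hv := volZero_pos n
  have h0 : IsAdmRadius n (radOf n (volZero n)) := isAdmRadius_radOf hv (by linarith)
  have hr := h0.mono (s := min (ρ / 4) (radOf n (volZero n)))
    (lt_min (by linarith) h0.1) (min_le_right _ _)
  have hrρ : min (ρ / 4) (radOf n (volZero n)) ≤ ρ / 4 := min_le_left _ _
  obtain ⟨w, hw⟩ := exists_norm_eq (Euc n) (c := ρ / 2) (by linarith)
  have hdist : dist z (z + w) = ρ / 2 := by simp [hw]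
  obtain ⟨u, hu, hug, -⟩ := exists_isDirTrial (p := z) (q := z + w) (Ω := Ω) hr hr
    (ball_disjoint_ball (by rw [hdist]; linarith))
    ((ball_subset_ball (by linarith)).trans hρΩ)
    ((ball_subset_ball' (by rw [dist_comm, hdist]; linarith)).trans hρΩ) hα hg hgα
  exact ⟨_, u, hu, hug, rfl⟩

theorem one_le_twistedEV (hΩ : IsOpen Ω) (hΩb : Bornology.IsBounded Ω) (hne : Ω.Nonempty)
    (hα : 0 < α) (hg : Measurable g) (hgα : ∀ᵐ x, α ≤ g x ∧ g x ≤ 1)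
    (h : ∀ u : Euc n → ℝ, (∃ K, LipschitzWith K u) → (∀ x ∉ Ω, u x = 0) →
      (∫ x, u x * g x) = 0 → 0 ≤ qform u) : 1 ≤ twistedEV (n + 2) Ω g := by
  refine le_csInf (trialValues_nonempty hΩ hne hα hg hgα) ?_
  rintro _ ⟨u, ⟨hu, h0, h1⟩, hug, rfl⟩
  exact one_le_rayleigh (isBLip_of_isBounded hΩb hu h0) h1 (h u hu h0 hug)

theorem twistedEV_le_rayleigh {u : Euc n → ℝ} (hu : IsDirTrial (n + 2) Ω u)
    (hug : ∫ x, u x * g x = 0) : twistedEV (n + 2) Ω g ≤ rayleigh (n + 2) u := by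
  refine csInf_le ⟨0, ?_⟩ ⟨u, hu, hug, rfl⟩
  rintro _ ⟨w, -, -, rfl⟩
  exact div_nonneg (integral_nonneg fun x => by positivity) (integral_nonneg fun x => sq_nonneg _)

theorem measurable_chiBang (α : ℝ) (q : Euc n) (s : ℝ) :
    Measurable (chiBang (n + 2) α (ball q s)) :=
  Measurable.ite measurableSet_ball measurable_const measurable_const

theorem chiBang_bounds (hα1 : α ≤ 1) (B : Set (Euc n)) :
    ∀ᵐ x, α ≤ chiBang (n + 2) α B x ∧ chiBang (n + 2) α B x ≤ 1 := by
  refine Eventually.of_forall fun x => ?_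
  rw [chiBang]
  split_ifs <;> simp [hα1]

theorem twistedEV_pair_le_one (hα0 : 0 < α) (hα1 : α ≤ 1) (hr : IsAdmRadius n r)
    (hs : IsAdmRadius n s) (hd : Disjoint (ball p r) (ball q s))
    (hC : radC n r + α ^ 2 * radC n s ≤ 0) :
    twistedEV (n + 2) (ball p r ∪ ball q s) (chiBang (n + 2) α (ball q s)) ≤ 1 := by
  obtain ⟨u, hu, hug, huB, hq⟩ := exists_isDirTrial hr hs hd subset_union_left subset_union_right
    hα0 (measurable_chiBang α q s) (chiBang_bounds hα1 (ball q s))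
  refine (twistedEV_le_rayleigh hu hug).trans (rayleigh_le_one huB hu.2.2 ?_)
  have h1 : ∫ x, ballFun n p r x * chiBang (n + 2) α (ball q s) x =
      α * (ballConst n * radD n r) := by
    rw [← integral_ballFun p hr.1.le, ← integral_const_mul]
    congr 1 with x
    rw [chiBang]
    split_ifs with hx
    · have := Set.disjoint_right.1 hd hx
      rw [mem_ball, dist_eq_norm, not_lt] at this
      simp [ballFun_eq_zero this]
    · ring
  have h2 : ∫ x, ballFun n q s x * chiBang (n + 2) α (ball q s) x = ballConst n * radD n s := by
    rw [← integral_ballFun q hs.1.le]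
    congr 1 with x
    rw [chiBang]
    split_ifs with hx
    · ring
    · rw [mem_ball, dist_eq_norm, not_lt] at hx
      simp [ballFun_eq_zero hx]
  have hκ := ballConst_pos n
  have hr0 := hr.radD_pos
  have hs0 := hs.radD_pos
  have e1 : radPhi n r = radC n r * radD n r := by rw [radC]; field_simp
  have e2 : radPhi n s = radC n s * radD n s := by rw [radC]; field_simp
  have h3 := mul_le_mul_of_nonneg_left (qform_ballFun_le p hr.1)
    (sq_nonneg (ballConst n * radD n s))
  have h4 := mul_le_mul_of_nonneg_left (qform_ballFun_le q hs.1)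
    (sq_nonneg (α * (ballConst n * radD n r)))
  have h5 := mul_nonpos_of_nonneg_of_nonpos
    (show 0 ≤ ballConst n ^ 3 * radD n r ^ 2 * radD n s ^ 2 by positivity) hC
  rw [e1] at h3
  rw [e2] at h4
  rw [hq, h1, h2]
  linarith

theorem one_le_twistedEV_pair (hα0 : 0 < α) (hα1 : α ≤ 1) (hr : IsAdmRadius n r)
    (hs : IsAdmRadius n s) (hd : Disjoint (ball p r) (ball q s))
    (hC : 0 ≤ radC n r + α ^ 2 * radC n s) :
    1 ≤ twistedEV (n + 2) (ball p r ∪ ball q s) (chiBang (n + 2) α (ball q s)) := by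
  have hb : Bornology.IsBounded (ball p r ∪ ball q s) := isBounded_ball.union isBounded_ball
  refine one_le_twistedEV (isOpen_ball.union isOpen_ball) hb ⟨p, Or.inl (mem_ball_self hr.1)⟩ hα0
    (measurable_chiBang α q s) (chiBang_bounds hα1 (ball q s)) ?_
  rintro u ⟨K, hK⟩ h0 hug
  have hL1 := hK.indicator_of_disjoint isOpen_ball isOpen_ball hd h0
  have hL2 := hK.indicator_of_disjoint isOpen_ball isOpen_ball hd.symm
    (by rwa [union_comm])
  have hz1 : ∀ x ∉ ball p r, (ball p r).indicator u x = 0 := fun x hx => indicator_of_notMem hx u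
  have hz2 : ∀ x ∉ ball q s, (ball q s).indicator u x = 0 := fun x hx => indicator_of_notMem hx u
  have hB1 := isBLip_of_isBounded isBounded_ball ⟨K, hL1⟩ hz1
  have hB2 := isBLip_of_isBounded isBounded_ball ⟨K, hL2⟩ hz2
  have hsum : u = fun x => (ball p r).indicator u x + (ball q s).indicator u x := by
    rw [← Set.indicator_union_of_disjoint hd]
    funext x
    by_cases hx : x ∈ ball p r ∪ ball q s
    · rw [indicator_of_mem hx]
    · rw [indicator_of_notMem hx, h0 x hx]
  have hq : qform u = qform ((ball p r).indicator u) + qform ((ball q s).indicator u) := by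
    conv_lhs => rw [hsum]
    refine qform_add_of_mul_eq_zero hB1 hB2 fun x => ?_
    by_cases hx : x ∈ ball p r
    · rw [hz2 x (Set.disjoint_left.1 hd hx), mul_zero]
    · rw [hz1 x hx, zero_mul]
  have hc : α * (∫ x, (ball p r).indicator u x) + ∫ x, (ball q s).indicator u x = 0 := by
    rw [← hug, ← integral_const_mul, ← integral_add (hB1.integrable.const_mul α) hB2.integrable]
    congr 1 with x
    rw [chiBang]
    split_ifs with hx
    · rw [hz1 x (Set.disjoint_right.1 hd hx), indicator_of_mem hx]; ring
    · by_cases hx' : x ∈ ball p r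
      · rw [hz2 x hx, indicator_of_mem hx']; ring
      · rw [hz2 x hx, hz1 x hx', h0 x (by simp [hx, hx'])]; ring
  have h1 := qform_ge_of_ball hr ⟨K, hL1⟩ hz1
  have h2 := qform_ge_of_ball hs ⟨K, hL2⟩ hz2
  set P := ∫ x, (ball p r).indicator u x
  have hQ : ∫ x, (ball q s).indicator u x = -(α * P) := by linarith
  rw [hQ] at h2
  have h3 : 0 ≤ (radC n r + α ^ 2 * radC n s) / ballConst n * P ^ 2 :=
    mul_nonneg (div_nonneg hC (ballConst_pos n).le) (sq_nonneg P)
  have h4 : (radC n r + α ^ 2 * radC n s) / ballConst n * P ^ 2 =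
      radC n r / ballConst n * P ^ 2 + radC n s / ballConst n * (-(α * P)) ^ 2 := by ring
  rw [hq]
  linarith

theorem toReal_volume_pair (hr : 0 ≤ r) (hs : 0 ≤ s) (hd : Disjoint (ball p r) (ball q s)) :
    (volume (ball p r ∪ ball q s)).toReal =
      ballConst n * (r ^ (n + 2) / (n + 2)) + ballConst n * (s ^ (n + 2) / (n + 2)) := by
  rw [measure_union hd measurableSet_ball,
    ENNReal.toReal_add measure_ball_lt_top.ne measure_ball_lt_top.ne, toReal_volume_ball p hr,
    toReal_volume_ball q hs]

end Trial

section Ratio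

variable {n : ℕ} {α x y : ℝ}

/-- The optimality properties of a pair of (normalized) volumes. -/
structure IsOptimalPair (n : ℕ) (α x y : ℝ) : Prop where
  pos_left : 0 < x
  pos_right : 0 < y
  add_le : x + y ≤ 2 * volZero n
  volC_eq : volC n x + α ^ 2 * volC n y = 0
  unique : ∀ x' y', 0 < x' → 0 < y' → x' + y' ≤ x + y →
    volC n x' + α ^ 2 * volC n y' ≤ 0 → x' = x ∧ y' = y

theorem toReal_volume_pair_radOf {p q : Euc n} (hx : 0 < x) (hy : 0 < y)
    (hd : Disjoint (ball p (radOf n x)) (ball q (radOf n y))) :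
    (volume (ball p (radOf n x) ∪ ball q (radOf n y))).toReal = ballConst n * (x + y) := by
  rw [toReal_volume_pair (radOf_pos n hx).le (radOf_pos n hy).le hd, radOf_pow n hx.le,
    radOf_pow n hy.le]
  field_simp

theorem exists_scaling {V W : ℝ} (n : ℕ) (hV : 0 < V) (hW : 0 < W) :
    ∃ s : ℝ, 0 < s ∧ V / s ^ (n + 2) = W := by
  refine ⟨(V / W) ^ ((n + 2 : ℕ) : ℝ)⁻¹, by positivity, ?_⟩
  rw [Real.rpow_inv_natCast_pow (by positivity) (by omega)]
  field_simp

namespace IsOptimalPair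

theorem le_scaledEV (h : IsOptimalPair n α x y) (hα0 : 0 < α) {Ω : Set (Euc n)} (hΩ : IsOpen Ω)
    (hΩb : Bornology.IsBounded Ω) (hne : Ω.Nonempty) {g : Euc n → ℝ} (hg : Measurable g)
    (hgα : ∀ᵐ z, α ≤ g z ∧ g z ≤ 1) :
    (ballConst n * (x + y)) ^ ((2 : ℝ) / (n + 2 : ℕ)) ≤ scaledEV Ω g := by
  have hκ := ballConst_pos n
  have hx := h.pos_left
  have hy := h.pos_right
  have hV : 0 < (volume Ω).toReal :=
    ENNReal.toReal_pos (hΩ.measure_pos volume hne).ne' hΩb.measure_lt_top.ne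
  obtain ⟨s, hs, hsV⟩ := exists_scaling n hV (show 0 < ballConst n * (x + y) by positivity)
  have hc : Continuous fun z : Euc n => s • z := continuous_const_smul s
  have hvol : (volume ((fun z => s • z) ⁻¹' Ω)).toReal = ballConst n * (x + y) := by
    rw [toReal_volume_preimage_smul hs, hsV]
  have hb : Bornology.IsBounded ((fun z => s • z) ⁻¹' Ω) := by
    obtain ⟨R, hR⟩ := hΩb.subset_ball 0
    refine isBounded_ball.subset ((preimage_mono hR).trans (preimage_smul_ball hs 0 R).subset)
  have hgα' : ∀ᵐ z, α ≤ g (s • z) ∧ g (s • z) ≤ 1 :=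
    (Measure.quasiMeasurePreserving_smul volume hs.ne').ae hgα
  have key : 1 ≤ twistedEV (n + 2) ((fun z => s • z) ⁻¹' Ω) (fun z => g (s • z)) := by
    refine one_le_twistedEV (hΩ.preimage hc) hb ?_ hα0 (hg.comp hc.measurable) hgα' ?_
    · obtain ⟨z, hz⟩ := hne
      exact ⟨s⁻¹ • z, by simpa [smul_smul, hs.ne'] using hz⟩
    · intro u hu h0 hug
      exact qform_nonneg_of_constraint hα0 h.add_le h.volC_eq h.unique hb hvol.le
        (hg.comp hc.measurable) hgα' hu h0 hug
  rw [← scaledEV_preimage_smul hs, scaledEV, hvol]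
  exact le_mul_of_one_le_right (by positivity) key

theorem isAdmRadius (h : IsOptimalPair n α x y) :
    IsAdmRadius n (radOf n x) ∧ IsAdmRadius n (radOf n y) := by
  have hx := h.pos_left
  have hy := h.pos_right
  have := h.add_le
  exact ⟨isAdmRadius_radOf hx (by linarith), isAdmRadius_radOf hy (by linarith)⟩

theorem scaledEV_radOf_le (h : IsOptimalPair n α x y) (hα0 : 0 < α) (hα1 : α ≤ 1) {p q : Euc n}
    (hd : Disjoint (ball p (radOf n x)) (ball q (radOf n y))) :
    scaledEV (ball p (radOf n x) ∪ ball q (radOf n y))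
        (chiBang (n + 2) α (ball q (radOf n y))) ≤
      (ballConst n * (x + y)) ^ ((2 : ℝ) / (n + 2 : ℕ)) := by
  rw [scaledEV, toReal_volume_pair_radOf h.pos_left h.pos_right hd]
  have := (ballConst_pos n).le
  have hx := h.pos_left
  have hy := h.pos_right
  exact mul_le_of_le_one_right (by positivity)
    (twistedEV_pair_le_one hα0 hα1 h.isAdmRadius.1 h.isAdmRadius.2 hd h.volC_eq.le)

theorem scaledEV_pair_le (h : IsOptimalPair n α x y) (hα0 : 0 < α) (hα1 : α ≤ 1) {p q : Euc n}
    {r s : ℝ} (hr : 0 < r) (hs : 0 < s) (hd : Disjoint (ball p r) (ball q s))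
    (hvol : (volume (ball q s)).toReal = y / x * (volume (ball p r)).toReal) :
    scaledEV (ball p r ∪ ball q s) (chiBang (n + 2) α (ball q s)) ≤
      (ballConst n * (x + y)) ^ ((2 : ℝ) / (n + 2 : ℕ)) := by
  have hx := h.pos_left
  have hy := h.pos_right
  have hrx := radOf_pos n hx
  have hry := radOf_pos n hy
  have hκ := ballConst_pos n
  set t := r / radOf n x with ht
  have ht0 : 0 < t := div_pos hr hrx
  have e1 : r / t = radOf n x := by rw [ht]; field_simp
  have e2 : s / t = radOf n y := by
    refine (pow_left_inj₀ (div_pos hs ht0).le hry.le (n := n + 2) (by omega)).1 ?_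
    rw [toReal_volume_ball q hs.le, toReal_volume_ball p hr.le] at hvol
    have h1 : s ^ (n + 2) = y / x * r ^ (n + 2) := by
      field_simp at hvol ⊢
      linarith
    have h2 : (r / t) ^ (n + 2) = (n + 2) * x := by rw [e1, radOf_pow n hx.le]
    rw [div_pow] at h2
    rw [div_pow, h1, mul_div_assoc, h2, radOf_pow n hy.le]
    field_simp
  have hd' := hd.preimage fun z : Euc n => t • z
  rw [preimage_smul_ball ht0, preimage_smul_ball ht0, e1, e2] at hd'
  have hpre := scaledEV_preimage_smul ht0 (ball p r ∪ ball q s) (chiBang (n + 2) α (ball q s))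
  have hchi : (fun z => chiBang (n + 2) α (ball q s) (t • z)) =
      chiBang (n + 2) α ((fun z => t • z) ⁻¹' ball q s) := rfl
  rw [hchi, preimage_union, preimage_smul_ball ht0, preimage_smul_ball ht0, e1, e2] at hpre
  rw [← hpre]
  exact h.scaledEV_radOf_le hα0 hα1 hd'

theorem goodRatio (h : IsOptimalPair n α x y) (hα0 : 0 < α) (hα1 : α ≤ 1) :
    GoodRatio (n + 2) α (y / x) := by
  intro Ω hΩ hΩb hne g hg hgα p q r s hr hs hd hvol
  exact (h.scaledEV_pair_le hα0 hα1 hr hs hd hvol).trans (h.le_scaledEV hα0 hΩ hΩb hne hg hgα)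

theorem eq_of_goodRatio (h : IsOptimalPair n α x y) (hα0 : 0 < α) (hα1 : α ≤ 1) {m : ℝ} (hm : 0 < m)
    (hgood : GoodRatio (n + 2) α m) : m = y / x := by
  have hx := h.pos_left
  have hy := h.pos_right
  have hxy := h.add_le
  have hκ := ballConst_pos n
  by_contra hne
  set x' := (x + y) / (1 + m) with hx'
  set y' := m * x' with hy'
  have hx'0 : 0 < x' := by positivity
  have hy'0 : 0 < y' := by positivity
  have hsum : x' + y' = x + y := by rw [hy', hx']; field_simp
  have hpos : 0 < volC n x' + α ^ 2 * volC n y' := by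
    by_contra! hle
    obtain ⟨h1, h2⟩ := h.unique x' y' hx'0 hy'0 hsum.le hle
    refine hne ?_
    rw [← h1, ← h2, hy']
    field_simp
  have hc : ContinuousAt (fun t => volC n (t * x') + α ^ 2 * volC n (t * y')) 1 := by
    refine ContinuousAt.add ?_ (ContinuousAt.mul continuousAt_const ?_)
    · refine ContinuousAt.comp (g := volC n) (f := fun t => t * x') ?_ (by fun_prop)
      rw [one_mul]
      exact volC_continuousAt hx'0 (by linarith)
    · refine ContinuousAt.comp (g := volC n) (f := fun t => t * y') ?_ (by fun_prop)
      rw [one_mul]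
      exact volC_continuousAt hy'0 (by linarith)
  have hev1 : ∀ᶠ t in nhds (1 : ℝ), 0 < volC n (t * x') + α ^ 2 * volC n (t * y') :=
    hc.eventually (lt_mem_nhds (by simpa using hpos))
  have hev2 : ∀ z, z < 2 * volZero n → ∀ᶠ t in nhds (1 : ℝ), t * z < 2 * volZero n := by
    intro z hz
    have hcz : Continuous fun t : ℝ => t * z := by fun_prop
    exact hcz.continuousAt.eventually (gt_mem_nhds (by simpa using hz))
  have hev := hev1.and ((hev2 x' (by linarith)).and (hev2 y' (by linarith)))
  obtain ⟨t, ⟨hpos', hlex, hley⟩, ht1⟩ :=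
    ((hev.filter_mono nhdsWithin_le_nhds).and (self_mem_nhdsWithin (s := Ioi (1 : ℝ)))).exists
  have ht1 : 1 < t := ht1
  have ht0 : 0 < t := by linarith
  have htx : 0 < t * x' := by positivity
  have hty : 0 < t * y' := by positivity
  have hex : ∀ r s : ℝ, 0 < r → 0 < s → ∃ q : Euc n, Disjoint (ball (0 : Euc n) r) (ball q s) := by
    intro r s hr hs
    obtain ⟨q, hq⟩ := exists_norm_eq (Euc n) (c := r + s) (by linarith)
    exact ⟨q, ball_disjoint_ball (by simp [hq])⟩
  obtain ⟨q, hd⟩ := hex _ _ (radOf_pos n htx) (radOf_pos n hty)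
  obtain ⟨q₀, hd₀⟩ := hex _ _ (radOf_pos n hx) (radOf_pos n hy)
  have hupper := h.scaledEV_radOf_le hα0 hα1 hd₀
  have hmid := hgood (ball 0 (radOf n x) ∪ ball q₀ (radOf n y)) (isOpen_ball.union isOpen_ball)
    (isBounded_ball.union isBounded_ball) ⟨0, Or.inl (mem_ball_self (radOf_pos n hx))⟩
    (chiBang (n + 2) α (ball q₀ (radOf n y))) (measurable_chiBang α q₀ _)
    (chiBang_bounds hα1 _) 0 q (radOf n (t * x')) (radOf n (t * y')) (radOf_pos n htx)
    (radOf_pos n hty) hd (by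
      rw [toReal_volume_ball _ (radOf_pos n htx).le, toReal_volume_ball _ (radOf_pos n hty).le,
        radOf_pow n htx.le, radOf_pow n hty.le, hy']
      field_simp)
  have hlower := one_le_twistedEV_pair hα0 hα1 (isAdmRadius_radOf htx hlex.le)
    (isAdmRadius_radOf hty hley.le) hd hpos'.le
  rw [toReal_volume_pair_radOf htx hty hd] at hmid
  have h1 : (ballConst n * (x + y)) ^ ((2 : ℝ) / (n + 2 : ℕ)) <
      (ballConst n * (t * x' + t * y')) ^ ((2 : ℝ) / (n + 2 : ℕ)) := by
    refine Real.rpow_lt_rpow (by positivity) ?_ (by positivity)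
    rw [← mul_add, hsum]
    have : 0 < x + y := by positivity
    have := mul_lt_mul_of_pos_right ht1 this
    refine mul_lt_mul_of_pos_left ?_ hκ
    linarith
  have h2 := le_mul_of_one_le_right (Real.rpow_nonneg (show 0 ≤ ballConst n * (t * x' + t * y')
    by positivity) ((2 : ℝ) / (n + 2 : ℕ))) hlower
  exact absurd (h1.trans_le (h2.trans (hmid.trans hupper))) (lt_irrefl _)

end IsOptimalPair

end Ratio

/-- there is a unique measure ratio `m ∈ (0,1]` for which the isoperimetric
inequality for twisted eigenvalues holds; moreover `m ≥ α^{d/(d-1)}`. -/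
theorem stmt13 (d : ℕ) (hd : 2 ≤ d) (α : ℝ) (hα0 : 0 < α) (hα1 : α ≤ 1) :
    ∃ m : ℝ, (0 < m ∧ m ≤ 1 ∧ GoodRatio d α m) ∧
      α ^ ((d : ℝ) / ((d : ℝ) - 1)) ≤ m ∧
      ∀ m' : ℝ, 0 < m' → m' ≤ 1 → GoodRatio d α m' → m' = m := by
  obtain ⟨n, rfl⟩ := Nat.exists_eq_add_of_le' hd
  obtain ⟨x, y, hx, hy, hyx, hxy, hC, huniq, hrad⟩ := exists_optimal_volumes n hα0 hα1
  have h : IsOptimalPair n α x y := ⟨hx, hy, hxy, hC, huniq⟩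
  exact ⟨y / x, ⟨div_pos hy hx, (div_le_one hx).2 hyx, h.goodRatio hα0 hα1⟩,
    rpow_le_div_of_radOf hα0 hx hy hrad, fun m hm _ hgood => h.eq_of_goodRatio hα0 hα1 hm hgood⟩
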